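/- Let W be an n-dimensional vector space and 𝓘=(I^1,…,I^s) an s-tuple of subsets of [n], each of cardinality r. Then for a generic point 𝓔 ∈ Fl(W)^s, the intersection ∩_{j=1}^{s} Ω°_{I^j}(E^j_•) has an open dense subset of points at which the smooth varieties Ω°_{I^1}(E^1_•),…,Ω°_{I^s}(E^s_•) meet transversally. -/

import Mathlib

noncomputable section

open Module Submodule

/-! ### Polynomial functions and the Zariski topology on a vector space -/

/-- Evaluation of a polynomial in linear functionals at a point of a vector space.
These are exactly the polynomial functions on a finite-dimensional vector space. -/
def mEval (k : Type*) {M : Type*} [Field k] [AddCommGroup M] [Module k M]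
    (x : M) (p : MvPolynomial (Module.Dual k M) k) : k :=
  MvPolynomial.eval (fun l : Module.Dual k M => l x) p

/-- The Zariski topology on a (finite-dimensional) vector space, generated by the
complements of zero sets of polynomial functions. -/
def mZariski (k M : Type*) [Field k] [AddCommGroup M] [Module k M] :
    TopologicalSpace M :=
  TopologicalSpace.generateFrom
    {U : Set M | ∃ p : MvPolynomial (Module.Dual k M) k, U = {x : M | mEval k x p ≠ 0}}

/-- The Zariski tangent space at a point `x` to a subset `A` of a vector space:
the common kernel of the differentials at `x` of all polynomial functions vanishing on `A`. -/
def mTangent (k : Type*) {M : Type*} [Field k] [AddCommGroup M] [Module k M]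
    (A : Set M) (x : M) : Submodule k M :=
  letI := Classical.decEq (Module.Dual k M)
  ⨅ p ∈ {p : MvPolynomial (Module.Dual k M) k | ∀ a ∈ A, mEval k a p = 0},
    LinearMap.ker (∑ l ∈ p.vars, mEval k x (MvPolynomial.pderiv l p) • (l : Module.Dual k M))

/-- `f : M → N` is a polynomial map on a subset `A ⊆ M`. -/
def IsPolyOn (k : Type*) {M N : Type*} [Field k] [AddCommGroup M] [Module k M]
    [AddCommGroup N] [Module k N] (A : Set M) (f : M → N) : Prop :=
  ∀ l : Module.Dual k N, ∃ p : MvPolynomial (Module.Dual k M) k, ∀ x ∈ A, l (f x) = mEval k x p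

/-- Dimension (topological Krull dimension) of a subset of a topological space. -/
def subDim {α : Type*} (t : TopologicalSpace α) (C : Set α) : WithBot ℕ∞ :=
  @topologicalKrullDim C (TopologicalSpace.induced (Subtype.val : C → α) t)

/-- The irreducible components of a subset `A` of a topological space
(for the subspace topology). -/
def subComponents {α : Type*} (t : TopologicalSpace α) (A : Set α) : Set (Set ↥A) :=
  @irreducibleComponents A (TopologicalSpace.induced (Subtype.val : A → α) t)

/-- Dimension of a subset `C` of a subspace `A` of a topological space. -/
def compDim {α : Type*} (t : TopologicalSpace α) (A : Set α) (C : Set ↥A) : WithBot ℕ∞ :=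
  subDim (TopologicalSpace.induced (Subtype.val : A → α) t) C

/-! ### Flags, Schubert cells and Schubert varieties -/

/-- A complete flag on a finite-dimensional vector space, recorded as the increasing
function sending `m` to the `m`-th member (of dimension `m`) of the flag. -/
def IsFlag {k M : Type*} [Field k] [AddCommGroup M] [Module k M]
    (E : ℕ → Submodule k M) : Prop :=
  Monotone E ∧ ∀ m : ℕ, finrank k ↥(E m) = min m (finrank k M)

/-- Membership of `V` in the (open) Schubert cell `Ω°_I(E_•) ⊆ Gr(r, M)` attached to the
subset `I ⊆ [n]` recorded by the strictly increasing tuple `i : Fin r → Fin n`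
(`0`-indexed: the `1`-based subset is `{i a + 1}`): `dim (V ∩ E_u) = #{a | i_a ≤ u}`. -/
def cellMem {k M : Type*} [Field k] [AddCommGroup M] [Module k M] {n r : ℕ}
    (i : Fin r → Fin n) (E : ℕ → Submodule k M) (V : Submodule k M) : Prop :=
  finrank k ↥V = r ∧
    ∀ u : ℕ, u ≤ n →
      finrank k ↥(V ⊓ E u) =
        (Finset.univ.filter (fun a : Fin r => (i a : ℕ) + 1 ≤ u)).card

/-- Membership of `V` in the (closed) Schubert variety `Ω_I(E_•) ⊆ Gr(r, M)`:
`dim (V ∩ E_{i_a}) ≥ a` for `a = 1, …, r`. -/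
def varMem {k M : Type*} [Field k] [AddCommGroup M] [Module k M] {n r : ℕ}
    (i : Fin r → Fin n) (E : ℕ → Submodule k M) (V : Submodule k M) : Prop :=
  finrank k ↥V = r ∧ ∀ a : Fin r, (a : ℕ) + 1 ≤ finrank k ↥(V ⊓ E ((i a : ℕ) + 1))

/-- The flag induced on a subspace `V` by a flag `E` on `M`: its `a`-th member is the
smallest subspace of the form `V ∩ E_u` of dimension `≥ a`. -/
def indSub {k M : Type*} [Field k] [AddCommGroup M] [Module k M]
    (E : ℕ → Submodule k M) (V : Submodule k M) : ℕ → Submodule k ↥V := fun a =>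
  ⨅ u ∈ {u : ℕ | a ≤ finrank k ↥(Submodule.comap V.subtype (E u))},
    Submodule.comap V.subtype (E u)

/-- The flag induced on the quotient `M ⧸ V` by a flag `E` on `M`: its `b`-th member is
the smallest subspace of the form `(E_u + V)/V` of dimension `≥ b`. -/
def indQuot {k M : Type*} [Field k] [AddCommGroup M] [Module k M]
    (E : ℕ → Submodule k M) (V : Submodule k M) : ℕ → Submodule k (M ⧸ V) := fun b =>
  ⨅ u ∈ {u : ℕ | b ≤ finrank k ↥(Submodule.map V.mkQ (E u))},
    Submodule.map V.mkQ (E u)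

/-- The flag spanned by a tuple of vectors (a complete flag when the tuple is a basis). -/
def spanFlag (k : Type*) {M : Type*} [Field k] [AddCommGroup M] [Module k M] {r : ℕ}
    (b : Fin r → M) : ℕ → Submodule k M := fun m =>
  Submodule.span k (b '' {a : Fin r | (a : ℕ) < m})

/-- `P` holds for a generic point of `Fl(M)^s` (`r = dim M`): there is a nonempty Zariski
open set of `s`-tuples of bases of `M` on which the associated tuples of complete flags
satisfy `P`. -/
def GenericFlags (k : Type*) {M : Type*} [Field k] [AddCommGroup M] [Module k M]
    (s r : ℕ) (P : (Fin s → ℕ → Submodule k M) → Prop) : Prop :=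
  ∃ U : Set (Fin s → Fin r → M),
    @IsOpen _ (mZariski k (Fin s → Fin r → M)) U ∧
    (∃ b ∈ U, ∀ j, LinearIndependent k (b j)) ∧
    ∀ b ∈ U, (∀ j, LinearIndependent k (b j)) → P (fun j => spanFlag k (b j))

/-- `P` holds for a generic point of `Fl(M)^s × Fl(Q)^s` (`r = dim M`, `q = dim Q`). -/
def GenericFlagPairs (k : Type*) {M Q : Type*} [Field k] [AddCommGroup M] [Module k M]
    [AddCommGroup Q] [Module k Q] (s r q : ℕ)
    (P : (Fin s → ℕ → Submodule k M) → (Fin s → ℕ → Submodule k Q) → Prop) : Prop :=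
  ∃ U : Set ((Fin s → Fin r → M) × (Fin s → Fin q → Q)),
    @IsOpen _ (mZariski k ((Fin s → Fin r → M) × (Fin s → Fin q → Q))) U ∧
    (∃ b ∈ U, (∀ j, LinearIndependent k (b.1 j)) ∧ ∀ j, LinearIndependent k (b.2 j)) ∧
    ∀ b ∈ U, ((∀ j, LinearIndependent k (b.1 j)) ∧ ∀ j, LinearIndependent k (b.2 j)) →
      P (fun j => spanFlag k (b.1 j)) (fun j => spanFlag k (b.2 j))

/-! ### The spaces `Hom_𝓘(V, Q, 𝓕, 𝓖)` -/

/-- The subspace `{φ : M →ₗ Q | φ(p) ⊆ q}` of `Hom(M, Q)`. -/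
def homConstraint {k M Q : Type*} [Field k] [AddCommGroup M] [Module k M]
    [AddCommGroup Q] [Module k Q] (p : Submodule k M) (q : Submodule k Q) :
    Submodule k (M →ₗ[k] Q) :=
  LinearMap.ker ((LinearMap.llcomp k ↥p Q (Q ⧸ q) q.mkQ).comp (LinearMap.lcomp k Q p.subtype))

/-- `Hom_𝓘(M, Q, F, G) = {φ | φ(F^j_a) ⊆ G^j_{i^j_a - a} for all a = 1, …, r, j = 1, …, s}`. -/
def homSpace {k M Q : Type*} [Field k] [AddCommGroup M] [Module k M]
    [AddCommGroup Q] [Module k Q] {n r s : ℕ} (I : Fin s → Fin r → Fin n)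
    (F : Fin s → ℕ → Submodule k M) (G : Fin s → ℕ → Submodule k Q) :
    Submodule k (M →ₗ[k] Q) :=
  ⨅ j : Fin s, ⨅ a : Fin r,
    homConstraint (F j ((a : ℕ) + 1)) (G j ((I j a : ℕ) - (a : ℕ)))

/-! ### Charts on the Grassmannian, tangent spaces to Schubert cells -/

/-- The graph of `ψ : V →ₗ C`, a point of the Grassmannian chart around `V`
determined by a complement `C` of `V`. -/
def graphMap {k M : Type*} [Field k] [AddCommGroup M] [Module k M]
    (V C : Submodule k M) (ψ : ↥V →ₗ[k] ↥C) : Submodule k M :=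
  LinearMap.range (V.subtype + C.subtype ∘ₗ ψ)

/-- The canonical identification `Hom(V, C) ≃ Hom(V, M/V)` (derivative of the chart). -/
def conjMap {k M : Type*} [Field k] [AddCommGroup M] [Module k M]
    (V C : Submodule k M) : (↥V →ₗ[k] ↥C) →ₗ[k] (↥V →ₗ[k] M ⧸ V) :=
  LinearMap.llcomp k ↥V ↥C (M ⧸ V) (V.mkQ ∘ₗ C.subtype)

/-- The tangent space at `V` to a set `S` of points of the Grassmannian `Gr(r, M)`,
computed in the chart determined by a complement `C` of `V` and viewed inside
`Hom(V, M/V)` via the canonical identification. -/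
def grTangent {k M : Type*} [Field k] [AddCommGroup M] [Module k M]
    (S : Set (Submodule k M)) (V C : Submodule k M) :
    Submodule k (↥V →ₗ[k] (M ⧸ V)) :=
  Submodule.map (conjMap V C)
    (mTangent k {ψ : ↥V →ₗ[k] ↥C | graphMap V C ψ ∈ S} 0)

/-- The Zariski topology on the Grassmannian of `r`-dimensional subspaces of `M`
(as a topology on `Submodule k M`), coinduced from the Stiefel parameterization by
spanning `r`-tuples. -/
def grTop (k : Type*) {M : Type*} [Field k] [AddCommGroup M] [Module k M] (r : ℕ) :
    TopologicalSpace (Submodule k M) :=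
  TopologicalSpace.coinduced (fun b : Fin r → M => Submodule.span k (Set.range b))
    (mZariski k (Fin r → M))

/-! ### Numerical quantities -/

/-- `codim ω_I = ∑_{a=1}^r (n - r + a - i_a)` (as an integer). -/
def codimZ (n r : ℕ) (i : Fin r → Fin n) : ℤ :=
  ∑ a : Fin r, ((n : ℤ) - (r : ℤ) + ((a : ℕ) : ℤ) - ((i a : ℕ) : ℤ))

/-- The quantity `∑_j ∑_{a ∈ K^j} (n - r + a - i^j_a) - d(n - r)` of Inequality `(†^𝓘_𝓚)`. -/
def daggerZ (n r d : ℕ) {s : ℕ} (I : Fin s → Fin r → Fin n)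
    (K : Fin s → Fin d → Fin r) : ℤ :=
  (∑ j : Fin s, ∑ t : Fin d,
      ((n : ℤ) - (r : ℤ) + ((K j t : ℕ) : ℤ) - ((I j (K j t) : ℕ) : ℤ)))
    - (d : ℤ) * ((n : ℤ) - (r : ℤ))

/-- The expected dimension `dim(S, M, 𝓕) = d(m - d) - ∑_j ∑_{t=1}^d (m - d + t - k^j_t)`
of an intersection of Schubert cells `Ω°_{K^j}` in `Gr(d, m)`. -/
def eDimZ {s : ℕ} (m d : ℕ) (K : Fin s → Fin d → Fin m) : ℤ :=
  (d : ℤ) * ((m : ℤ) - (d : ℤ)) -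
    ∑ j : Fin s, ∑ t : Fin d,
      ((m : ℤ) - (d : ℤ) + ((t : ℕ) : ℤ) - ((K j t : ℕ) : ℤ))

/-- `codim ω_I` as a natural number. -/
def codimN (n r : ℕ) (i : Fin r → Fin n) : ℕ :=
  ∑ a : Fin r, ((n - r + (a : ℕ)) - (i a : ℕ))

/-! ### The cohomology ring of the Grassmannian, Schubert classes -/

/-- The ideal `(h_{n-r+1}, …, h_n)` of the polynomial ring in `r` variables
(`h_m` the complete homogeneous symmetric polynomials). -/
def grassIdeal (r n : ℕ) : Ideal (MvPolynomial (Fin r) ℤ) :=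
  Ideal.span ((fun m : ℕ => MvPolynomial.hsymm (Fin r) ℤ m) '' Set.Icc (n - r + 1) n)

/-- A presentation of the cohomology (Chow) ring `H^*(Gr(r,n))`: products of Schubert
classes vanish here exactly when they vanish in `H^*(Gr(r,n))`. -/
abbrev grassRing (r n : ℕ) : Type :=
  MvPolynomial (Fin r) ℤ ⧸ grassIdeal r n

/-- `h_m` for an integer `m` (zero for negative `m`). -/
def hkZ (r : ℕ) (m : ℤ) : MvPolynomial (Fin r) ℤ :=
  if 0 ≤ m then MvPolynomial.hsymm (Fin r) ℤ m.toNat else 0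

/-- The Schur polynomial (Jacobi–Trudi determinant) of the partition
`λ_a = n - r + a - i_a` attached to the subset `I ⊆ [n]` recorded by `i`. -/
def schurI {n r : ℕ} (i : Fin r → Fin n) : MvPolynomial (Fin r) ℤ :=
  Matrix.det (Matrix.of fun a b : Fin r =>
    hkZ r ((n : ℤ) - (r : ℤ) + ((b : ℕ) : ℤ) - ((i a : ℕ) : ℤ)))

/-- The Schubert class `ω_I ∈ H^*(Gr(r,n))` of the subset `I ⊆ [n]` recorded by the
strictly increasing tuple `i : Fin r → Fin n`. -/
def omegaCls {n r : ℕ} (i : Fin r → Fin n) : grassRing r n :=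
  Ideal.Quotient.mk (grassIdeal r n) (schurI i)

/-- The class of a point in `H^*(Gr(r,n))`: the Schubert class of `I = {1, …, r}`. -/
def pointCls (r n : ℕ) (h : r ≤ n) : grassRing r n :=
  omegaCls (fun a : Fin r => Fin.castLE h a)

/-! ### Schur polynomials of partitions, Littlewood–Richardson coefficients -/

/-- The Schur polynomial of a partition with at most `r` parts, via Jacobi–Trudi. -/
def schurP {r : ℕ} (lam : Fin r → ℕ) : MvPolynomial (Fin r) ℤ :=
  Matrix.det (Matrix.of fun a b : Fin r =>
    hkZ r (((lam a : ℕ) : ℤ) - ((a : ℕ) : ℤ) + ((b : ℕ) : ℤ)))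

/-- The Vandermonde alternant `a_δ = det(x_a^{r-1-b})`. -/
def alternant (r : ℕ) : MvPolynomial (Fin r) ℤ :=
  Matrix.det (Matrix.of fun a b : Fin r => (MvPolynomial.X a) ^ (r - 1 - (b : ℕ)))

/-- The coefficient of the Schur polynomial `s_δ` in a symmetric polynomial `f`
(in `r` variables): the coefficient of the monomial `x^{δ + (r-1, …, 1, 0)}` in `f ⬝ a_δ`. -/
def schurCoeff (r : ℕ) (f : MvPolynomial (Fin r) ℤ) (δ : Fin r → ℕ) : ℤ :=
  MvPolynomial.coeff
    (Finsupp.equivFunOnFinite.symm (fun a : Fin r => δ a + (r - 1 - (a : ℕ))))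
    (f * alternant r)

/-- The Littlewood–Richardson coefficient `c^λ_{μ,ν}` (partitions with at most `r` parts):
the multiplicity of `V_λ` in `V_μ ⊗ V_ν`, i.e. of `s_λ` in `s_μ s_ν`. -/
def lrCoeff (r : ℕ) (lam mu nu : Fin r → ℕ) : ℤ :=
  schurCoeff r (schurP mu * schurP nu) lam

/-- The multiplicity of `V_δ` in `V_{Λ 1} ⊗ ⋯ ⊗ V_{Λ t}` (as `GL(r)`-representations),
i.e. of `s_δ` in `∏_j s_{Λ j}`. -/
def multiCoeff (r : ℕ) {t : ℕ} (Λ : Fin t → Fin r → ℕ) (δ : Fin r → ℕ) : ℤ :=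
  schurCoeff r (∏ j : Fin t, schurP (Λ j)) δ

section PolynomialFunctions

variable {k E F G H : Type*} [Field k] [AddCommGroup E] [Module k E]
  [AddCommGroup F] [Module k F] [AddCommGroup G] [Module k G] [AddCommGroup H] [Module k H]

/-- The algebra of polynomial functions on a vector space. -/
def polyFun (k E : Type*) [Field k] [AddCommGroup E] [Module k E] : Subalgebra k (E → k) :=
  Algebra.adjoin k (Set.range fun l : Dual k E => (l : E → k))

/-- A map all of whose linear coordinates are polynomial functions. -/
def PolyMap (k : Type*) {E F : Type*} [Field k] [AddCommGroup E] [Module k E]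
    [AddCommGroup F] [Module k F] (f : E → F) : Prop :=
  ∀ l : Dual k F, (fun x => l (f x)) ∈ polyFun k E

lemma polyFun_linear (l : Dual k E) : (l : E → k) ∈ polyFun k E :=
  Algebra.subset_adjoin ⟨l, rfl⟩

lemma polyFun_const (c : k) : (fun _ : E => c) ∈ polyFun k E :=
  (polyFun k E).algebraMap_mem c

lemma polyFun_eq_range :
    polyFun k E = (MvPolynomial.aeval (R := k) fun l : Dual k E => (l : E → k)).range :=
  Algebra.adjoin_range_eq_range_aeval _ _

omit [AddCommGroup E] [Module k E] in
lemma aeval_fun_apply {ι : Type*} (c : ι → E → k) (p : MvPolynomial ι k) (x : E) :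
    MvPolynomial.aeval (R := k) c p x = MvPolynomial.eval (fun i => c i x) p := by
  have h : (Pi.evalAlgHom k (fun _ : E => k) x).comp (MvPolynomial.aeval (R := k) c)
      = MvPolynomial.aeval fun i => c i x := by
    ext i; simp
  have := DFunLike.congr_fun h p
  simpa [MvPolynomial.coe_aeval_eq_eval] using this

lemma mem_polyFun_iff {f : E → k} :
    f ∈ polyFun k E ↔ ∃ p : MvPolynomial (Dual k E) k, ∀ x, f x = mEval k x p := by
  rw [polyFun_eq_range]
  constructor
  · rintro ⟨p, rfl⟩
    exact ⟨p, fun x => aeval_fun_apply _ p x⟩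
  · rintro ⟨p, hp⟩
    exact ⟨p, funext fun x => (aeval_fun_apply _ p x).trans (hp x).symm⟩

lemma polyFun_comp {f : F → k} (hf : f ∈ polyFun k F) {g : E → F} (hg : PolyMap k g) :
    (fun x => f (g x)) ∈ polyFun k E := by
  induction hf using Algebra.adjoin_induction with
  | mem f hf => obtain ⟨l, rfl⟩ := hf; exact hg l
  | algebraMap c => exact polyFun_const c
  | add f₁ f₂ _ _ h₁ h₂ => exact add_mem h₁ h₂
  | mul f₁ f₂ _ _ h₁ h₂ => exact mul_mem h₁ h₂

lemma PolyMap.comp {f : F → G} (hf : PolyMap k f) {g : E → F} (hg : PolyMap k g) :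
    PolyMap k fun x => f (g x) := fun l => polyFun_comp (hf l) hg

lemma PolyMap.linear (f : E →ₗ[k] F) : PolyMap k f := fun l => polyFun_linear (l ∘ₗ f)

lemma PolyMap.const (c : F) : PolyMap k fun _ : E => c := fun l => polyFun_const (l c)

lemma PolyMap.id : PolyMap k fun x : E => x := fun l => polyFun_linear l

lemma PolyMap.add {f g : E → F} (hf : PolyMap k f) (hg : PolyMap k g) :
    PolyMap k fun x => f x + g x := fun l => by
  simp only [map_add]; exact add_mem (hf l) (hg l)

lemma PolyMap.sub {f g : E → F} (hf : PolyMap k f) (hg : PolyMap k g) :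
    PolyMap k fun x => f x - g x := fun l => by
  simp only [map_sub]; exact sub_mem (hf l) (hg l)

lemma PolyMap.sum {ι : Type*} (s : Finset ι) {f : ι → E → F} (hf : ∀ i ∈ s, PolyMap k (f i)) :
    PolyMap k fun x => ∑ i ∈ s, f i x := fun l => by
  have : (fun x => l (∑ i ∈ s, f i x)) = ∑ i ∈ s, fun x => l (f i x) := by
    ext x; simp
  rw [this]; exact sum_mem fun i hi => hf i hi l

lemma PolyMap.smul {c : E → k} {f : E → F} (hc : c ∈ polyFun k E) (hf : PolyMap k f) :
    PolyMap k fun x => c x • f x := fun l => by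
  simp only [map_smul, smul_eq_mul]; exact mul_mem hc (hf l)

lemma polyMap_iff_mem {f : E → k} : PolyMap k f ↔ f ∈ polyFun k E := by
  refine ⟨fun h => h LinearMap.id, fun h l => ?_⟩
  have : (fun x => l (f x)) = fun x => f x * l 1 := by
    ext x; rw [← smul_eq_mul, ← map_smul, smul_eq_mul, mul_one]
  rw [this]
  exact mul_mem h (polyFun_const _)

lemma polyMap_of_basis {ι : Type*} [Fintype ι] (b : Basis ι k F) {f : E → F}
    (h : ∀ i, (fun x => b.repr (f x) i) ∈ polyFun k E) : PolyMap k f := by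
  have : f = fun x => ∑ i, b.repr (f x) i • b i := by ext x; rw [b.sum_repr]
  rw [this]
  exact PolyMap.sum _ fun i _ => PolyMap.smul (h i) (PolyMap.const _)

lemma PolyMap.coord {ι : Type*} (b : Basis ι k F) {f : E → F} (hf : PolyMap k f) (i : ι) :
    (fun x => b.repr (f x) i) ∈ polyFun k E := hf (b.coord i)

lemma polyMap_pi {ι : Type*} [Finite ι] {M : ι → Type*} [∀ i, AddCommGroup (M i)]
    [∀ i, Module k (M i)] {f : E → ∀ i, M i} (h : ∀ i, PolyMap k fun x => f x i) :
    PolyMap k f := by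
  classical
  cases nonempty_fintype ι
  have : f = fun x => ∑ i, LinearMap.single k M i (f x i) := by
    ext x j
    simp [Finset.sum_apply, Finset.sum_pi_single]
  rw [this]
  exact PolyMap.sum _ fun i _ => (PolyMap.linear (LinearMap.single k M i)).comp (h i)

lemma PolyMap.prodMk {f : E → F} {g : E → G} (hf : PolyMap k f) (hg : PolyMap k g) :
    PolyMap k fun x => (f x, g x) := by
  have : (fun x => (f x, g x)) =
      fun x => LinearMap.inl k F G (f x) + LinearMap.inr k F G (g x) := by
    ext x <;> simp
  rw [this]
  exact ((PolyMap.linear _).comp hf).add ((PolyMap.linear _).comp hg)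

lemma PolyMap.bilin [FiniteDimensional k F] (B : F →ₗ[k] G →ₗ[k] H) {f : E → F} {g : E → G}
    (hf : PolyMap k f) (hg : PolyMap k g) : PolyMap k fun x => B (f x) (g x) := by
  let b := finBasis k F
  have : (fun x => B (f x) (g x)) = fun x => ∑ i, b.repr (f x) i • B (b i) (g x) := by
    ext x
    conv_lhs => rw [← b.sum_repr (f x)]
    simp only [map_sum, map_smul, LinearMap.sum_apply, LinearMap.smul_apply]
  rw [this]
  exact PolyMap.sum _ fun i _ =>
    PolyMap.smul (hf.coord b i) ((PolyMap.linear (B (b i))).comp hg)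

lemma PolyMap.apply [FiniteDimensional k F] [FiniteDimensional k G]
    {L : E → F →ₗ[k] G} {v : E → F} (hL : PolyMap k L)
    (hv : PolyMap k v) : PolyMap k fun x => L x (v x) :=
  PolyMap.bilin LinearMap.id hL hv

lemma PolyMap.lcomp [FiniteDimensional k F] [FiniteDimensional k G] [FiniteDimensional k H]
    {L : E → G →ₗ[k] H} {M : E → F →ₗ[k] G} (hL : PolyMap k L)
    (hM : PolyMap k M) : PolyMap k fun x => L x ∘ₗ M x :=
  PolyMap.bilin (LinearMap.llcomp k F G H) hL hM

lemma polyMap_hom [FiniteDimensional k F] [FiniteDimensional k G] {L : E → F →ₗ[k] G}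
    (h : ∀ v, PolyMap k fun x => L x v) : PolyMap k L := by
  let b := finBasis k F
  have : L = fun x => ∑ i, LinearMap.smulRightₗ (b.coord i) (L x (b i)) := by
    ext x v
    conv_lhs => rw [← b.sum_repr v]
    simp only [map_sum, map_smul, LinearMap.sum_apply, LinearMap.smulRightₗ_apply_apply,
      Basis.coord_apply]
  rw [this]
  exact PolyMap.sum _ fun i _ => (PolyMap.linear _).comp (h _)

lemma polyFun_matrix_det {ι : Type*} [Fintype ι] [DecidableEq ι] {A : E → Matrix ι ι k}
    (h : ∀ i j, (fun x => A x i j) ∈ polyFun k E) : (fun x => (A x).det) ∈ polyFun k E := by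
  have : (fun x => (A x).det) = ∑ σ : Equiv.Perm ι,
      (fun _ => ((Equiv.Perm.sign σ : ℤ) : k)) * ∏ i, fun x => A x (σ i) i := by
    ext x; simp [Matrix.det_apply', Finset.sum_apply, Finset.prod_apply]
  rw [this]
  exact sum_mem fun σ _ => mul_mem (polyFun_const _) (prod_mem fun i _ => h _ _)

lemma polyFun_matrix_adjugate {ι : Type*} [Fintype ι] [DecidableEq ι] {A : E → Matrix ι ι k}
    (h : ∀ i j, (fun x => A x i j) ∈ polyFun k E) (i j : ι) :
    (fun x => (A x).adjugate i j) ∈ polyFun k E := by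
  simp only [Matrix.adjugate_apply]
  refine polyFun_matrix_det fun a b => ?_
  by_cases hj : a = j
  · subst hj; simp only [Matrix.updateRow_self]; exact polyFun_const _
  · simp only [Matrix.updateRow_ne hj]; exact h a b

lemma polyFun_det [FiniteDimensional k F] {L : E → F →ₗ[k] F} (hL : PolyMap k L) :
    (fun x => LinearMap.det (L x)) ∈ polyFun k E := by
  let b := finBasis k F
  simp only [← LinearMap.det_toMatrix b]
  refine polyFun_matrix_det fun i j => ?_
  simp only [LinearMap.toMatrix_apply]
  exact (hL.apply (PolyMap.const _)).coord b i

lemma exists_polyMap_adjugate [FiniteDimensional k F] {L : E → F →ₗ[k] F} (hL : PolyMap k L) :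
    ∃ A : E → F →ₗ[k] F, PolyMap k A ∧ ∀ x, L x ∘ₗ A x = LinearMap.det (L x) • LinearMap.id ∧
      A x ∘ₗ L x = LinearMap.det (L x) • LinearMap.id := by
  let b := finBasis k F
  refine ⟨fun x => Matrix.toLin b b (LinearMap.toMatrix b b (L x)).adjugate, ?_, fun x => ?_⟩
  · refine polyMap_hom fun v => polyMap_of_basis b fun i => ?_
    simp only [Matrix.repr_toLin]
    have : (fun x => ((LinearMap.toMatrix b b (L x)).adjugate.mulVec (b.repr v)) i)
       = ∑ j, (fun x => (LinearMap.toMatrix b b (L x)).adjugate i j) * fun _ => b.repr v j := by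
      ext x; simp [Matrix.mulVec, dotProduct, Finset.sum_apply]
    rw [this]
    refine sum_mem fun j _ => mul_mem (polyFun_matrix_adjugate (fun i j => ?_) i j)
      (polyFun_const _)
    simp only [LinearMap.toMatrix_apply]
    exact (hL.apply (PolyMap.const _)).coord b i
  · constructor <;> apply (LinearMap.toMatrix b b).injective <;>
    · rw [LinearMap.toMatrix_comp b b b, LinearMap.toMatrix_toLin]
      simp [Matrix.mul_adjugate, Matrix.adjugate_mul]

lemma exists_polynomial_of_polyFun {f : k → k} (hf : f ∈ polyFun k k) :
    ∃ P : Polynomial k, ∀ t, f t = P.eval t := by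
  induction hf using Algebra.adjoin_induction with
  | mem f hf =>
    obtain ⟨l, rfl⟩ := hf
    refine ⟨Polynomial.C (l 1) * Polynomial.X, fun t => ?_⟩
    simp only [Polynomial.eval_mul, Polynomial.eval_C, Polynomial.eval_X]
    rw [mul_comm, ← smul_eq_mul, ← map_smul, smul_eq_mul, mul_one]
  | algebraMap c => exact ⟨Polynomial.C c, fun t => by simp⟩
  | add f₁ f₂ _ _ h₁ h₂ =>
    obtain ⟨P, hP⟩ := h₁; obtain ⟨Q, hQ⟩ := h₂
    exact ⟨P + Q, fun t => by simp [hP, hQ]⟩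
  | mul f₁ f₂ _ _ h₁ h₂ =>
    obtain ⟨P, hP⟩ := h₁; obtain ⟨Q, hQ⟩ := h₂
    exact ⟨P * Q, fun t => by simp [hP, hQ]⟩

lemma polyFun_of_polynomial (P : Polynomial k) : (fun t => P.eval t) ∈ polyFun k k := by
  induction P using Polynomial.induction_on' with
  | add p q hp hq => simp only [Polynomial.eval_add]; exact add_mem hp hq
  | monomial m a =>
    simp only [Polynomial.eval_monomial]
    exact mul_mem (polyFun_const a) (pow_mem (polyFun_linear (LinearMap.id : Dual k k)) m)

lemma polyMap_line (x y : E) : PolyMap k fun t : k => x + t • y :=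
  (PolyMap.const x).add (PolyMap.smul (polyFun_linear (LinearMap.id : Dual k k)) (PolyMap.const y))

lemma polyFun_mul_ne_zero [Infinite k] {f g : E → k} (hf : f ∈ polyFun k E)
    (hg : g ∈ polyFun k E) {x y : E} (hx : f x ≠ 0) (hy : g y ≠ 0) :
    ∃ z, f z ≠ 0 ∧ g z ≠ 0 := by
  obtain ⟨P, hP⟩ := exists_polynomial_of_polyFun (polyFun_comp hf (polyMap_line x (y - x)))
  obtain ⟨Q, hQ⟩ := exists_polynomial_of_polyFun (polyFun_comp hg (polyMap_line x (y - x)))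
  have hP0 : P ≠ 0 := by
    rintro rfl; have := hP 0; simp at this; exact hx this
  have hQ0 : Q ≠ 0 := by
    rintro rfl; have := hQ 1; simp at this; exact hy this
  by_contra! h
  refine mul_ne_zero hP0 hQ0 (Polynomial.funext fun t => ?_)
  rw [Polynomial.eval_mul, ← hP, ← hQ, Polynomial.eval_zero]
  by_cases h0 : f (x + t • (y - x)) = 0
  · rw [h0, zero_mul]
  · rw [h _ h0, mul_zero]

lemma polyFun_prod_ne_zero [Infinite k] {ι : Type*} (s : Finset ι) {f : ι → E → k}
    (hf : ∀ i ∈ s, f i ∈ polyFun k E) (h : ∀ i ∈ s, ∃ x, f i x ≠ 0) :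
    ∃ z, ∀ i ∈ s, f i z ≠ 0 := by
  classical
  suffices ∃ g ∈ polyFun k E, (∃ x, g x ≠ 0) ∧ ∀ x, g x ≠ 0 → ∀ i ∈ s, f i x ≠ 0 by
    obtain ⟨g, -, ⟨x, hx⟩, hg⟩ := this
    exact ⟨x, hg x hx⟩
  induction s using Finset.induction_on with
  | empty => exact ⟨1, one_mem _, ⟨0, one_ne_zero⟩, by simp⟩
  | insert a s ha ih =>
    obtain ⟨g, hg, ⟨x, hx⟩, hgs⟩ := ih (fun i hi => hf i (Finset.mem_insert_of_mem hi))
      (fun i hi => h i (Finset.mem_insert_of_mem hi))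
    obtain ⟨y, hy⟩ := h a (Finset.mem_insert_self _ _)
    have hfa := hf a (Finset.mem_insert_self _ _)
    obtain ⟨z, hz, hz'⟩ := polyFun_mul_ne_zero hg hfa hx hy
    refine ⟨g * f a, mul_mem hg hfa, ⟨z, mul_ne_zero hz hz'⟩, fun x hx i hi => ?_⟩
    have := mul_ne_zero_iff.1 hx
    rcases Finset.mem_insert.1 hi with rfl | hi
    · exact this.2
    · exact hgs x this.1 i hi

/-- The first order expansion of a curve at `0`. -/
def HasJet (k : Type*) {F : Type*} [Field k] [AddCommGroup F] [Module k F]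
    (γ : k → F) (a b : F) : Prop :=
  ∃ h : k → F, PolyMap k h ∧ ∀ t, γ t = a + t • b + t ^ 2 • h t

lemma PolyMap.hasJet [FiniteDimensional k F] {γ : k → F} (hγ : PolyMap k γ) :
    ∃ b, HasJet k γ (γ 0) b := by
  let b := finBasis k F
  choose P hP using fun i => exists_polynomial_of_polyFun (hγ.coord b i)
  have key : ∀ (Q : Polynomial k) (t : k), Q.eval t =
      Q.eval 0 + t * Q.coeff 1 + t ^ 2 * (Q.divX.divX).eval t := by
    intro Q t
    conv_lhs => rw [← Q.divX_mul_X_add, ← Q.divX.divX_mul_X_add]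
    have h1 : Q.divX.coeff 0 = Q.coeff 1 := Polynomial.coeff_divX
    simp only [Polynomial.eval_add, Polynomial.eval_mul, Polynomial.eval_X, Polynomial.eval_C, h1,
      Polynomial.coeff_zero_eq_eval_zero]
    ring
  refine ⟨∑ i, (P i).coeff 1 • b i, fun t => ∑ i, ((P i).divX.divX).eval t • b i,
    PolyMap.sum _ fun i _ => PolyMap.smul (polyFun_of_polynomial _) (PolyMap.const _), fun t => ?_⟩
  conv_lhs => rw [← b.sum_repr (γ t)]
  conv_rhs => rw [← b.sum_repr (γ 0)]
  simp only [hP, Finset.smul_sum, ← Finset.sum_add_distrib, smul_smul, ← add_smul]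
  exact Finset.sum_congr rfl fun i _ => by rw [key]

lemma HasJet.zero_eq {γ : k → F} {a b : F} (h : HasJet k γ a b) : γ 0 = a := by
  obtain ⟨h, -, hγ⟩ := h
  simpa using hγ 0

lemma HasJet.unique [Infinite k] {γ : k → F} {a b a' b' : F} (h : HasJet k γ a b)
    (h' : HasJet k γ a' b') : b = b' := by
  obtain rfl := h.zero_eq
  obtain rfl := h'.zero_eq
  obtain ⟨h, hh, hγ⟩ := h
  obtain ⟨h', hh', hγ'⟩ := h'
  rw [← sub_eq_zero, ← Module.forall_dual_apply_eq_zero_iff k]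
  intro l
  obtain ⟨P, hP⟩ := exists_polynomial_of_polyFun ((hh'.sub hh) l)
  have h0 : Polynomial.X * (Polynomial.C (l (b - b')) - Polynomial.X * P) = 0 := by
    refine Polynomial.funext fun t => ?_
    have h1 : t • (b - b') = t ^ 2 • (h' t - h t) := by
      have h2 := (hγ t).symm.trans (hγ' t)
      have h3 : t • (b - b') - t ^ 2 • (h' t - h t)
        = (γ 0 + t • b + t ^ 2 • h t) - (γ 0 + t • b' + t ^ 2 • h' t) := by module
      rwa [h2, sub_self, sub_eq_zero] at h3
    have h4 := congrArg l h1
    simp only [map_smul, hP, smul_eq_mul] at h4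
    simp only [Polynomial.eval_mul, Polynomial.eval_X, Polynomial.eval_sub, Polynomial.eval_C,
      Polynomial.eval_zero]
    linear_combination h4
  have h1 := (mul_eq_zero.1 h0).resolve_left Polynomial.X_ne_zero
  simpa using congrArg (Polynomial.eval 0) h1

lemma HasJet.bilin [FiniteDimensional k F] [FiniteDimensional k G] (B : F →ₗ[k] G →ₗ[k] H)
    {γ : k → F} {δ : k → G} {a b : F} {c d : G}
    (h : HasJet k γ a b) (h' : HasJet k δ c d) :
    HasJet k (fun t => B (γ t) (δ t)) (B a c) (B b c + B a d) := by
  obtain ⟨h, hh, hγ⟩ := h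
  obtain ⟨h', hh', hγ'⟩ := h'
  refine ⟨fun t => B a (h' t) + B b (d + t • h' t) + B (h t) (δ t), ?_, fun t => ?_⟩
  · have ht : (fun t : k => t) ∈ polyFun k k := polyFun_linear (LinearMap.id : Dual k k)
    have hδ : PolyMap k δ := by
      have : δ = fun t => c + t • d + t ^ 2 • h' t := funext hγ'
      rw [this]
      exact (polyMap_line c d).add (PolyMap.smul (pow_mem ht 2) hh')
    exact (((PolyMap.linear (B a)).comp hh').add ((PolyMap.linear (B b)).comp
      ((PolyMap.const d).add (PolyMap.smul ht hh')))).add (PolyMap.bilin B hh hδ)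
  · dsimp only
    rw [hγ t]
    simp only [map_add, map_smul, LinearMap.add_apply, LinearMap.smul_apply]
    rw [show B a (δ t) = B a c + t • B a d + t ^ 2 • B a (h' t) by rw [hγ' t]; simp,
      show B b (δ t) = B b c + t • B b d + t ^ 2 • B b (h' t) by rw [hγ' t]; simp]
    module

end PolynomialFunctions

section Cramer

variable {k E F G H : Type*} [Field k] [AddCommGroup E] [Module k E]
  [AddCommGroup F] [Module k F] [AddCommGroup G] [Module k G] [AddCommGroup H] [Module k H]

lemma HasJet.linear {γ : k → F} {a b : F} (h : HasJet k γ a b) (f : F →ₗ[k] G) :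
    HasJet k (fun t => f (γ t)) (f a) (f b) := by
  obtain ⟨h, hh, hγ⟩ := h
  exact ⟨fun t => f (h t), (PolyMap.linear f).comp hh, fun t => by simp [hγ t]⟩

lemma HasJet.add {γ δ : k → F} {a b c d : F} (h : HasJet k γ a b) (h' : HasJet k δ c d) :
    HasJet k (fun t => γ t + δ t) (a + c) (b + d) := by
  obtain ⟨h, hh, hγ⟩ := h
  obtain ⟨h', hh', hγ'⟩ := h'
  exact ⟨fun t => h t + h' t, hh.add hh', fun t => by simp only [hγ t, hγ' t]; module⟩

lemma HasJet.const (a : F) : HasJet k (fun _ => a) a 0 :=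
  ⟨fun _ => 0, PolyMap.const 0, fun t => by simp⟩

lemma HasJet.line (a b : F) : HasJet k (fun t => a + t • b) a b :=
  ⟨fun _ => 0, PolyMap.const 0, fun t => by simp⟩

lemma HasJet.polyMap {γ : k → F} {a b : F} (h : HasJet k γ a b) : PolyMap k γ := by
  obtain ⟨h, hh, hγ⟩ := h
  have ht : (fun t : k => t) ∈ polyFun k k := polyFun_linear (LinearMap.id : Dual k k)
  rw [show γ = _ from funext hγ]
  exact (polyMap_line a b).add (PolyMap.smul (pow_mem ht 2) hh)

lemma HasJet.apply [FiniteDimensional k F] [FiniteDimensional k G]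
    {L : k → F →ₗ[k] G} {γ : k → F} {a b : F →ₗ[k] G} {c d : F}
    (h : HasJet k L a b) (h' : HasJet k γ c d) :
    HasJet k (fun t => L t (γ t)) (a c) (b c + a d) :=
  HasJet.bilin LinearMap.id h h'

lemma exists_pseudoInverse (A : F →ₗ[k] G) :
    ∃ B : G →ₗ[k] F, A ∘ₗ B ∘ₗ A = A ∧ B ∘ₗ A ∘ₗ B = B := by
  obtain ⟨g, hg⟩ := A.rangeRestrict.exists_rightInverse_of_surjective A.range_rangeRestrict
  obtain ⟨B, hB⟩ := g.exists_extend
  have h1 : ∀ x, A (B (A x)) = A x := fun x => by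
    have h2 := DFunLike.congr_fun hB ⟨A x, x, rfl⟩
    have h3 := congrArg Subtype.val (DFunLike.congr_fun hg ⟨A x, x, rfl⟩)
    simp only [LinearMap.comp_apply, Submodule.subtype_apply] at h2
    rw [h2]; exact h3
  exact ⟨B ∘ₗ A ∘ₗ B, by ext x; simp [h1], by ext x; simp [h1]⟩

lemma finrank_range_eq_of_det_ne_zero [FiniteDimensional k F] [FiniteDimensional k G]
    {A L : F →ₗ[k] G} {B : G →ₗ[k] F} (hA : A ∘ₗ B ∘ₗ A = A)
    (h : LinearMap.det (B ∘ₗ L + (LinearMap.id - B ∘ₗ A)) ≠ 0) :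
    finrank k (LinearMap.range A) ≤ finrank k (LinearMap.range (B ∘ₗ L)) := by
  set P := B ∘ₗ L + (LinearMap.id - B ∘ₗ A)
  have hP : LinearMap.range P = ⊤ := by
    rw [LinearMap.range_eq_top]
    have := ((LinearMap.isUnit_iff_isUnit_det P).2 (isUnit_iff_ne_zero.2 h))
    exact ((Module.End.isUnit_iff P).1 this).2
  have h1 : LinearMap.range P ≤ LinearMap.range (B ∘ₗ L) ⊔ LinearMap.ker A := by
    rintro _ ⟨x, rfl⟩
    refine Submodule.add_mem_sup ⟨x, rfl⟩ ?_
    have := DFunLike.congr_fun hA x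
    simp only [LinearMap.comp_apply] at this
    simp [this]
  have h2 := Submodule.finrank_mono h1
  have h3 := Submodule.finrank_add_le_finrank_add_finrank (LinearMap.range (B ∘ₗ L))
    (LinearMap.ker A)
  have h4 := A.finrank_range_add_finrank_ker
  rw [hP, finrank_top] at h2
  omega

lemma exists_polyFun_le_rank [FiniteDimensional k F] [FiniteDimensional k G]
    {L : E → F →ₗ[k] G} (hL : PolyMap k L) (p₀ : E) :
    ∃ g ∈ polyFun k E, g p₀ ≠ 0 ∧ ∀ p, g p ≠ 0 →
      finrank k (LinearMap.range (L p₀)) ≤ finrank k (LinearMap.range (L p)) := by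
  obtain ⟨B, hA, hB⟩ := exists_pseudoInverse (L p₀)
  refine ⟨fun p => LinearMap.det (B ∘ₗ L p + (LinearMap.id - B ∘ₗ L p₀)), polyFun_det
    (((PolyMap.const B).lcomp hL).add (PolyMap.const _)), by simp, fun p hp => ?_⟩
  refine (finrank_range_eq_of_det_ne_zero hA hp).trans ?_
  rw [LinearMap.range_comp]
  exact Submodule.finrank_map_le _ _

lemma exists_polyMap_section_of_le [FiniteDimensional k F] [FiniteDimensional k G]
    {L : E → F →ₗ[k] G} (hL : PolyMap k L) {p₀ : E} {v : F} (hv : L p₀ v = 0) :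
    ∃ V : E → F, PolyMap k V ∧ V p₀ = v ∧
      ∀ p, finrank k (LinearMap.range (L p)) ≤ finrank k (LinearMap.range (L p₀)) →
        L p (V p) = 0 := by
  obtain ⟨B, hA, hB⟩ := exists_pseudoInverse (L p₀)
  have hP : PolyMap k fun p => B ∘ₗ L p + (LinearMap.id - B ∘ₗ L p₀) :=
    ((PolyMap.const B).lcomp hL).add (PolyMap.const _)
  obtain ⟨J, hJ, hJP⟩ := exists_polyMap_adjugate hP
  refine ⟨fun p => LinearMap.det (B ∘ₗ L p + (LinearMap.id - B ∘ₗ L p₀)) • J p v,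
    PolyMap.smul (polyFun_det hP) (hJ.apply (PolyMap.const v)), ?_, fun p hmax => ?_⟩
  · have h1 := DFunLike.congr_fun (hJP p₀).2 v
    simpa using h1
  · by_cases hd : LinearMap.det (B ∘ₗ L p + (LinearMap.id - B ∘ₗ L p₀)) = 0
    · simp [hd]
    · have h1 := finrank_range_eq_of_det_ne_zero hA hd
      have h2 : LinearMap.ker (L p) = LinearMap.ker (B ∘ₗ L p) := by
        refine Submodule.eq_of_le_of_finrank_le (LinearMap.ker_le_ker_comp _ _) ?_
        have h3 := (L p).finrank_range_add_finrank_ker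
        have h4 := (B ∘ₗ L p).finrank_range_add_finrank_ker
        omega
      have h3 := DFunLike.congr_fun (hJP p).1 v
      set u := J p v
      rw [map_smul]
      suffices B (L p u) = 0 by
        have h4 : u ∈ LinearMap.ker (L p) := by rw [h2]; exact this
        rw [LinearMap.mem_ker.1 h4, smul_zero]
      simp only [LinearMap.comp_apply, LinearMap.add_apply, LinearMap.sub_apply, LinearMap.id_apply,
        LinearMap.smul_apply] at h3
      have h5 := congrArg (fun x => B (L p₀ x)) h3
      have hB' : ∀ x, B (L p₀ (B x)) = B x := fun x => DFunLike.congr_fun hB x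
      simp only [map_add, map_sub, map_smul, hB', hv, map_zero, smul_zero, sub_self,
        add_zero] at h5
      exact h5

lemma exists_polyMap_section [FiniteDimensional k F] [FiniteDimensional k G]
    {L : E → F →ₗ[k] G} (hL : PolyMap k L) {p₀ : E}
    (hmax : ∀ p, finrank k (LinearMap.range (L p)) ≤ finrank k (LinearMap.range (L p₀)))
    {v : F} (hv : L p₀ v = 0) :
    ∃ V : E → F, PolyMap k V ∧ V p₀ = v ∧ ∀ p, L p (V p) = 0 := by
  obtain ⟨V, hV, hV0, h⟩ := exists_polyMap_section_of_le hL hv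
  exact ⟨V, hV, hV0, fun p => h p (hmax p)⟩

lemma jet_ker_le_range [Infinite k] [FiniteDimensional k F] [FiniteDimensional k G]
    {L : k → F →ₗ[k] G} {L₀ L₁ : F →ₗ[k] G} (hL : HasJet k L L₀ L₁)
    (hmax : ∀ t, finrank k (LinearMap.range (L t)) ≤ finrank k (LinearMap.range L₀))
    {v : F} (hv : L₀ v = 0) : L₁ v ∈ LinearMap.range L₀ := by
  have h0 := hL.zero_eq
  obtain ⟨V, hV, rfl, hLV⟩ := exists_polyMap_section hL.polyMap (p₀ := 0) (v := v)
    (by rw [h0]; exact hmax) (by rw [h0]; exact hv)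
  obtain ⟨w, hw⟩ := hV.hasJet
  have h1 := hL.apply hw
  simp only [hLV, hv] at h1
  have h2 := h1.unique (HasJet.const 0)
  exact ⟨-w, by rw [map_neg, eq_comm, eq_neg_iff_add_eq_zero]; exact h2⟩

end Cramer

section Filtrations

variable {k M Q : Type*} [Field k] [AddCommGroup M] [Module k M] [AddCommGroup Q] [Module k Q]

/-- An exhaustive increasing filtration of length `n`. -/
structure IsFilt (n : ℕ) (F : ℕ → Submodule k M) : Prop where
  mono : Monotone F
  zero : F 0 = ⊥
  top : F n = ⊤

lemma IsFilt.comap {n : ℕ} {F : ℕ → Submodule k M} (hF : IsFilt n F) (f : Q →ₗ[k] M)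
    (hf : Function.Injective f) : IsFilt n fun u => (F u).comap f where
  mono _ _ h := Submodule.comap_mono (hF.mono h)
  zero := by simp [hF.zero, LinearMap.ker_eq_bot.2 hf]
  top := by simp [hF.top]

lemma IsFilt.map {n : ℕ} {F : ℕ → Submodule k M} (hF : IsFilt n F) (f : M →ₗ[k] Q)
    (hf : Function.Surjective f) : IsFilt n fun u => (F u).map f where
  mono _ _ h := Submodule.map_mono (hF.mono h)
  zero := by simp [hF.zero]
  top := by simp [hF.top, LinearMap.range_eq_top.2 hf]

/-- Linear maps compatible with filtrations. -/
def filtHom (F : ℕ → Submodule k M) (G : ℕ → Submodule k Q) : Submodule k (M →ₗ[k] Q) where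
  carrier := {φ | ∀ u, ∀ x ∈ F u, φ x ∈ G u}
  add_mem' h h' u x hx := add_mem (h u x hx) (h' u x hx)
  zero_mem' _ _ _ := zero_mem _
  smul_mem' c _ h u x hx := smul_mem _ c (h u x hx)

lemma mem_filtHom {F : ℕ → Submodule k M} {G : ℕ → Submodule k Q} {φ : M →ₗ[k] Q} :
    φ ∈ filtHom F G ↔ ∀ u, ∀ x ∈ F u, φ x ∈ G u := Iff.rfl

lemma exists_adapted_basis_aux {F : ℕ → Submodule k M} (hF : Monotone F) (h0 : F 0 = ⊥) (N : ℕ) :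
    ∃ B : Set M, LinearIndepOn k id B ∧ span k B = F N ∧
      ∀ u ≤ N, span k (B ∩ F u) = F u := by
  induction N with
  | zero =>
    refine ⟨∅, linearIndepOn_empty _ _, by simp [h0], fun u hu => ?_⟩
    obtain rfl : u = 0 := by omega
    simp [h0]
  | succ N ih =>
    obtain ⟨B, hB, hBs, hBu⟩ := ih
    have hsub : B ⊆ F (N + 1) := fun x hx =>
      hF (Nat.le_succ N) (hBs ▸ subset_span hx)
    obtain ⟨B', hB't, hBB', hspan, hB'⟩ := exists_linearIndepOn_id_extension hB hsub
    have hs : span k B' = F (N + 1) := le_antisymm (span_le.2 hB't) hspan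
    refine ⟨B', hB', hs, fun u hu => ?_⟩
    refine le_antisymm (span_le.2 Set.inter_subset_right) ?_
    rcases Nat.lt_or_ge N u with h | h
    · obtain rfl : u = N + 1 := by omega
      rw [Set.inter_eq_left.2 hB't, hs]
    · conv_lhs => rw [← hBu u h]
      exact span_mono (Set.inter_subset_inter_left _ hBB')

lemma exists_adapted_basis_extend_aux {F : ℕ → Submodule k M} (hF : Monotone F) (h0 : F 0 = ⊥)
    {K : Submodule k M} {B₀ : Set M} (hB₀ : LinearIndepOn k id B₀) (hB₀s : span k B₀ = K)
    (hB₀u : ∀ u, span k (B₀ ∩ F u) = K ⊓ F u) (N : ℕ) :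
    ∃ B : Set M, B₀ ⊆ B ∧ LinearIndepOn k id B ∧ span k B = K ⊔ F N ∧
      ∀ u ≤ N, span k (B ∩ F u) = F u := by
  induction N with
  | zero =>
    refine ⟨B₀, subset_rfl, hB₀, by simp [h0, hB₀s], fun u hu => ?_⟩
    obtain rfl : u = 0 := by omega
    rw [hB₀u, h0, inf_bot_eq]
  | succ N ih =>
    obtain ⟨B, hBB₀, hB, hBs, hBu⟩ := ih
    obtain ⟨B', hB't, hBB', hspan, hB'⟩ := exists_linearIndepOn_id_extension hB
      (Set.subset_union_left (t := (F (N + 1) : Set M)))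
    have hle : F N ≤ F (N + 1) := hF (Nat.le_succ N)
    have hs : span k B' = K ⊔ F (N + 1) := by
      apply le_antisymm
      · rw [span_le]
        refine hB't.trans (Set.union_subset ?_ ?_)
        · intro x hx
          have : x ∈ K ⊔ F N := hBs ▸ subset_span hx
          exact (sup_le_sup_left hle K) this
        · exact (le_sup_right : F (N + 1) ≤ K ⊔ F (N + 1))
      · refine sup_le ?_ fun x hx => hspan (Or.inr hx)
        rw [← hB₀s]; exact span_mono (hBB₀.trans hBB')
    refine ⟨B', hBB₀.trans hBB', hB', hs, fun u hu => ?_⟩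
    refine le_antisymm (span_le.2 Set.inter_subset_right) ?_
    rcases Nat.lt_or_ge N u with h | h
    · obtain rfl : u = N + 1 := by omega
      intro x hx
      have h1 : span k B' ≤ span k (B' ∩ F (N + 1)) ⊔ K := by
        rw [span_le]
        intro y hy
        rcases hB't hy with h | h
        · have h2 : y ∈ K ⊔ F N := hBs ▸ subset_span h
          rw [← hBu N le_rfl, sup_comm] at h2
          refine (sup_le_sup_right (span_mono ?_) K) h2
          exact Set.inter_subset_inter hBB' hle
        · exact Submodule.mem_sup_left (subset_span ⟨hy, h⟩)
      have hx' : x ∈ span k B' := hs ▸ Submodule.mem_sup_right hx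
      obtain ⟨a, ha, b, hb, rfl⟩ := Submodule.mem_sup.1 (h1 hx')
      refine add_mem ha ?_
      have haF : a ∈ F (N + 1) := (span_le.2 Set.inter_subset_right) ha
      have hbF : b ∈ F (N + 1) := by simpa using sub_mem hx haF
      have : b ∈ span k (B₀ ∩ F (N + 1)) := by rw [hB₀u]; exact ⟨hb, hbF⟩
      exact span_mono (Set.inter_subset_inter_left _ (hBB₀.trans hBB')) this
    · conv_lhs => rw [← hBu u h]
      exact span_mono (Set.inter_subset_inter_left _ hBB')

lemma IsFilt.exists_adapted_basis {n : ℕ} {F : ℕ → Submodule k M} (hF : IsFilt n F)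
    (K : Submodule k M) :
    ∃ B₀ B : Set M, B₀ ⊆ B ∧ LinearIndepOn k id B ∧ span k B = ⊤ ∧ span k B₀ = K ∧
      ∀ u, span k (B ∩ F u) = F u := by
  have hK : Monotone fun u => K ⊓ F u := fun _ _ h => inf_le_inf_left _ (hF.mono h)
  obtain ⟨B₀, hB₀, hB₀s, hB₀u⟩ := exists_adapted_basis_aux hK (by simp [hF.zero]) n
  have htop : ∀ u, n ≤ u → F u = ⊤ := fun u hu => top_le_iff.1 (hF.top ▸ hF.mono hu)
  simp only [hF.top, inf_top_eq] at hB₀s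
  have hint : ∀ u, B₀ ∩ (K ⊓ F u : Submodule k M) = B₀ ∩ F u := fun u => by
    ext x
    simp only [Set.mem_inter_iff, SetLike.mem_coe, Submodule.mem_inf]
    exact ⟨fun h => ⟨h.1, h.2.2⟩, fun h => ⟨h.1, hB₀s ▸ subset_span h.1, h.2⟩⟩
  have hB₀u' : ∀ u, span k (B₀ ∩ F u) = K ⊓ F u := fun u => by
    rcases le_total u n with h | h
    · rw [← hint]; exact hB₀u u h
    · simp [htop u h, hB₀s]
  obtain ⟨B, h1, h2, h3, h4⟩ := exists_adapted_basis_extend_aux hF.mono hF.zero hB₀ hB₀s hB₀u' n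
  rw [hF.top, sup_top_eq] at h3
  refine ⟨B₀, B, h1, h2, h3, hB₀s, fun u => ?_⟩
  rcases le_total u n with h | h
  · exact h4 u h
  · simp [htop u h, h3]

/-- A filtered map from a subspace to a quotient lifts to a filtered map. -/
lemma exists_filtered_lift {n : ℕ} {F : ℕ → Submodule k M} {G : ℕ → Submodule k Q}
    (hF : IsFilt n F) (hG : Monotone G) (K : Submodule k M) (N : Submodule k Q)
    {φ : K →ₗ[k] Q ⧸ N}
    (hφ : φ ∈ filtHom (fun u => (F u).comap K.subtype) (fun u => (G u).map N.mkQ)) :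
    ∃ α ∈ filtHom F G, ∀ x : K, N.mkQ (α x) = φ x := by
  classical
  obtain ⟨B₀, B, hBB, hB, hBs, hB₀, hBu⟩ := hF.exists_adapted_basis K
  let b : Basis B k M := Basis.mk hB (by simpa using hBs.ge)
  have hb : ∀ x : B, b x = x := fun x => by simp [b]
  have hlev : ∀ x : M, ∃ u, x ∈ F u := fun x => ⟨n, hF.top ▸ mem_top⟩
  have hK : ∀ x ∈ B₀, x ∈ K := fun x hx => hB₀ ▸ subset_span hx
  have hex : ∀ x : B, ∃ y : Q, (∀ u, (x : M) ∈ F u → y ∈ G u) ∧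
      ∀ h : (x : M) ∈ B₀, N.mkQ y = φ ⟨x, hK _ h⟩ := by
    intro x
    by_cases h : (x : M) ∈ B₀
    · obtain ⟨y, hy, hy'⟩ := hφ (Nat.find (hlev x)) ⟨x, hK _ h⟩ (Nat.find_spec (hlev x))
      exact ⟨y, fun u hu => hG (Nat.find_min' _ hu) hy, fun _ => hy'⟩
    · exact ⟨0, fun u _ => zero_mem _, fun h' => absurd h' h⟩
  choose y hy hy' using hex
  have hα : ∀ x : B, b.constr k y x = y x := fun x => by
    conv_lhs => rw [← hb x]
    exact b.constr_basis k y x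
  refine ⟨b.constr k y, fun u x hx => ?_, fun x => ?_⟩
  · rw [← hBu u] at hx
    refine (span_le (p := (G u).comap (b.constr k y))).2 ?_ hx
    rintro z ⟨hz, hzu⟩
    change b.constr k y z ∈ G u
    rw [hα ⟨z, hz⟩]
    exact hy ⟨z, hz⟩ u hzu
  · obtain ⟨x, hx⟩ := x
    have hx' := hx
    simp only [← hB₀] at hx'
    induction hx' using span_induction with
    | mem z hz => rw [hα ⟨z, hBB hz⟩]; exact hy' ⟨z, hBB hz⟩ hz
    | zero => rw [map_zero, map_zero, eq_comm]; exact map_zero φ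
    | add z w hz hw h1 h2 =>
      rw [map_add, map_add, h1 (hB₀ ▸ hz), h2 (hB₀ ▸ hw), ← map_add]; rfl
    | smul c z hz h1 =>
      rw [map_smul, map_smul, h1 (hB₀ ▸ hz), ← map_smul]; rfl

/-- The codimension of `filtHom F G`. -/
lemma finrank_filtHom [FiniteDimensional k M] [FiniteDimensional k Q] {n : ℕ}
    {F : ℕ → Submodule k M} {G : ℕ → Submodule k Q} (hF : IsFilt n F) (hG : IsFilt n G) :
    (finrank k M * finrank k Q : ℤ) - finrank k (filtHom F G) =
      ∑ u ∈ Finset.range n, (finrank k (F u) : ℤ) * (finrank k (G (u + 1)) - finrank k (G u)) := by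
  classical
  obtain ⟨-, B, -, hB, hBs, -, hBu⟩ := hF.exists_adapted_basis ⊥
  let b : Basis B k M := Basis.mk hB (by simpa using hBs.ge)
  have hb : ∀ x : B, b x = x := fun x => by simp [b]
  have hlev : ∀ x : M, ∃ u, x ∈ F u := fun x => ⟨n, hF.top ▸ mem_top⟩
  let _ : Fintype B := FiniteDimensional.fintypeBasisIndex b
  let ℓ : B → ℕ := fun x => Nat.find (hlev x)
  have hℓ : ∀ (x : B) u, (x : M) ∈ F u ↔ ℓ x ≤ u := fun x u =>
    ⟨fun h => Nat.find_min' _ h, fun h => hF.mono h (Nat.find_spec (hlev x))⟩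
  have hcard : ∀ u, finrank k (F u) = (Finset.univ.filter fun x : B => ℓ x ≤ u).card := fun u => by
    have h1 : LinearIndepOn k id (B ∩ F u) := hB.mono Set.inter_subset_left
    have h2 := finrank_span_set_eq_card (R := k) (s := B ∩ (F u : Set M)) h1
    rw [hBu] at h2
    rw [h2, Set.toFinset_card, ← Fintype.card_coe]
    refine Fintype.card_congr
      ⟨fun x => ⟨⟨x, x.2.1⟩, by simpa [← hℓ] using x.2.2⟩,
       fun x => ⟨x.1, x.1.2, by simpa [← hℓ] using x.2⟩, fun x => rfl, fun x => rfl⟩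
  let e : filtHom F G ≃ₗ[k] (∀ x : B, G (ℓ x)) :=
    { toFun := fun φ x => ⟨φ.1 x, φ.2 _ _ ((hℓ x _).2 le_rfl)⟩
      map_add' := fun _ _ => rfl
      map_smul' := fun _ _ => rfl
      invFun := fun y => ⟨b.constr k fun x => (y x : Q), fun u x hx => by
        rw [← hBu u] at hx
        refine (span_le (p := (G u).comap (b.constr k fun x => (y x : Q)))).2 ?_ hx
        rintro z ⟨hz, hzu⟩
        change b.constr k _ z ∈ G u
        have := b.constr_basis k (fun x => (y x : Q)) ⟨z, hz⟩
        rw [hb] at this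
        rw [this]
        exact hG.mono ((hℓ ⟨z, hz⟩ u).1 hzu) (y ⟨z, hz⟩).2⟩
      left_inv := fun φ => by
        apply Subtype.ext
        apply b.ext
        intro x
        rw [b.constr_basis, hb]
      right_inv := fun y => by
        ext x
        have := b.constr_basis k (fun x => (y x : Q)) x
        rw [hb] at this
        exact this }
  rw [e.finrank_eq, Module.finrank_pi_fintype, finrank_eq_card_basis b]
  simp only [hcard]
  have hln : ∀ x, ℓ x ≤ n := fun x => (hℓ x n).1 (hF.top ▸ mem_top)
  have h1 : ∀ x : B, (finrank k Q : ℤ) - finrank k (G (ℓ x)) =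
      ∑ u ∈ Finset.range n,
        if ℓ x ≤ u then (finrank k (G (u + 1)) - finrank k (G u) : ℤ) else 0 := by
    intro x
    rw [← Finset.sum_filter]
    have h2 : (Finset.range n).filter (fun u => ℓ x ≤ u) = Finset.Ico (ℓ x) n := by
      ext u; simp [and_comm]
    rw [h2, Finset.sum_Ico_sub (fun u => (finrank k (G u) : ℤ)) (hln x), hG.top, finrank_top]
  calc _ = ∑ x : B, ((finrank k Q : ℤ) - finrank k (G (ℓ x))) := by
        simp [Finset.sum_sub_distrib]
    _ = _ := by
        simp only [h1]
        rw [Finset.sum_comm]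
        refine Finset.sum_congr rfl fun u _ => ?_
        rw [← Finset.sum_filter, Finset.sum_const, nsmul_eq_mul]

/-- The Euler characteristic of a pair of multifiltered spaces. -/
def filtChi {s : ℕ} (n : ℕ) (F : Fin s → ℕ → Submodule k M) (G : Fin s → ℕ → Submodule k Q) : ℤ :=
  finrank k M * finrank k Q - ∑ j, ∑ u ∈ Finset.range n,
    (finrank k (F j u) : ℤ) * (finrank k (G j (u + 1)) - finrank k (G j u))

/-- Vanishing of the obstruction space of a pair of multifiltered spaces. -/
def ExtZero {s : ℕ} (F : Fin s → ℕ → Submodule k M) (G : Fin s → ℕ → Submodule k Q) : Prop :=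
  ∀ ρ : Fin s → (M →ₗ[k] Q), ∃ φ : M →ₗ[k] Q, ∀ j, ρ j - φ ∈ filtHom (F j) (G j)

lemma filtChi_add_finrank [FiniteDimensional k M] [FiniteDimensional k Q] {n s : ℕ}
    {F : Fin s → ℕ → Submodule k M} {G : Fin s → ℕ → Submodule k Q}
    (hF : ∀ j, IsFilt n (F j)) (hG : ∀ j, IsFilt n (G j)) :
    ∃ m : ℕ, (finrank k (⨅ j, filtHom (F j) (G j) : Submodule k (M →ₗ[k] Q)) : ℤ) =
      filtChi n F G + m ∧ (ExtZero F G ↔ m = 0) := by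
  let T : (M →ₗ[k] Q) →ₗ[k] ∀ j, ((M →ₗ[k] Q) ⧸ filtHom (F j) (G j)) :=
    LinearMap.pi fun j => (filtHom (F j) (G j)).mkQ
  have hker : LinearMap.ker T = ⨅ j, filtHom (F j) (G j) := by
    rw [LinearMap.ker_pi]; simp
  have h1 := T.finrank_range_add_finrank_ker
  have h2 := Submodule.finrank_quotient_add_finrank (LinearMap.range T)
  refine ⟨finrank k ((∀ j, ((M →ₗ[k] Q) ⧸ filtHom (F j) (G j))) ⧸ LinearMap.range T), ?_, ?_⟩
  · have h3 : (finrank k (∀ j, ((M →ₗ[k] Q) ⧸ filtHom (F j) (G j))) : ℤ) =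
        ∑ j, ∑ u ∈ Finset.range n,
          (finrank k (F j u) : ℤ) * (finrank k (G j (u + 1)) - finrank k (G j u)) := by
      rw [Module.finrank_pi_fintype]
      push_cast
      refine Finset.sum_congr rfl fun j _ => ?_
      rw [← finrank_filtHom (hF j) (hG j)]
      have := Submodule.finrank_quotient_add_finrank (filtHom (F j) (G j))
      rw [Module.finrank_linearMap] at this
      rw [eq_sub_iff_add_eq]
      exact_mod_cast this
    rw [filtChi, ← h3, ← hker]
    rw [Module.finrank_linearMap] at h1
    zify at h1 h2
    linarith
  · rw [finrank_eq_zero_iff_of_free, Submodule.Quotient.subsingleton_iff,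
      LinearMap.range_eq_top]
    constructor
    · intro h x
      choose ρ hρ using fun j => Submodule.mkQ_surjective _ (x j)
      obtain ⟨φ, hφ⟩ := h ρ
      refine ⟨φ, funext fun j => ?_⟩
      rw [← hρ j]
      exact ((Submodule.Quotient.eq _).2 (hφ j)).symm
    · intro h ρ
      obtain ⟨φ, hφ⟩ := h fun j => Submodule.Quotient.mk (ρ j)
      exact ⟨φ, fun j => (Submodule.Quotient.eq _).1 (congrFun hφ j).symm⟩

end Filtrations

section KeyLemma

variable {k : Type*} [Field k]

lemma exists_eq_comp_add_comp {X Y : Type*} [AddCommGroup X] [Module k X] [AddCommGroup Y]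
    [Module k Y] {θ ρ : X →ₗ[k] Y} (h : ∀ x, θ x = 0 → ρ x ∈ LinearMap.range θ) :
    ∃ (δ : Y →ₗ[k] Y) (γ : X →ₗ[k] X), ρ = δ ∘ₗ θ + θ ∘ₗ γ := by
  obtain ⟨B, hB, -⟩ := exists_pseudoInverse θ
  refine ⟨ρ ∘ₗ B, B ∘ₗ ρ ∘ₗ (LinearMap.id - B ∘ₗ θ), ?_⟩
  have hB' : ∀ x, θ (B (θ x)) = θ x := fun x => DFunLike.congr_fun hB x
  ext x
  obtain ⟨y, hy⟩ := h (x - B (θ x)) (by rw [map_sub, hB', sub_self])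
  simp only [LinearMap.add_apply, LinearMap.comp_apply, LinearMap.sub_apply, LinearMap.id_apply]
  rw [← hy, hB', hy, map_sub, add_sub_cancel]

section

variable {X Y : Type*} [AddCommGroup X] [Module k X] [AddCommGroup Y] [Module k Y]

lemma extZero_of_ker_coker {n s : ℕ} {F : Fin s → ℕ → Submodule k X}
    {G : Fin s → ℕ → Submodule k Y} (hF : ∀ j, IsFilt n (F j)) (hG : ∀ j, IsFilt n (G j))
    {θ : X →ₗ[k] Y}
    (h₁ : ∀ η : X →ₗ[k] Y, (∀ j, η ∈ filtHom (F j) (G j)) →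
      ∀ x, θ x = 0 → η x ∈ LinearMap.range θ)
    (h₂ : ∀ (δ : Fin s → Y →ₗ[k] Y) (γ : Fin s → X →ₗ[k] X), ∃ η : X →ₗ[k] Y,
      (∀ j, δ j ∘ₗ θ + θ ∘ₗ γ j - η ∈ filtHom (F j) (G j)) ∧
      ∀ x, θ x = 0 → η x ∈ LinearMap.range θ) :
    (∀ φ : LinearMap.ker θ →ₗ[k] Y ⧸ LinearMap.range θ,
      (∀ j, φ ∈ filtHom (fun u => (F j u).comap (LinearMap.ker θ).subtype)
        (fun u => (G j u).map (LinearMap.range θ).mkQ)) → φ = 0) ∧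
    (ExtZero (fun j u => (F j u).comap (LinearMap.ker θ).subtype)
        (fun j u => (G j u).map (LinearMap.range θ).mkQ) → ExtZero F G) := by
  have hlift : ∀ φ : LinearMap.ker θ →ₗ[k] Y ⧸ LinearMap.range θ,
      ∃ ρ : X →ₗ[k] Y, ∀ x : LinearMap.ker θ, (LinearMap.range θ).mkQ (ρ x) = φ x := by
    intro φ
    obtain ⟨g, hg⟩ := (LinearMap.range θ).mkQ.exists_rightInverse_of_surjective
      (Submodule.range_mkQ _)
    obtain ⟨ρ, hρ⟩ := (g ∘ₗ φ).exists_extend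
    refine ⟨ρ, fun x => ?_⟩
    have h3 : ρ x = g (φ x) := DFunLike.congr_fun hρ x
    rw [h3]
    exact DFunLike.congr_fun hg (φ x)
  have hcorr : ∀ ρ : Fin s → X →ₗ[k] Y,
      (∀ j x, θ x = 0 → ρ j x ∈ LinearMap.range θ) → ∃ η : X →ₗ[k] Y,
      (∀ j, ρ j - η ∈ filtHom (F j) (G j)) ∧ ∀ x, θ x = 0 → η x ∈ LinearMap.range θ := by
    intro ρ hρ
    choose δ γ h using fun j => exists_eq_comp_add_comp (hρ j)
    obtain ⟨η, hη, hη'⟩ := h₂ δ γ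
    exact ⟨η, fun j => by rw [h j]; exact hη j, hη'⟩
  constructor
  · intro φ hφ
    choose α hα hαφ using fun j => exists_filtered_lift (hF j) (hG j).mono _ _ (hφ j)
    obtain ⟨ρ, hρ⟩ := hlift φ
    obtain ⟨η, hη, hη'⟩ := hcorr (fun j => ρ - α j) fun j x hx => by
      rw [← Submodule.Quotient.mk_eq_zero]
      have h3 := hρ ⟨x, hx⟩
      have h4 := hαφ j ⟨x, hx⟩
      rw [← h4] at h3
      rw [← Submodule.mkQ_apply, LinearMap.sub_apply, map_sub]
      exact sub_eq_zero.2 h3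
    have h5 := h₁ (ρ - η) fun j => by
      have := add_mem (hη j) (hα j)
      convert this using 1
      abel
    ext ⟨x, hx⟩
    rw [← hρ]
    refine (Submodule.Quotient.mk_eq_zero _).2 ?_
    have := add_mem (h5 x hx) (hη' x hx)
    simpa using this
  · intro h ρ
    obtain ⟨φ, hφ⟩ := h fun j => (LinearMap.range θ).mkQ ∘ₗ ρ j ∘ₗ (LinearMap.ker θ).subtype
    obtain ⟨σ, hσ⟩ := hlift φ
    choose α hα hαφ using fun j => exists_filtered_lift (hF j) (hG j).mono _ _ (hφ j)
    obtain ⟨η, hη, -⟩ := hcorr (fun j => ρ j - σ - α j) fun j x hx => by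
      rw [← Submodule.Quotient.mk_eq_zero]
      have h3 := hσ ⟨x, hx⟩
      have h4 := hαφ j ⟨x, hx⟩
      rw [← Submodule.mkQ_apply, LinearMap.sub_apply, LinearMap.sub_apply, map_sub, map_sub, h4,
        LinearMap.sub_apply, ← h3]
      exact sub_self _
    refine ⟨σ + η, fun j => ?_⟩
    have := add_mem (hη j) (hα j)
    convert this using 1
    abel

end

variable {W : Type*} [AddCommGroup W] [Module k W]

lemma finrank_comap_subtype (S P : Submodule k W) :
    finrank k (P.comap S.subtype) = finrank k (S ⊓ P : Submodule k W) := by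
  rw [← Submodule.map_comap_subtype]
  exact (Submodule.finrank_map_subtype_eq _ _).symm

lemma finrank_map_add_inf_ker [FiniteDimensional k W] {Q : Type*} [AddCommGroup Q] [Module k Q]
    (f : W →ₗ[k] Q) (P : Submodule k W) :
    finrank k (P.map f) + finrank k (P ⊓ LinearMap.ker f : Submodule k W) = finrank k P := by
  have := (f.domRestrict P).finrank_range_add_finrank_ker
  rw [LinearMap.range_domRestrict, LinearMap.ker_domRestrict] at this
  rw [← this, ← finrank_comap_subtype]

lemma finrank_map_mkQ [FiniteDimensional k W] (T P : Submodule k W) :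
    finrank k (P.map T.mkQ) + finrank k (T ⊓ P : Submodule k W) = finrank k P := by
  have := finrank_map_add_inf_ker T.mkQ P
  rwa [Submodule.ker_mkQ, inf_comm] at this

/-- The Euler characteristic of maps from a subspace to the quotient by another. -/
def hnChi {s : ℕ} (n : ℕ) (E : Fin s → ℕ → Submodule k W) (S T : Submodule k W) : ℤ :=
  finrank k S * (finrank k W - finrank k T) - ∑ j, ∑ u ∈ Finset.range n,
    (finrank k (S ⊓ E j u : Submodule k W) : ℤ) *
      ((finrank k (E j (u + 1)) - finrank k (T ⊓ E j (u + 1) : Submodule k W)) -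
        (finrank k (E j u) - finrank k (T ⊓ E j u : Submodule k W)))

lemma exists_destabilizing [FiniteDimensional k W] {s : ℕ} {E : Fin s → ℕ → Submodule k W}
    {S L : Submodule k W} (hSL : S ≤ L) {S' : Submodule k L} (hS' : S' = S.comap L.subtype)
    {φ : S →ₗ[k] L ⧸ S'} (hφ0 : φ ≠ 0)
    (hφ : ∀ j, φ ∈ filtHom (fun u => (E j u).comap S.subtype)
      (fun u => ((E j u).comap L.subtype).map S'.mkQ)) :
    ∃ S₁ S₂ : Submodule k W, S₁ ≤ L ∧ S₂ ≤ L ∧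
      finrank k S₁ + finrank k S₂ = 2 * finrank k S ∧ finrank k S < finrank k S₂ ∧
      ∀ j u, 2 * finrank k (S ⊓ E j u : Submodule k W) ≤
        finrank k (S₁ ⊓ E j u : Submodule k W) + finrank k (S₂ ⊓ E j u : Submodule k W) := by
  set R := LinearMap.range φ
  have hS₁P : ∀ P : Submodule k W, (LinearMap.ker φ).map S.subtype ⊓ P =
      (P.comap S.subtype ⊓ LinearMap.ker φ).map S.subtype := fun P => by
    rw [Submodule.map_inf_eq_map_inf_comap, inf_comm]
  have hS₂P : ∀ P : Submodule k W, (R.comap S'.mkQ).map L.subtype ⊓ P =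
      (R.comap S'.mkQ ⊓ P.comap L.subtype).map L.subtype := fun P => by
    rw [Submodule.map_inf_eq_map_inf_comap]
  have e₁ : ∀ P : Submodule k W, finrank k ((P.comap S.subtype).map φ) +
      finrank k ((LinearMap.ker φ).map S.subtype ⊓ P : Submodule k W) =
      finrank k (S ⊓ P : Submodule k W) := fun P => by
    rw [hS₁P, Submodule.finrank_map_subtype_eq, finrank_map_add_inf_ker, finrank_comap_subtype]
  have e₂ : ∀ P : Submodule k W,
      finrank k ((R.comap S'.mkQ ⊓ P.comap L.subtype).map S'.mkQ) +
        finrank k (S ⊓ P : Submodule k W) =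
      finrank k ((R.comap S'.mkQ).map L.subtype ⊓ P : Submodule k W) := fun P => by
    rw [hS₂P, Submodule.finrank_map_subtype_eq, ← finrank_map_mkQ S']
    congr 1
    have : S' ⊓ (R.comap S'.mkQ ⊓ P.comap L.subtype) = (S ⊓ P).comap L.subtype := by
      have h : S' ≤ R.comap S'.mkQ := fun x hx => by
        rw [Submodule.mem_comap, Submodule.mkQ_apply, (Submodule.Quotient.mk_eq_zero _).2 hx]
        exact zero_mem _
      rw [← inf_assoc, inf_eq_left.2 h, Submodule.comap_inf, hS']
    rw [this, finrank_comap_subtype, ← inf_assoc, inf_eq_right.2 hSL]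
  have htop₁ := e₁ ⊤
  have htop₂ := e₂ ⊤
  rw [Submodule.comap_top, Submodule.map_top, inf_top_eq, inf_top_eq] at htop₁
  rw [Submodule.comap_top, inf_top_eq, inf_top_eq, inf_top_eq,
    Submodule.map_comap_eq_of_surjective (Submodule.mkQ_surjective _)] at htop₂
  change finrank k R + _ = _ at htop₁
  have hR : 0 < finrank k R := by
    rw [Module.finrank_pos_iff, Submodule.nontrivial_iff_ne_bot]
    exact fun h => hφ0 (LinearMap.range_eq_bot.1 h)
  refine ⟨(LinearMap.ker φ).map S.subtype, (R.comap S'.mkQ).map L.subtype,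
    (Submodule.map_subtype_le _ _).trans hSL, Submodule.map_subtype_le _ _, by omega, by omega,
    fun j u => ?_⟩
  have h1 := e₁ (E j u)
  have h2 := e₂ (E j u)
  have h3 : ((E j u).comap S.subtype).map φ ≤
      (R.comap S'.mkQ ⊓ (E j u).comap L.subtype).map S'.mkQ := by
    rintro _ ⟨x, hx, rfl⟩
    obtain ⟨y, hy, hyx⟩ := hφ j u x hx
    exact ⟨y, ⟨by rw [SetLike.mem_coe, Submodule.mem_comap, hyx]; exact ⟨x, rfl⟩, hy⟩, hyx⟩
  have h4 := Submodule.finrank_mono h3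
  omega

lemma exists_hnChi_self_neg [FiniteDimensional k W] {n s : ℕ} {E : Fin s → ℕ → Submodule k W}
    (hE : ∀ j, IsFilt n (E j)) {K L : Submodule k W} (hKL : K ≤ L) (h : hnChi n E K L < 0) :
    ∃ S : Submodule k W, hnChi n E S S < 0 := by
  classical
  have hg : ∀ (T : Submodule k W) j u,
      (finrank k (E j u) : ℤ) - finrank k (T ⊓ E j u : Submodule k W)
      = finrank k ((E j u).map T.mkQ) := fun T j u => by
    have := finrank_map_mkQ T (E j u); omega
  have hΔ : ∀ j u, (0 : ℤ) ≤
      ((finrank k (E j (u + 1)) - finrank k (L ⊓ E j (u + 1) : Submodule k W)) -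
        (finrank k (E j u) - finrank k (L ⊓ E j u : Submodule k W))) := fun j u => by
    rw [hg, hg, sub_nonneg]
    exact_mod_cast Submodule.finrank_mono (Submodule.map_mono ((hE j).mono (Nat.le_succ u)))
  set Δ : Fin s → ℕ → ℤ := fun j u =>
    ((finrank k (E j (u + 1)) - finrank k (L ⊓ E j (u + 1) : Submodule k W)) -
        (finrank k (E j u) - finrank k (L ⊓ E j u : Submodule k W))) with hΔd
  have hN : ∀ S, hnChi n E S L = finrank k S * (finrank k W - finrank k L) -
      ∑ j, ∑ u ∈ Finset.range n, (finrank k (S ⊓ E j u : Submodule k W) : ℤ) * Δ j u :=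
    fun S => rfl
  set m := finrank k W
  have hle : ∀ S : Submodule k W, finrank k S ≤ m := fun S => Submodule.finrank_le S
  have hq : (0 : ℤ) ≤ m - finrank k L := by have := hle L; omega
  have hlow : ∀ S, -(∑ j, ∑ u ∈ Finset.range n, (m : ℤ) * Δ j u) ≤ hnChi n E S L := fun S => by
    rw [hN]
    have h1 : ∑ j, ∑ u ∈ Finset.range n, (finrank k (S ⊓ E j u : Submodule k W) : ℤ) * Δ j u ≤
        ∑ j, ∑ u ∈ Finset.range n, (m : ℤ) * Δ j u :=
      Finset.sum_le_sum fun j _ => Finset.sum_le_sum fun u _ =>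
        mul_le_mul_of_nonneg_right (by exact_mod_cast hle _) (hΔ j u)
    have h2 : (0 : ℤ) ≤ finrank k S * (m - finrank k L) := mul_nonneg (by positivity) hq
    linarith
  obtain ⟨_, ⟨S, hSL, rfl⟩, hmin⟩ := Int.exists_least_of_bdd
    (P := fun z : ℤ => ∃ S ≤ L, (m + 1) * hnChi n E S L - finrank k S = z)
    ⟨(m + 1) * (-(∑ j, ∑ u ∈ Finset.range n, (m : ℤ) * Δ j u)) - m, by
      rintro _ ⟨S, -, rfl⟩
      have h1 := hlow S
      have h2 : (finrank k S : ℤ) ≤ m := by exact_mod_cast hle S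
      nlinarith⟩ ⟨_, K, hKL, rfl⟩
  replace hmin : ∀ T ≤ L, ((m : ℤ) + 1) * hnChi n E S L - finrank k S ≤
      (m + 1) * hnChi n E T L - finrank k T := fun T hT => hmin _ ⟨T, hT, rfl⟩
  have hminN : ∀ T ≤ L, hnChi n E S L ≤ hnChi n E T L := fun T hT => by
    have h1 := hmin T hT
    have h2 : (finrank k S : ℤ) ≤ m := by exact_mod_cast hle S
    by_contra! h3
    nlinarith
  have hSneg : hnChi n E S L < 0 := (hminN K hKL).trans_lt h
  refine ⟨S, ?_⟩
  have hzero : ∀ φ : S →ₗ[k] L ⧸ S.comap L.subtype,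
      (∀ j, φ ∈ filtHom (fun u => (E j u).comap S.subtype)
      (fun u => ((E j u).comap L.subtype).map (S.comap L.subtype).mkQ)) → φ = 0 := by
    intro φ hφ
    by_contra hφ0
    obtain ⟨S₁, S₂, h1, h2, h12, hlt, hd⟩ := exists_destabilizing hSL rfl hφ0 hφ
    have hsum : hnChi n E S₁ L + hnChi n E S₂ L ≤ 2 * hnChi n E S L := by
      rw [hN, hN, hN]
      have h3 : ∑ j, ∑ u ∈ Finset.range n, (2 * finrank k (S ⊓ E j u : Submodule k W) : ℤ) * Δ j u ≤
          ∑ j, ∑ u ∈ Finset.range n, ((finrank k (S₁ ⊓ E j u : Submodule k W) : ℤ) +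
            finrank k (S₂ ⊓ E j u : Submodule k W)) * Δ j u :=
        Finset.sum_le_sum fun j _ => Finset.sum_le_sum fun u _ =>
          mul_le_mul_of_nonneg_right (by exact_mod_cast hd j u) (hΔ j u)
      simp only [add_mul, Finset.sum_add_distrib, mul_assoc, ← Finset.mul_sum] at h3
      have h4 : (finrank k S₁ : ℤ) + finrank k S₂ = 2 * finrank k S := by exact_mod_cast h12
      have h5 : (finrank k S₁ : ℤ) * (m - finrank k L) + finrank k S₂ * (m - finrank k L)
          = 2 * (finrank k S * (m - finrank k L)) := by
        rw [← add_mul, h4, mul_assoc]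
      linarith
    have h3 := hminN S₁ h1
    have h4 := hminN S₂ h2
    have h5 : hnChi n E S₂ L = hnChi n E S L := by linarith
    have h6 := hmin S₂ h2
    rw [h5] at h6
    have : (finrank k S : ℤ) < finrank k S₂ := by exact_mod_cast hlt
    linarith
  have hFS : ∀ j, IsFilt n fun u => (E j u).comap S.subtype := fun j =>
    (hE j).comap _ S.injective_subtype
  have hGS : ∀ j, IsFilt n fun u => ((E j u).comap L.subtype).map (S.comap L.subtype).mkQ :=
    fun j => ((hE j).comap _ L.injective_subtype).map _ (Submodule.mkQ_surjective _)
  obtain ⟨c, hc, -⟩ := filtChi_add_finrank hFS hGS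
  have hbot : (⨅ j, filtHom (fun u => (E j u).comap S.subtype)
      (fun u => ((E j u).comap L.subtype).map (S.comap L.subtype).mkQ) :
      Submodule k (S →ₗ[k] L ⧸ S.comap L.subtype)) = ⊥ := by
    rw [eq_bot_iff]
    intro φ hφ
    exact hzero φ fun j => (Submodule.mem_iInf _).1 hφ j
  rw [hbot, finrank_bot] at hc
  have hq' : ∀ j u, (finrank k (((E j u).comap L.subtype).map (S.comap L.subtype).mkQ) : ℤ)
      = finrank k (L ⊓ E j u : Submodule k W) - finrank k (S ⊓ E j u : Submodule k W) := by
    intro j u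
    have h1 := finrank_map_mkQ (S.comap L.subtype) ((E j u).comap L.subtype)
    rw [← Submodule.comap_inf, finrank_comap_subtype, finrank_comap_subtype, ← inf_assoc,
      inf_eq_right.2 hSL] at h1
    omega
  have hq'' : (finrank k (L ⧸ S.comap L.subtype) : ℤ) = finrank k L - finrank k S := by
    have h1 := Submodule.finrank_quotient_add_finrank (S.comap L.subtype)
    rw [finrank_comap_subtype, inf_eq_right.2 hSL] at h1
    omega
  have hadd : hnChi n E S S = filtChi n (fun j u => (E j u).comap S.subtype)
      (fun j u => ((E j u).comap L.subtype).map (S.comap L.subtype).mkQ) + hnChi n E S L := by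
    rw [hnChi, hnChi, filtChi]
    simp only [hq', hq'', finrank_comap_subtype]
    have : ∀ a b c d e f : ℤ, a - b = c - d + (e - f) ↔ a - c - e = b - d - f := by
      intros; constructor <;> intro h <;> linarith
    rw [this, ← Finset.sum_sub_distrib, ← Finset.sum_sub_distrib]
    simp only [← Finset.sum_sub_distrib]
    rw [Finset.sum_eq_zero]
    · ring
    · intro j _
      rw [Finset.sum_eq_zero]
      intro u _
      ring
  have : (0 : ℤ) ≤ c := by positivity
  push_cast at hc
  linarith

/-- The obstruction space vanishes at a point of the intersection of cells if a tangent vector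
deforms well to first order. -/
lemma extZero_of_deformation [FiniteDimensional k W] {n s : ℕ} {E : Fin s → ℕ → Submodule k W}
    (hE : ∀ j, IsFilt n (E j)) (hnn : ∀ S : Submodule k W, 0 ≤ hnChi n E S S)
    {V : Submodule k W} {θ : V →ₗ[k] W ⧸ V}
    (h₁ : ∀ η : V →ₗ[k] W ⧸ V,
      (∀ j, η ∈ filtHom (fun u => (E j u).comap V.subtype) (fun u => (E j u).map V.mkQ)) →
      ∀ x, θ x = 0 → η x ∈ LinearMap.range θ)
    (h₂ : ∀ (δ : Fin s → (W ⧸ V) →ₗ[k] (W ⧸ V)) (γ : Fin s → V →ₗ[k] V),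
      ∃ η : V →ₗ[k] W ⧸ V,
      (∀ j, δ j ∘ₗ θ + θ ∘ₗ γ j - η ∈
        filtHom (fun u => (E j u).comap V.subtype) (fun u => (E j u).map V.mkQ)) ∧
      ∀ x, θ x = 0 → η x ∈ LinearMap.range θ) :
    ExtZero (fun j u => (E j u).comap V.subtype) (fun j u => (E j u).map V.mkQ) := by
  have hF : ∀ j, IsFilt n fun u => (E j u).comap V.subtype := fun j =>
    (hE j).comap _ V.injective_subtype
  have hG : ∀ j, IsFilt n fun u => (E j u).map V.mkQ := fun j =>
    (hE j).map _ (Submodule.mkQ_surjective _)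
  by_contra hext
  obtain ⟨hz, himp⟩ := extZero_of_ker_coker hF hG h₁ h₂
  have hext' := mt himp hext
  have hF' : ∀ j, IsFilt n fun u => ((E j u).comap V.subtype).comap (LinearMap.ker θ).subtype :=
    fun j => (hF j).comap _ (LinearMap.ker θ).injective_subtype
  have hG' : ∀ j, IsFilt n fun u => ((E j u).map V.mkQ).map (LinearMap.range θ).mkQ := fun j =>
    (hG j).map _ (Submodule.mkQ_surjective _)
  obtain ⟨c, hc, hc0⟩ := filtChi_add_finrank hF' hG'
  have hbot : (⨅ j, filtHom (fun u => ((E j u).comap V.subtype).comap (LinearMap.ker θ).subtype)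
      (fun u => ((E j u).map V.mkQ).map (LinearMap.range θ).mkQ) :
      Submodule k (LinearMap.ker θ →ₗ[k] (W ⧸ V) ⧸ LinearMap.range θ)) = ⊥ := by
    rw [eq_bot_iff]
    intro φ hφ
    exact hz φ fun j => (Submodule.mem_iInf _).1 hφ j
  rw [hbot, finrank_bot] at hc
  have hcpos : 0 < c := Nat.pos_of_ne_zero fun h => hext' (hc0.2 h)
  set K := (LinearMap.ker θ).map V.subtype
  set L := (LinearMap.range θ).comap V.mkQ
  have hVL : V ≤ L := fun x hx => by
    rw [Submodule.mem_comap, Submodule.mkQ_apply, (Submodule.Quotient.mk_eq_zero _).2 hx]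
    exact zero_mem _
  have hKL : K ≤ L := (Submodule.map_subtype_le _ _).trans hVL
  have hk : ∀ P : Submodule k W, finrank k ((P.comap V.subtype).comap (LinearMap.ker θ).subtype) =
      finrank k (K ⊓ P : Submodule k W) := fun P => by
    rw [finrank_comap_subtype, Submodule.map_inf_eq_map_inf_comap,
      Submodule.finrank_map_subtype_eq]
  have hl : ∀ P : Submodule k W, (finrank k ((P.map V.mkQ).map (LinearMap.range θ).mkQ) : ℤ) =
      finrank k P - finrank k (L ⊓ P : Submodule k W) := fun P => by
    have h := finrank_map_add_inf_ker ((LinearMap.range θ).mkQ ∘ₗ V.mkQ) P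
    rw [LinearMap.ker_comp, Submodule.ker_mkQ, Submodule.map_comp, inf_comm] at h
    change _ + finrank k (L ⊓ P : Submodule k W) = _ at h
    omega
  have hktop := hk ⊤
  have hltop := hl ⊤
  rw [Submodule.comap_top, Submodule.comap_top, inf_top_eq, finrank_top] at hktop
  rw [Submodule.map_top, Submodule.range_mkQ, Submodule.map_top, Submodule.range_mkQ, inf_top_eq,
    finrank_top, finrank_top] at hltop
  have hneg : hnChi n E K L < 0 := by
    have : hnChi n E K L = filtChi n
        (fun j u => ((E j u).comap V.subtype).comap (LinearMap.ker θ).subtype)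
        (fun j u => ((E j u).map V.mkQ).map (LinearMap.range θ).mkQ) := by
      rw [hnChi, filtChi]
      simp only [hk, hl, hktop, hltop]
    rw [this]
    push_cast at hc
    omega
  obtain ⟨S, hS⟩ := exists_hnChi_self_neg hE hKL hneg
  exact absurd (hnn S) (not_le.2 hS)

end KeyLemma

section Cells

variable {k W : Type*} [Field k] [AddCommGroup W] [Module k W] [FiniteDimensional k W] {n r : ℕ}

/-- The basis given by an independent tuple of maximal length. -/
def indepBasis (hW : finrank k W = n) {e : Fin n → W} (he : LinearIndependent k e) :
    Basis (Fin n) k W :=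
  basisOfLinearIndependentOfCardEqFinrank' e he (by simp [hW])

lemma indepBasis_apply (hW : finrank k W = n) {e : Fin n → W} (he : LinearIndependent k e)
    (m : Fin n) : indepBasis hW he m = e m := by simp [indepBasis]

lemma mem_spanFlag_iff (hW : finrank k W = n) {e : Fin n → W} (he : LinearIndependent k e)
    {u : ℕ} {x : W} :
    x ∈ spanFlag k e u ↔ ∀ m : Fin n, u ≤ m → (indepBasis hW he).repr x m = 0 := by
  have h1 : spanFlag k e u = span k (indepBasis hW he '' {a : Fin n | (a : ℕ) < u}) := by
    rw [spanFlag]; congr 2; ext m; rw [indepBasis_apply]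
  rw [h1, Basis.mem_span_image]
  constructor
  · intro h m hm
    by_contra h0
    exact absurd (h (Finsupp.mem_support_iff.2 h0)) (not_lt.2 hm)
  · intro h m hm
    by_contra h0
    exact Finsupp.mem_support_iff.1 hm (h m (not_lt.1 h0))

omit [FiniteDimensional k W] in
lemma finrank_span_image_indep {e : Fin n → W} (he : LinearIndependent k e)
    (p : Fin n → Prop) [DecidablePred p] :
    finrank k (span k (e '' {m | p m})) = (Finset.univ.filter p).card := by
  have h1 : LinearIndependent k fun x : {m // p m} => e x := he.comp _ Subtype.val_injective
  have h2 := finrank_span_eq_card h1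
  have h3 : e '' {m | p m} = Set.range fun x : {m // p m} => e x := by ext; simp
  rw [h3, h2, Fintype.card_subtype]

omit [FiniteDimensional k W] in
lemma finrank_spanFlag {e : Fin n → W} (he : LinearIndependent k e) {u : ℕ} (hu : u ≤ n) :
    finrank k (spanFlag k e u) = u := by
  rw [spanFlag, finrank_span_image_indep he]
  have : (Finset.univ.filter fun a : Fin n => (a : ℕ) < u).card =
      ((Finset.univ.filter fun a : Fin n => (a : ℕ) < u).map Fin.valEmbedding).card :=
    (Finset.card_map _).symm
  rw [this]
  convert Finset.card_range u using 2
  ext m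
  simp only [Finset.mem_map, Finset.mem_filter, Finset.mem_univ, true_and, Fin.valEmbedding_apply,
    Finset.mem_range]
  exact ⟨by rintro ⟨a, h, rfl⟩; exact h, fun h => ⟨⟨m, by omega⟩, h, rfl⟩⟩

lemma isFilt_spanFlag (hW : finrank k W = n) {e : Fin n → W} (he : LinearIndependent k e) :
    IsFilt n (spanFlag k e) where
  mono _ _ h := span_mono (Set.image_mono fun _ ha => lt_of_lt_of_le ha h)
  zero := by simp [spanFlag]
  top := by
    apply Submodule.eq_top_of_finrank_eq
    rw [finrank_spanFlag he le_rfl, hW]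

lemma hnChi_eq_filtChi {s : ℕ} (E : Fin s → ℕ → Submodule k W) (S T : Submodule k W) :
    hnChi n E S T = filtChi n (fun j u => (E j u).comap S.subtype)
      (fun j u => (E j u).map T.mkQ) := by
  have hl : ∀ P : Submodule k W, (finrank k (P.map T.mkQ) : ℤ) =
      finrank k P - finrank k (T ⊓ P : Submodule k W) := fun P => by
    have := finrank_map_mkQ T P; omega
  have hq : (finrank k (W ⧸ T) : ℤ) = finrank k W - finrank k T := by
    have := Submodule.finrank_quotient_add_finrank T; omega
  rw [hnChi, filtChi]
  simp only [hl, hq, finrank_comap_subtype]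

omit [FiniteDimensional k W] in
lemma codim_cell {e : Fin n → W} (he : LinearIndependent k e)
    {i : Fin r → Fin n} (hi : StrictMono i) {V : Submodule k W}
    (hV : cellMem i (spanFlag k e) V) :
    ∑ u ∈ Finset.range n, (finrank k (V ⊓ spanFlag k e u : Submodule k W) : ℤ) *
      ((finrank k (spanFlag k e (u + 1)) -
          finrank k (V ⊓ spanFlag k e (u + 1) : Submodule k W)) -
        (finrank k (spanFlag k e u) - finrank k (V ⊓ spanFlag k e u : Submodule k W))) =
      codimZ n r i := by
  set g : ℕ → ℤ := fun u => (u : ℤ) - (Finset.univ.filter fun a : Fin r => (i a : ℕ) + 1 ≤ u).card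
  have h1 : ∀ u ≤ n, (finrank k (spanFlag k e u) : ℤ) -
      finrank k (V ⊓ spanFlag k e u : Submodule k W) = g u := fun u hu => by
    rw [finrank_spanFlag he hu, hV.2 u hu]
  have h2 : ∀ u ∈ Finset.range n, (finrank k (V ⊓ spanFlag k e u : Submodule k W) : ℤ) *
      ((finrank k (spanFlag k e (u + 1)) -
          finrank k (V ⊓ spanFlag k e (u + 1) : Submodule k W)) -
        (finrank k (spanFlag k e u) - finrank k (V ⊓ spanFlag k e u : Submodule k W))) =
      ∑ a : Fin r, if (i a : ℕ) + 1 ≤ u then g (u + 1) - g u else 0 := fun u hu => by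
    have hu' := Finset.mem_range.1 hu
    rw [h1 _ hu', h1 u hu'.le, hV.2 u hu'.le, ← Finset.sum_filter, Finset.sum_const, nsmul_eq_mul]
  rw [Finset.sum_congr rfl h2, Finset.sum_comm, codimZ]
  refine Finset.sum_congr rfl fun a _ => ?_
  rw [← Finset.sum_filter]
  have h3 : (Finset.range n).filter (fun u => (i a : ℕ) + 1 ≤ u) =
      Finset.Ico ((i a : ℕ) + 1) n := by
    ext u; simp [and_comm]
  rw [h3, Finset.sum_Ico_sub g (i a).2]
  have h4 : g n = n - r := by
    have : (Finset.univ.filter fun b : Fin r => (i b : ℕ) + 1 ≤ n) = Finset.univ := by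
      ext b; simp only [Finset.mem_filter, Finset.mem_univ, true_and, iff_true]; omega
    simp only [g, this, Finset.card_univ, Fintype.card_fin]
  have h5 : g (i a + 1) = i a - a := by
    have : (Finset.univ.filter fun b : Fin r => (i b : ℕ) + 1 ≤ i a + 1) = Finset.Iic a := by
      ext b
      simp only [Finset.mem_filter, Finset.mem_univ, true_and, Finset.mem_Iic]
      rw [← hi.le_iff_le (a := b) (b := a), Fin.le_def]
      omega
    simp only [g, this, Fin.card_Iic]
    push_cast; ring
  rw [h4, h5]; ring

omit [FiniteDimensional k W] in
lemma hnChi_self_eq {s : ℕ} (hW : finrank k W = n) {e : Fin s → Fin n → W}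
    (he : ∀ j, LinearIndependent k (e j)) {i : Fin s → Fin r → Fin n} (hi : ∀ j, StrictMono (i j))
    {V : Submodule k W} (hV : ∀ j, cellMem (i j) (spanFlag k (e j)) V)
    (hVr : finrank k V = r) :
    hnChi n (fun j => spanFlag k (e j)) V V = r * (n - r) - ∑ j, codimZ n r (i j) := by
  rw [hnChi, hVr, hW]
  congr 1
  exact Finset.sum_congr rfl fun j _ => codim_cell (he j) (hi j) (hV j)

lemma finrank_inf_spanFlag_succ_le (hW : finrank k W = n) {e : Fin n → W}
    (he : LinearIndependent k e) (V : Submodule k W) {u : ℕ} (hu : u < n) :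
    finrank k (V ⊓ spanFlag k e (u + 1) : Submodule k W) ≤
      finrank k (V ⊓ spanFlag k e u : Submodule k W) + 1 := by
  have h1 := finrank_map_mkQ V (spanFlag k e (u + 1))
  have h2 := finrank_map_mkQ V (spanFlag k e u)
  have h3 := Submodule.finrank_mono (Submodule.map_mono (f := V.mkQ)
    ((isFilt_spanFlag hW he).mono (Nat.le_succ u)))
  rw [finrank_spanFlag he hu] at h1
  rw [finrank_spanFlag he hu.le] at h2
  rw [Nat.succ_eq_add_one] at h3
  omega

lemma exists_cellMem (hW : finrank k W = n) {e : Fin n → W} (he : LinearIndependent k e)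
    (V : Submodule k W) :
    ∃ i : Fin (finrank k V) → Fin n, StrictMono i ∧ cellMem i (spanFlag k e) V := by
  classical
  let J : Finset (Fin n) := Finset.univ.filter fun m : Fin n =>
    finrank k (V ⊓ spanFlag k e m : Submodule k W) <
      finrank k (V ⊓ spanFlag k e (m + 1) : Submodule k W)
  have hfilt := isFilt_spanFlag hW he
  have hJ : ∀ u ≤ n, (J.filter fun m : Fin n => (m : ℕ) + 1 ≤ u).card =
      finrank k (V ⊓ spanFlag k e u : Submodule k W) := by
    intro u
    induction u with
    | zero =>
      intro _
      rw [hfilt.zero, inf_bot_eq, finrank_bot, Finset.card_eq_zero, Finset.filter_eq_empty_iff]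
      intro m _
      omega
    | succ u ih =>
      intro hu
      have h1 := ih (by omega)
      have h2 := finrank_inf_spanFlag_succ_le hW he V hu
      have h3 : finrank k (V ⊓ spanFlag k e u : Submodule k W) ≤
          finrank k (V ⊓ spanFlag k e (u + 1) : Submodule k W) :=
        Submodule.finrank_mono (inf_le_inf_left _ (hfilt.mono (Nat.le_succ u)))
      by_cases h : (⟨u, hu⟩ : Fin n) ∈ J
      · have h4 : (J.filter fun m : Fin n => (m : ℕ) + 1 ≤ u + 1) =
            insert ⟨u, hu⟩ (J.filter fun m : Fin n => (m : ℕ) + 1 ≤ u) := by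
          ext m
          simp only [Finset.mem_filter, Finset.mem_insert, Fin.ext_iff]
          constructor
          · rintro ⟨h5, h6⟩
            by_cases h7 : (m : ℕ) = u
            · exact Or.inl h7
            · exact Or.inr ⟨h5, by omega⟩
          · rintro (h5 | ⟨h5, h6⟩)
            · obtain rfl : m = ⟨u, hu⟩ := Fin.ext h5
              exact ⟨h, le_rfl⟩
            · exact ⟨h5, by omega⟩
        rw [h4, Finset.card_insert_of_notMem (by simp), h1]
        have := (Finset.mem_filter.1 h).2
        dsimp only at this
        omega
      · have h4 : (J.filter fun m : Fin n => (m : ℕ) + 1 ≤ u + 1) =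
            (J.filter fun m : Fin n => (m : ℕ) + 1 ≤ u) := by
          ext m
          simp only [Finset.mem_filter]
          refine and_congr_right fun h5 => ⟨fun h6 => ?_, fun h6 => by omega⟩
          have h7 : (m : ℕ) ≠ u := fun h7 => h (by
            obtain rfl : m = ⟨u, hu⟩ := Fin.ext h7
            exact h5)
          omega
        rw [h4, h1]
        have h9 : ¬ finrank k (V ⊓ spanFlag k e u : Submodule k W) <
            finrank k (V ⊓ spanFlag k e (u + 1) : Submodule k W) :=
          fun h8 => h (Finset.mem_filter.2 ⟨Finset.mem_univ _, h8⟩)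
        omega
  have hcard : J.card = finrank k V := by
    have := hJ n le_rfl
    rw [hfilt.top, inf_top_eq] at this
    rw [← this]
    congr 1
    ext m
    simp only [Finset.mem_filter, iff_self_and]
    intro; omega
  refine ⟨J.orderEmbOfFin hcard, (J.orderEmbOfFin hcard).strictMono, rfl, fun u hu => ?_⟩
  rw [← hJ u hu]
  have h1 : J = Finset.univ.map (J.orderEmbOfFin hcard).toEmbedding := by
    simp [Finset.map_orderEmbOfFin_univ]
  conv_lhs => rw [h1]
  rw [Finset.filter_map, Finset.card_map]
  rfl

end Cells

section Echelon

variable {k W : Type*} [Field k] [AddCommGroup W] [Module k W] {n r : ℕ}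

/-- The positions below `u` missed by the tuple `i`. -/
def gaps (i : Fin r → Fin n) (u : ℕ) : Finset (Fin n) :=
  Finset.univ.filter fun m => (m : ℕ) < u ∧ ∀ a, i a ≠ m

lemma mem_gaps {i : Fin r → Fin n} {u : ℕ} {m : Fin n} :
    m ∈ gaps i u ↔ (m : ℕ) < u ∧ ∀ a, i a ≠ m := by simp [gaps]

lemma gaps_mono (i : Fin r → Fin n) {u u' : ℕ} (h : u ≤ u') : gaps i u ⊆ gaps i u' :=
  fun _ hm => mem_gaps.2 ⟨(mem_gaps.1 hm).1.trans_le h, (mem_gaps.1 hm).2⟩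

lemma gaps_succ (i : Fin r → Fin n) (a : Fin r) : gaps i (i a + 1) = gaps i (i a) := by
  refine Finset.Subset.antisymm (fun m hm => ?_) (gaps_mono i (Nat.le_succ _))
  obtain ⟨h1, h2⟩ := mem_gaps.1 hm
  refine mem_gaps.2 ⟨lt_of_le_of_ne (Nat.lt_succ_iff.1 h1) fun h => h2 a (Fin.ext h.symm), h2⟩

lemma span_gaps_le (i : Fin r → Fin n) (e : Fin n → W) (u : ℕ) :
    span k (e '' (gaps i u : Set (Fin n))) ≤ spanFlag k e u :=
  span_mono (Set.image_mono fun _ hm => (mem_gaps.1 hm).1)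

/-- The tuple `w` is obtained from `e ∘ i` by adding lower terms in the missed positions. -/
def IsEchelon (i : Fin r → Fin n) (e : Fin n → W) (c : Fin n → Fin r → k) (w : Fin r → W) : Prop :=
  ∀ a, w a = e (i a) + ∑ m ∈ gaps i (i a), c m a • e m

variable {i : Fin r → Fin n} {e : Fin n → W} {c : Fin n → Fin r → k} {w : Fin r → W}

lemma IsEchelon.mem_spanFlag (h : IsEchelon i e c w) (a : Fin r) :
    w a ∈ spanFlag k e (i a + 1) := by
  rw [h a]
  refine add_mem (subset_span ⟨i a, by simp, rfl⟩) (sum_mem fun m hm => smul_mem _ _ ?_)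
  refine subset_span ⟨m, ?_, rfl⟩
  have := (mem_gaps.1 hm).1
  simp only [Set.mem_ofPred_eq]; omega

variable [FiniteDimensional k W]

lemma IsEchelon.repr_sum (hW : finrank k W = n) (he : LinearIndependent k e)
    (hi : Function.Injective i) (h : IsEchelon i e c w) (l : Fin r → k) (b : Fin r) :
    (indepBasis hW he).repr (∑ a, l a • w a) (i b) = l b := by
  classical
  have h1 : ∀ a, (indepBasis hW he).repr (w a) (i b) = if a = b then 1 else 0 := fun a => by
    have h2 : ∀ m, (indepBasis hW he).repr (e m) = Finsupp.single m 1 := fun m => by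
      rw [← indepBasis_apply hW he, Basis.repr_self]
    rw [h a, map_add, map_sum, Finsupp.add_apply, Finsupp.finsetSum_apply, h2,
      Finsupp.single_apply, Finset.sum_eq_zero, add_zero]
    · simp only [hi.eq_iff]
    · intro m hm
      rw [map_smul, h2, Finsupp.smul_apply, Finsupp.single_eq_of_ne, smul_zero]
      exact (mem_gaps.1 hm).2 b
  rw [map_sum, Finsupp.finsetSum_apply]
  simp [h1]

lemma IsEchelon.linearIndependent (hW : finrank k W = n) (he : LinearIndependent k e)
    (hi : Function.Injective i) (h : IsEchelon i e c w) : LinearIndependent k w := by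
  rw [Fintype.linearIndependent_iff]
  intro l hl b
  rw [← h.repr_sum hW he hi l b, hl, map_zero, Finsupp.zero_apply]

lemma IsEchelon.span_inf (hW : finrank k W = n) (he : LinearIndependent k e)
    (hi : Function.Injective i) (h : IsEchelon i e c w) (u : ℕ) :
    span k (Set.range w) ⊓ spanFlag k e u = span k (w '' {a | (i a : ℕ) < u}) := by
  apply le_antisymm
  · rintro x ⟨hx, hxu⟩
    obtain ⟨l, rfl⟩ := (mem_span_range_iff_exists_fun k).1 hx
    refine sum_mem fun a _ => ?_
    by_cases hau : (i a : ℕ) < u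
    · exact smul_mem _ _ (subset_span ⟨a, hau, rfl⟩)
    · have := (mem_spanFlag_iff hW he).1 hxu (i a) (not_lt.1 hau)
      rw [h.repr_sum hW he hi] at this
      simp [this]
  · rw [span_le]
    rintro _ ⟨a, ha, rfl⟩
    exact ⟨subset_span ⟨a, rfl⟩, (isFilt_spanFlag hW he).mono ha (h.mem_spanFlag a)⟩

lemma IsEchelon.cellMem (hW : finrank k W = n) (he : LinearIndependent k e)
    (hi : Function.Injective i) (h : IsEchelon i e c w) :
    cellMem i (spanFlag k e) (span k (Set.range w)) := by
  have hw := h.linearIndependent hW he hi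
  refine ⟨by rw [finrank_span_eq_card hw, Fintype.card_fin], fun u _ => ?_⟩
  rw [h.span_inf hW he hi, finrank_span_image_indep hw]
  rfl

lemma spanFlag_le_sup (hW : finrank k W = n) (he : LinearIndependent k e)
    {V : Submodule k W} (hV : cellMem i (spanFlag k e) V) :
    ∀ u ≤ n, spanFlag k e u ≤ (V ⊓ spanFlag k e u) ⊔ span k (e '' (gaps i u : Set (Fin n))) := by
  have hf := isFilt_spanFlag hW he
  intro u
  induction u with
  | zero => intro _; rw [hf.zero]; exact bot_le
  | succ u ih =>
    intro hu
    have h1 : spanFlag k e u ≤ (V ⊓ spanFlag k e (u + 1)) ⊔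
        span k (e '' (gaps i (u + 1) : Set (Fin n))) :=
      (ih (by omega)).trans (sup_le_sup (inf_le_inf_left _ (hf.mono (Nat.le_succ u)))
        (span_mono (Set.image_mono (Finset.coe_subset.2 (gaps_mono i (Nat.le_succ u))))))
    suffices h2 : e ⟨u, hu⟩ ∈ (V ⊓ spanFlag k e (u + 1)) ⊔
        span k (e '' (gaps i (u + 1) : Set (Fin n))) by
      conv_lhs => rw [spanFlag]
      rw [span_le]
      rintro _ ⟨m, hm, rfl⟩
      rcases Nat.lt_succ_iff_lt_or_eq.1 hm with h3 | h3
      · exact h1 (subset_span ⟨m, h3, rfl⟩)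
      · obtain rfl : m = ⟨u, hu⟩ := Fin.ext h3
        exact h2
    by_cases h3 : ∀ a, i a ≠ ⟨u, hu⟩
    · exact mem_sup_right (subset_span ⟨_, Finset.mem_coe.2 (mem_gaps.2 ⟨Nat.lt_succ_self u, h3⟩),
        rfl⟩)
    · push Not at h3
      obtain ⟨a, ha⟩ := h3
      have h4 : finrank k (V ⊓ spanFlag k e u : Submodule k W) <
          finrank k (V ⊓ spanFlag k e (u + 1) : Submodule k W) := by
        rw [hV.2 u (by omega), hV.2 (u + 1) hu]
        refine Finset.card_lt_card ⟨fun b hb => ?_, fun hsub => ?_⟩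
        · simp only [Finset.mem_filter, Finset.mem_univ, true_and] at hb ⊢; omega
        · have := @hsub a (by simp [ha])
          simp [ha] at this
      obtain ⟨x, hx, hxu⟩ : ∃ x ∈ V ⊓ spanFlag k e (u + 1), x ∉ spanFlag k e u := by
        by_contra! h5
        exact absurd (Submodule.finrank_mono (show V ⊓ spanFlag k e (u + 1) ≤ V ⊓ spanFlag k e u
          from fun x hx => ⟨hx.1, h5 x hx⟩)) (not_le.2 h4)
      set b := indepBasis hW he
      have h6 : x - b.repr x ⟨u, hu⟩ • e ⟨u, hu⟩ ∈ spanFlag k e u := by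
        rw [mem_spanFlag_iff hW he]
        intro m hm
        rw [map_sub, map_smul, ← indepBasis_apply hW he, Basis.repr_self]
        by_cases hmu : m = ⟨u, hu⟩
        · subst hmu; simp [b]
        · have hlt : u + 1 ≤ (m : ℕ) := by
            have : (m : ℕ) ≠ u := fun h => hmu (Fin.ext h)
            omega
          simp [Ne.symm hmu, (mem_spanFlag_iff hW he).1 hx.2 m hlt]
      have h7 : b.repr x ⟨u, hu⟩ ≠ 0 := fun h => hxu (by simpa [h] using h6)
      have h8 : b.repr x ⟨u, hu⟩ • e ⟨u, hu⟩ ∈ (V ⊓ spanFlag k e (u + 1)) ⊔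
          span k (e '' (gaps i (u + 1) : Set (Fin n))) := by
        have := sub_mem (mem_sup_left hx) (h1 h6)
        rwa [sub_sub_cancel] at this
      exact (smul_mem_iff _ h7).1 h8

lemma exists_isEchelon (hW : finrank k W = n) (he : LinearIndependent k e)
    (hi : Function.Injective i) {V : Submodule k W} (hV : cellMem i (spanFlag k e) V) :
    ∃ (c : Fin n → Fin r → k) (w : Fin r → W), IsEchelon i e c w ∧ span k (Set.range w) = V := by
  have h1 : ∀ a, ∃ (l : Fin n → k) (y : W),
      y ∈ V ∧ y = e (i a) + ∑ m ∈ gaps i (i a), l m • e m := by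
    intro a
    have h2 := spanFlag_le_sup hW he hV (i a + 1) (i a).2
      (subset_span ⟨i a, by simp, rfl⟩ : e (i a) ∈ spanFlag k e (i a + 1))
    obtain ⟨y, hy, z, hz, hyz⟩ := Submodule.mem_sup.1 h2
    rw [gaps_succ, Submodule.mem_span_image_finset_iff_exists_fun] at hz
    obtain ⟨l, rfl⟩ := hz
    refine ⟨fun m => if hm : m ∈ gaps i (i a) then -l ⟨m, hm⟩ else 0, y, hy.1, ?_⟩
    rw [← hyz, ← Finset.sum_coe_sort (gaps i (i a))]
    simp
  choose l w hw hwe using h1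
  have hech : IsEchelon i e (fun m a => l a m) w := hwe
  refine ⟨_, w, hech, Submodule.eq_of_le_of_finrank_eq ?_ ?_⟩
  · rw [span_le]; rintro _ ⟨a, rfl⟩; exact hw a
  · rw [hV.1, (hech.cellMem hW he hi).1]

lemma IsEchelon.mem_filtHom_iff (hW : finrank k W = n) (he : LinearIndependent k e)
    (hi : Function.Injective i) (h : IsEchelon i e c w) {V : Submodule k W}
    (hV : span k (Set.range w) = V) (η : V →ₗ[k] W ⧸ V) :
    η ∈ filtHom (fun u => (spanFlag k e u).comap V.subtype)
      (fun u => (spanFlag k e u).map V.mkQ) ↔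
    ∀ a (ha : w a ∈ V), η ⟨w a, ha⟩ ∈ (span k (e '' (gaps i (i a) : Set (Fin n)))).map V.mkQ := by
  have hf := isFilt_spanFlag hW he
  have hc := h.cellMem hW he hi
  rw [hV] at hc
  rw [mem_filtHom]
  constructor
  · intro hη a ha
    have h1 := hη (i a + 1) ⟨w a, ha⟩ (h.mem_spanFlag a)
    have h2 := Submodule.map_mono (f := V.mkQ) (spanFlag_le_sup hW he hc (i a + 1) (i a).2) h1
    rw [Submodule.map_sup, gaps_succ] at h2
    have h3 : (V ⊓ spanFlag k e (i a + 1)).map V.mkQ = ⊥ := by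
      rw [eq_bot_iff, map_le_iff_le_comap]
      intro x hx
      simpa using hx.1
    rwa [h3, bot_sup_eq] at h2
  · rintro hη u ⟨x, hx⟩ hxu
    have h1 : x ∈ span k (w '' {a | (i a : ℕ) < u}) := by
      rw [← h.span_inf hW he hi, hV]; exact ⟨hx, hxu⟩
    have h2 : span k (w '' {a | (i a : ℕ) < u}) ≤
        (((spanFlag k e u).map V.mkQ).comap η).map V.subtype := by
      rw [span_le]
      rintro _ ⟨a, ha, rfl⟩
      have hwa : w a ∈ V := hV ▸ subset_span ⟨a, rfl⟩
      refine ⟨⟨w a, hwa⟩, ?_, rfl⟩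
      exact Submodule.map_mono ((span_gaps_le i e _).trans (hf.mono (le_of_lt ha))) (hη a hwa)
    obtain ⟨y, hy, hyx⟩ := h2 h1
    obtain rfl : y = ⟨x, hx⟩ := Subtype.ext hyx
    exact hy

/-- Parametrization of tuples of vectors `e` such that the span of `v` lies in the Schubert cell
of the flag spanned by `e`. -/
def cellParam (i : Fin r → Fin n) (v : Fin r → W) (f : Fin n → W) (h : Fin r → Fin r → k)
    (c : Fin n → Fin r → k) : Fin n → W :=
  Function.extend i (fun a => ∑ b, h b a • v b - ∑ m ∈ gaps i (i a), c m a • f m) f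

variable {v : Fin r → W} {f : Fin n → W} {h : Fin r → Fin r → k}

omit [FiniteDimensional k W] in
lemma cellParam_gap (i : Fin r → Fin n) (v : Fin r → W) (f : Fin n → W) (h : Fin r → Fin r → k)
    (c : Fin n → Fin r → k) {m : Fin n} (hm : ∀ a, i a ≠ m) : cellParam i v f h c m = f m :=
  Function.extend_apply' _ _ _ (by simpa using hm)

omit [FiniteDimensional k W] in
lemma isEchelon_cellParam (hi : Function.Injective i) :
    IsEchelon i (cellParam i v f h c) c (fun a => ∑ b, h b a • v b) := by
  intro a
  have h1 : ∑ m ∈ gaps i (i a), c m a • cellParam i v f h c m =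
      ∑ m ∈ gaps i (i a), c m a • f m := Finset.sum_congr rfl fun m hm => by
    rw [cellParam_gap _ _ _ _ _ (mem_gaps.1 hm).2]
  rw [h1, cellParam, hi.extend_apply, sub_add_cancel]

lemma span_eq_of_cellParam (hW : finrank k W = n) (hi : Function.Injective i)
    (he : LinearIndependent k (cellParam i v f h c)) :
    span k (Set.range fun a => ∑ b, h b a • v b) = span k (Set.range v) := by
  have h1 := (isEchelon_cellParam (v := v) (f := f) (h := h) (c := c) hi).linearIndependent hW he hi
  refine Submodule.eq_of_le_of_finrank_le ?_ ?_
  · rw [span_le]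
    rintro _ ⟨a, rfl⟩
    exact sum_mem fun b _ => smul_mem _ _ (subset_span ⟨b, rfl⟩)
  · rw [finrank_span_eq_card h1]
    exact finrank_range_le_card v

omit [FiniteDimensional k W] in
lemma IsEchelon.cellParam_eq (hi : Function.Injective i) (hech : IsEchelon i e c w)
    (hw : ∀ a, w a = ∑ b, h b a • v b) (hfe : ∀ m, (∀ a, i a ≠ m) → f m = e m) :
    cellParam i v f h c = e := by
  funext m
  by_cases hm : ∃ a, i a = m
  · obtain ⟨a, rfl⟩ := hm
    rw [cellParam, hi.extend_apply, ← hw, hech a,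
      Finset.sum_congr rfl fun m hm => by rw [← hfe m (mem_gaps.1 hm).2], add_sub_cancel_right]
  · push Not at hm
    rw [cellParam_gap _ _ _ _ _ hm, hfe m hm]

end Echelon

section Tangent

variable {k M : Type*} [Field k] [AddCommGroup M] [Module k M]

lemma hasJet_mEval (p : MvPolynomial (Dual k M) k) (x φ : M) :
    HasJet k (fun t => mEval k (x + t • φ) p) (mEval k x p)
      (mEval k x (MvPolynomial.mkDerivation k (fun l : Dual k M => MvPolynomial.C (l φ)) p)) := by
  induction p using MvPolynomial.induction_on with
  | C c =>
    have := HasJet.const (k := k) c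
    simpa [mEval] using this
  | add p q hp hq => simpa [mEval] using hp.add hq
  | mul_X p l hp =>
    have h1 : HasJet k (fun t => l (x + t • φ)) (l x) (l φ) := (HasJet.line x φ).linear l
    have h2 := HasJet.bilin (LinearMap.mul k k) hp h1
    simp only [LinearMap.mul_apply'] at h2
    convert h2 using 1
    · funext t; simp [mEval]
    · simp [mEval]
    · simp only [Derivation.leibniz, MvPolynomial.mkDerivation_X, mEval, smul_eq_mul, map_add,
        map_mul, MvPolynomial.eval_C, MvPolynomial.eval_X]
      ring

lemma derivation_sum_apply {ι : Type*} (s : Finset ι)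
    (D : ι → Derivation k (MvPolynomial (Dual k M) k) (MvPolynomial (Dual k M) k))
    (p : MvPolynomial (Dual k M) k) : (∑ l ∈ s, D l) p = ∑ l ∈ s, D l p := by
  classical
  induction s using Finset.induction_on with
  | empty => simp
  | insert a s ha ih => rw [Finset.sum_insert ha, Finset.sum_insert ha, Derivation.add_apply, ih]

lemma sum_pderiv_eq [DecidableEq (Dual k M)] (p : MvPolynomial (Dual k M) k) (x φ : M) :
    (∑ l ∈ p.vars, mEval k x (MvPolynomial.pderiv l p) • (l : Dual k M)) φ =
      mEval k x (MvPolynomial.mkDerivation k (fun l : Dual k M => MvPolynomial.C (l φ)) p) := by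
  have h1 : MvPolynomial.mkDerivation k (fun l : Dual k M => MvPolynomial.C (l φ)) p =
      (∑ l ∈ p.vars, (MvPolynomial.C (l φ) : MvPolynomial (Dual k M) k) •
        MvPolynomial.pderiv (R := k) l) p := by
    refine MvPolynomial.derivation_eq_of_forall_mem_vars fun i hi => ?_
    rw [MvPolynomial.mkDerivation_X, derivation_sum_apply, Finset.sum_eq_single i]
    · simp
    · intro l _ hl
      simp [MvPolynomial.pderiv_X_of_ne hl.symm]
    · exact fun h => absurd hi h
  rw [h1, derivation_sum_apply]
  simp only [mEval, Derivation.smul_apply, smul_eq_mul, map_sum, map_mul, MvPolynomial.eval_C,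
    LinearMap.sum_apply, LinearMap.smul_apply]
  exact Finset.sum_congr rfl fun l _ => mul_comm _ _

lemma mem_mTangent_iff [Infinite k] {A : Set M} {x φ : M} :
    φ ∈ mTangent k A x ↔ ∀ f ∈ polyFun k M, (∀ a ∈ A, f a = 0) → ∀ c,
      HasJet k (fun t => f (x + t • φ)) (f x) c → c = 0 := by
  classical
  have h1 : φ ∈ mTangent k A x ↔ ∀ p : MvPolynomial (Dual k M) k, (∀ a ∈ A, mEval k a p = 0) →
      mEval k x (MvPolynomial.mkDerivation k (fun l : Dual k M => MvPolynomial.C (l φ)) p) = 0 := by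
    simp only [mTangent, Submodule.mem_iInf, LinearMap.mem_ker]
    refine forall_congr' fun p => imp_congr Iff.rfl ?_
    rw [← sum_pderiv_eq]
  rw [h1]
  constructor
  · intro h f hf hA c hc
    obtain ⟨p, hp⟩ := mem_polyFun_iff.1 hf
    simp only [hp] at hc hA
    rw [hc.unique (hasJet_mEval p x φ)]
    exact h p hA
  · intro h p hA
    exact h (fun y => mEval k y p) (mem_polyFun_iff.2 ⟨p, fun _ => rfl⟩) hA _ (hasJet_mEval p x φ)

end Tangent

section CellTangent

variable {k W : Type*} [Field k] [AddCommGroup W] [Module k W] [FiniteDimensional k W] {n r : ℕ}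
  {i : Fin r → Fin n} {E : ℕ → Submodule k W} {V C : Submodule k W}

omit [FiniteDimensional k W] in
lemma conjMap_apply (ψ : V →ₗ[k] C) (x : V) : conjMap V C ψ x = V.mkQ (ψ x : W) := rfl

omit [FiniteDimensional k W] in
lemma graphMap_injective (hC : IsCompl V C) (ψ : V →ₗ[k] C) :
    Function.Injective (V.subtype + C.subtype ∘ₗ ψ) := by
  rw [← LinearMap.ker_eq_bot, eq_bot_iff]
  intro x hx
  have h1 : (x : W) = -(ψ x : W) := eq_neg_of_add_eq_zero_left (by simpa using hx)
  have h2 : (x : W) ∈ V ⊓ C := ⟨x.2, h1 ▸ neg_mem (ψ x).2⟩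
  rw [hC.inf_eq_bot, mem_bot] at h2
  simpa using h2

omit [FiniteDimensional k W] in
lemma finrank_graphMap (hC : IsCompl V C) (ψ : V →ₗ[k] C) :
    finrank k (graphMap V C ψ) = finrank k V :=
  LinearMap.finrank_range_of_inj (graphMap_injective hC ψ)

lemma finrank_graphMap_inf (hC : IsCompl V C) (ψ : V →ₗ[k] C) (P : Submodule k W) :
    finrank k (LinearMap.range (P.mkQ ∘ₗ (V.subtype + C.subtype ∘ₗ ψ))) +
      finrank k (graphMap V C ψ ⊓ P : Submodule k W) = finrank k V := by
  have := finrank_map_add_inf_ker P.mkQ (graphMap V C ψ)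
  rwa [Submodule.ker_mkQ, finrank_graphMap hC, graphMap, ← LinearMap.range_comp] at this

lemma conjMap_mem_filtHom [Infinite k] (hE : IsFilt n E) (hV : cellMem i E V) (hC : IsCompl V C)
    {φ : V →ₗ[k] C}
    (hφ : φ ∈ mTangent k {ψ : V →ₗ[k] C | graphMap V C ψ ∈ {V' | cellMem i E V'}} 0) :
    conjMap V C φ ∈ filtHom (fun u => (E u).comap V.subtype) (fun u => (E u).map V.mkQ) := by
  rw [mem_mTangent_iff] at hφ
  intro u v hv
  by_cases hu : n ≤ u
  · have : E u = ⊤ := top_le_iff.1 (hE.top ▸ hE.mono hu)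
    simp [this, Submodule.range_mkQ]
  push Not at hu
  by_contra hcon
  obtain ⟨l, hl0, hl⟩ := Submodule.exists_le_ker_of_notMem hcon
  let L : (V →ₗ[k] C) → V →ₗ[k] W ⧸ E u := fun ψ => (E u).mkQ ∘ₗ (V.subtype + C.subtype ∘ₗ ψ)
  have hL : PolyMap k L :=
    (PolyMap.const _).lcomp ((PolyMap.const _).add ((PolyMap.const _).lcomp PolyMap.id))
  have h0 : L 0 v = 0 := by simpa [L] using hv
  obtain ⟨X, hX, hX0, hXL⟩ := exists_polyMap_section_of_le hL h0
  have hrank : ∀ ψ, cellMem i E (graphMap V C ψ) →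
      finrank k (LinearMap.range (L ψ)) ≤ finrank k (LinearMap.range (L 0)) := by
    intro ψ hψ
    have h1 := finrank_graphMap_inf hC ψ (E u)
    have h2 := finrank_graphMap_inf hC (0 : V →ₗ[k] C) (E u)
    have h3 : graphMap V C 0 = V := by simp [graphMap]
    have h4 := hψ.2 u hu.le
    have h5 := hV.2 u hu.le
    rw [h3] at h2
    change finrank k (LinearMap.range ((E u).mkQ ∘ₗ _)) ≤
      finrank k (LinearMap.range ((E u).mkQ ∘ₗ _))
    omega
  have hf : PolyMap k fun ψ : V →ₗ[k] C => l (conjMap V C ψ (X ψ)) :=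
    (PolyMap.linear l).comp (((PolyMap.linear (conjMap V C)).comp PolyMap.id).apply hX)
  rw [polyMap_iff_mem] at hf
  have hzero : ∀ ψ ∈ {ψ : V →ₗ[k] C | graphMap V C ψ ∈ {V' | cellMem i E V'}},
      l (conjMap V C ψ (X ψ)) = 0 := by
    intro ψ hψ
    have h1 : (X ψ : W) + ψ (X ψ) ∈ E u := (Submodule.Quotient.mk_eq_zero _).1 (hXL ψ (hrank ψ hψ))
    have h2 : conjMap V C ψ (X ψ) ∈ (E u).map V.mkQ :=
      ⟨_, h1, by rw [map_add, conjMap_apply]; simp⟩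
    exact hl h2
  obtain ⟨b, hb⟩ := (hX.comp (polyMap_line (0 : V →ₗ[k] C) φ)).hasJet
  have h3 := ((HasJet.line (0 : V →ₗ[k] C) φ).linear (conjMap V C)).apply hb
  have h4 := hφ _ hf hzero _ (h3.linear l |> fun h => by simpa [hX0] using h)
  exact hl0 (by simpa [hX0] using h4)

lemma finrank_map_inf_of_preserves {g : W →ₗ[k] W} (hg : Function.Injective g) {P : Submodule k W}
    (hP : P ≤ P.comap g) (V : Submodule k W) :
    finrank k (V.map g ⊓ P : Submodule k W) = finrank k (V ⊓ P : Submodule k W) := by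
  have h1 : P.map g = P := Submodule.eq_of_le_of_finrank_eq (map_le_iff_le_comap.2 hP)
    (LinearEquiv.finrank_eq (Submodule.equivMapOfInjective g hg P)).symm
  conv_lhs => rw [← h1, ← Submodule.map_inf _ hg]
  exact (LinearEquiv.finrank_eq (Submodule.equivMapOfInjective g hg _)).symm

/-- A transvection-like map preserving the filtration moves `V` to the graph of a multiple of
a map of rank one. -/
lemma cellMem_graphMap_smulRight (hE : IsFilt n E) (hV : cellMem i E V) (hC : IsCompl V C)
    {u : ℕ} {f : Dual k W} (hf : E u ≤ LinearMap.ker f) {w : W} (hw : w ∈ E (u + 1)) {c : C}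
    {v₀ : V} (hwc : w = c + v₀) {τ : k} (h₁ : 1 - τ * f v₀ ≠ 0) (h₂ : 1 + τ * (f w - f v₀) ≠ 0) :
    cellMem i E (graphMap V C (τ • (f ∘ₗ V.subtype).smulRight c)) := by
  set t := τ / (1 - τ * f v₀)
  let g : W →ₗ[k] W := LinearMap.id + f.smulRight (t • w)
  have hgx : ∀ x, g x = x + f x • t • w := fun x => rfl
  have hinj : Function.Injective g := by
    rw [← LinearMap.ker_eq_bot, eq_bot_iff]
    intro x hx
    rw [LinearMap.mem_ker, hgx] at hx
    have h3 : f x * (1 + t * f w) = 0 := by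
      have := congrArg f hx
      simp only [map_add, map_smul, smul_eq_mul, map_zero] at this
      rw [← this]; ring
    have h4 : 1 + t * f w ≠ 0 := by
      have : 1 + t * f w = (1 + τ * (f w - f v₀)) / (1 - τ * f v₀) := by
        simp only [t]; field_simp; ring
      rw [this]
      exact div_ne_zero h₂ h₁
    have h5 := (mul_eq_zero.1 h3).resolve_right h4
    simpa [h5] using hx
  have hpres : ∀ m, E m ≤ (E m).comap g := by
    intro m x hx
    rw [mem_comap, hgx]
    refine add_mem hx ?_
    by_cases hm : m ≤ u
    · have : f x = 0 := hf (hE.mono hm hx)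
      simp [this]
    · exact smul_mem _ _ (smul_mem _ _ (hE.mono (by omega) hw))
  have hgV : V.map g = graphMap V C (τ • (f ∘ₗ V.subtype).smulRight c) := by
    refine Submodule.eq_of_le_of_finrank_eq ?_ ?_
    · rintro _ ⟨v, hv, rfl⟩
      refine ⟨⟨v, hv⟩ + (f v * t) • v₀, ?_⟩
      have h3 : τ * (f v + f v * t * f v₀) = f v * t := by
        simp only [t]; field_simp; ring
      simp only [LinearMap.add_apply, LinearMap.comp_apply, LinearMap.smul_apply,
        LinearMap.smulRight_apply, Submodule.subtype_apply, map_add, map_smul, hgx, hwc]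
      trans v + (f v * t) • (v₀ : W) + (τ * (f v + f v * t * f v₀)) • (c : W)
      · module
      · rw [h3]; module
    · rw [finrank_graphMap hC]
      exact (LinearEquiv.finrank_eq (Submodule.equivMapOfInjective g hinj V)).symm
  refine ⟨by rw [finrank_graphMap hC, hV.1], fun m hm => ?_⟩
  rw [← hgV, finrank_map_inf_of_preserves hinj (hpres m), hV.2 m hm]

lemma smulRight_mem_grTangent [Infinite k] (hE : IsFilt n E) (hV : cellMem i E V)
    (hC : IsCompl V C) {l : Dual k V} {y : W ⧸ V}
    (h : ∀ u, (∃ x : V, (x : W) ∈ E u ∧ l x ≠ 0) → y ∈ (E u).map V.mkQ) :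
    l.smulRight y ∈ grTangent {V' : Submodule k W | cellMem i E V'} V C := by
  classical
  have hex : ∃ u, y ∈ (E u).map V.mkQ := ⟨n, by simp [hE.top, Submodule.range_mkQ]⟩
  obtain ⟨u, hu, hmin⟩ : ∃ u, y ∈ (E u).map V.mkQ ∧ ∀ m < u, y ∉ (E m).map V.mkQ :=
    ⟨Nat.find hex, Nat.find_spec hex, fun m hm => Nat.find_min hex hm⟩
  cases u with
  | zero =>
    rw [hE.zero, Submodule.map_bot, mem_bot] at hu
    rw [hu, LinearMap.smulRight_zero]
    exact zero_mem _
  | succ u =>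
    have hl : ∀ x : V, (x : W) ∈ E u → l x = 0 := fun x hx => by
      by_contra hne
      exact hmin u (Nat.lt_succ_self u) (h u ⟨x, hx, hne⟩)
    obtain ⟨w, hw, rfl⟩ := hu
    obtain ⟨f, hfV, hfE⟩ : ∃ f : Dual k W, f ∘ₗ V.subtype = l ∧ E u ≤ LinearMap.ker f := by
      have h1 : LinearMap.ker ((E u).mkQ ∘ₗ V.subtype) ≤ LinearMap.ker l := fun x hx =>
        hl x (by simpa using hx)
      obtain ⟨f', hf'⟩ := LinearMap.exists_extend
        (((LinearMap.ker ((E u).mkQ ∘ₗ V.subtype)).liftQ l h1) ∘ₗ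
          ((E u).mkQ ∘ₗ V.subtype).quotKerEquivRange.symm.toLinearMap)
      refine ⟨f' ∘ₗ (E u).mkQ, ?_, ?_⟩
      · ext x
        have h2 := DFunLike.congr_fun hf' ⟨((E u).mkQ ∘ₗ V.subtype) x, x, rfl⟩
        have h3 : ((E u).mkQ ∘ₗ V.subtype).quotKerEquivRange.symm
            ⟨((E u).mkQ ∘ₗ V.subtype) x, x, rfl⟩ = Submodule.Quotient.mk x :=
          LinearMap.quotKerEquivRange_symm_apply_image _ _ _
        simp only [LinearMap.comp_apply, LinearEquiv.coe_coe] at h2 h3 ⊢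
        rw [h3] at h2
        exact h2
      · intro x hx
        have : (E u).mkQ x = 0 := by simpa using hx
        simp only [LinearMap.mem_ker, LinearMap.comp_apply]
        rw [this, map_zero]
    obtain ⟨v₀, hv₀, c, hc, hvc⟩ := Submodule.mem_sup.1 (hC.sup_eq_top ▸ mem_top : w ∈ V ⊔ C)
    refine ⟨l.smulRight ⟨c, hc⟩, ?_, ?_⟩
    swap
    · ext x
      rw [conjMap_apply]
      simp [← hvc, (Submodule.Quotient.mk_eq_zero V).2 hv₀]
    refine mem_mTangent_iff.2 fun p hp hA d hd => ?_
    suffices h0 : ∀ τ : k, p (0 + τ • l.smulRight (⟨c, hc⟩ : C)) = 0 by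
      have h1 : p 0 = 0 := by simpa using h0 0
      rw [funext h0, h1] at hd
      exact hd.unique (HasJet.const 0)
    intro τ₀
    by_contra hne
    have hq : (fun τ : k => p (0 + τ • l.smulRight (⟨c, hc⟩ : C))) ∈ polyFun k k :=
      polyFun_comp hp (polyMap_line _ _)
    have ht : (fun t : k => t) ∈ polyFun k k := polyFun_linear (LinearMap.id : Dual k k)
    have hd₁ : (fun τ : k => 1 - τ * f v₀) ∈ polyFun k k :=
      sub_mem (polyFun_const 1) (mul_mem ht (polyFun_const _))
    have hd₂ : (fun τ : k => 1 + τ * (f w - f v₀)) ∈ polyFun k k :=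
      add_mem (polyFun_const 1) (mul_mem ht (polyFun_const _))
    obtain ⟨x, hx⟩ := polyFun_mul_ne_zero hd₁ hd₂ (x := 0) (y := 0) (by simp) (by simp)
    obtain ⟨τ, h1, h2⟩ := polyFun_mul_ne_zero hq (mul_mem hd₁ hd₂) hne
      (y := x) (mul_ne_zero hx.1 hx.2)
    refine h1 (hA _ ?_)
    have h3 := cellMem_graphMap_smulRight (c := ⟨c, hc⟩) (v₀ := ⟨v₀, hv₀⟩) hE hV hC hfE hw
      (by rw [← hvc, add_comm]) (left_ne_zero_of_mul h2) (right_ne_zero_of_mul h2)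
    rw [hfV] at h3
    rw [zero_add]
    exact h3

/-- The tangent space to a Schubert cell. -/
lemma grTangent_cell [Infinite k] (hE : IsFilt n E) (hV : cellMem i E V) (hC : IsCompl V C) :
    grTangent {V' : Submodule k W | cellMem i E V'} V C =
      filtHom (fun u => (E u).comap V.subtype) (fun u => (E u).map V.mkQ) := by
  classical
  apply le_antisymm
  · rintro _ ⟨φ, hφ, rfl⟩
    exact conjMap_mem_filtHom hE hV hC hφ
  · intro χ hχ
    obtain ⟨-, B, -, hB, hBs, -, hBu⟩ :=
      (hE.comap V.subtype V.injective_subtype).exists_adapted_basis ⊥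
    let b : Basis B k V := Basis.mk hB (by simpa using hBs.ge)
    have hb : ∀ x : B, b x = x := fun x => by simp [b]
    have : Fintype B := FiniteDimensional.fintypeBasisIndex b
    have hsum : χ = ∑ x, (b.coord x).smulRight (χ (b x)) := by
      ext v
      conv_lhs => rw [← b.sum_repr v, map_sum]
      simp
    rw [hsum]
    refine sum_mem fun x _ => smulRight_mem_grTangent hE hV hC fun u hu => ?_
    obtain ⟨v, hv, hv0⟩ := hu
    refine hχ u _ ?_
    by_contra hxu
    have h1 : v ∈ span k (B ∩ ((E u).comap V.subtype : Submodule k V)) := by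
      rw [hBu]; exact hv
    have h2 : span k (B ∩ ((E u).comap V.subtype : Submodule k V)) ≤ LinearMap.ker (b.coord x) := by
      rw [span_le]
      rintro z ⟨hzB, hzu⟩
      have h3 : z = b ⟨z, hzB⟩ := (hb ⟨z, hzB⟩).symm
      rw [SetLike.mem_coe, LinearMap.mem_ker, h3, Basis.coord_apply, Basis.repr_self,
        Finsupp.single_eq_of_ne]
      rintro rfl
      exact hxu (by rw [hb]; exact hzu)
    exact hv0 (h2 h1)

end CellTangent

section PolynomialAlgebra

variable {k E F : Type*} [Field k] [Infinite k] [AddCommGroup E] [Module k E]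
  [AddCommGroup F] [Module k F]

/-- Polynomial functions are polynomials in the coordinates with respect to a basis. -/
def polyFunEquiv {ι : Type*} [Finite ι] (b : Basis ι k E) : MvPolynomial ι k ≃ₐ[k] polyFun k E :=
  (AlgEquiv.ofInjective (MvPolynomial.aeval (R := k) fun i => (b.coord i : E → k)) (by
    rw [injective_iff_map_eq_zero]
    intro p hp
    refine MvPolynomial.funext fun x => ?_
    have := congrFun hp (b.equivFun.symm x)
    rw [aeval_fun_apply] at this
    have h2 : (fun i => b.coord i (b.equivFun.symm x)) = x := by
      ext i
      rw [Basis.coord_apply, ← Basis.equivFun_apply, LinearEquiv.apply_symm_apply]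
    rw [h2] at this
    simpa using this)).trans (Subalgebra.equivOfEq _ _ (by
      rw [← Algebra.adjoin_range_eq_range_aeval, polyFun]
      refine le_antisymm (Algebra.adjoin_mono ?_) (Algebra.adjoin_le ?_)
      · rintro _ ⟨i, rfl⟩
        exact Set.mem_range_self (b.coord i)
      · rintro _ ⟨l, rfl⟩
        cases nonempty_fintype ι
        have : (l : E → k) = ∑ i, l (b i) • (b.coord i : E → k) := by
          ext x
          conv_lhs => rw [← b.sum_repr x]
          simp only [map_sum, map_smul, smul_eq_mul, Finset.sum_apply, Pi.smul_apply,
            Basis.coord_apply]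
          exact Finset.sum_congr rfl fun i _ => mul_comm _ _
        show (l : E → k) ∈ _
        rw [this]
        exact sum_mem fun i _ =>
          Subalgebra.smul_mem _ (Algebra.subset_adjoin (Set.mem_range_self i)) _))

lemma polyFunEquiv_apply {ι : Type*} [Finite ι] (b : Basis ι k E) (p : MvPolynomial ι k) (x : E) :
    (polyFunEquiv b p : E → k) x = MvPolynomial.eval (b.repr x) p :=
  aeval_fun_apply (fun i => (b.coord i : E → k)) p x

lemma exists_polyFun_comp_eq_zero [FiniteDimensional k E] [FiniteDimensional k F]
    {Ψ : E → F} (hΨ : PolyMap k Ψ) (h : finrank k E < finrank k F) :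
    ∃ g ∈ polyFun k F, (∃ x, g x ≠ 0) ∧ ∀ a, g (Ψ a) = 0 := by
  let bE := finBasis k E
  let bF := finBasis k F
  let g : Fin (finrank k F) → MvPolynomial (Fin (finrank k E)) k := fun i =>
    (polyFunEquiv bE).symm ⟨fun x => bF.repr (Ψ x) i, hΨ.coord bF i⟩
  have hg : ∀ i a, MvPolynomial.eval (bE.repr a) (g i) = bF.repr (Ψ a) i := fun i a => by
    rw [← polyFunEquiv_apply, AlgEquiv.apply_symm_apply]
  have hdep : ¬ AlgebraicIndependent k g := fun hi => by
    have := hi.lift_cardinalMk_le_trdeg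
    simp at this
    omega
  rw [algebraicIndependent_iff] at hdep
  push Not at hdep
  obtain ⟨p, hp, hp0⟩ := hdep
  refine ⟨_, (polyFunEquiv bF p).2, ?_, fun a => ?_⟩
  · by_contra! hx
    exact hp0 ((polyFunEquiv bF).injective (by rw [map_zero]; exact Subtype.ext (funext hx)))
  · rw [polyFunEquiv_apply]
    have h1 : (bF.repr (Ψ a) : Fin _ → k) = fun i => MvPolynomial.eval (bE.repr a) (g i) := by
      ext i; rw [hg]
    have h2 : MvPolynomial.eval (fun i => MvPolynomial.eval (bE.repr a) (g i)) p =
        MvPolynomial.eval (bE.repr a) (MvPolynomial.aeval g p) := by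
      have h3 := MvPolynomial.comp_aeval_apply g (MvPolynomial.aeval (R := k) (bE.repr a)) p
      simp only [MvPolynomial.aeval_eq_eval] at h3
      exact h3.symm
    rw [h1, h2, hp, map_zero]

end PolynomialAlgebra

section DimensionCount

variable {k W E : Type*} [Field k] [AddCommGroup W] [Module k W]
  [AddCommGroup E] [Module k E] {n r : ℕ}

section Projections

variable {F G : Type*} [AddCommGroup F] [Module k F] [AddCommGroup G] [Module k G]

lemma PolyMap.fst {f : E → F × G} (hf : PolyMap k f) : PolyMap k fun x => (f x).1 :=
  (PolyMap.linear (LinearMap.fst k F G)).comp hf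

lemma PolyMap.snd {f : E → F × G} (hf : PolyMap k f) : PolyMap k fun x => (f x).2 :=
  (PolyMap.linear (LinearMap.snd k F G)).comp hf

lemma PolyMap.eval {ι : Type*} {M : ι → Type*} [∀ i, AddCommGroup (M i)]
    [∀ i, Module k (M i)] {f : E → ∀ i, M i} (hf : PolyMap k f) (i : ι) :
    PolyMap k fun x => f x i := (PolyMap.linear (LinearMap.proj i)).comp hf

end Projections

lemma polyMap_cellParam {i : Fin r → Fin n} (hi : Function.Injective i) {v : E → Fin r → W}
    {f : E → Fin n → W} {h : E → Fin r → Fin r → k} {c : E → Fin n → Fin r → k}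
    (hv : ∀ a, PolyMap k fun x => v x a) (hf : ∀ m, PolyMap k fun x => f x m)
    (hh : ∀ b a, (fun x => h x b a) ∈ polyFun k E)
    (hc : ∀ m a, (fun x => c x m a) ∈ polyFun k E) :
    PolyMap k fun x => cellParam i (v x) (f x) (h x) (c x) := by
  refine polyMap_pi fun m => ?_
  by_cases hm : ∃ a, i a = m
  · obtain ⟨a, rfl⟩ := hm
    simp only [cellParam, hi.extend_apply]
    exact (PolyMap.sum _ fun b _ => (hv b).smul (hh b a)).sub
      (PolyMap.sum _ fun m _ => (hf m).smul (hc m a))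
  · push Not at hm
    simp only [cellParam_gap _ _ _ _ _ hm]
    exact hf m

lemma card_gaps_add {i : Fin r → Fin n} (hi : StrictMono i) (a : Fin r) :
    (gaps i (i a)).card + a = i a := by
  classical
  have h1 : (Finset.univ.filter fun m : Fin n => m < i a) =
      gaps i (i a) ∪ (Finset.univ.filter fun b : Fin r => b < a).map ⟨i, hi.injective⟩ := by
    ext m
    simp only [Finset.mem_filter, Finset.mem_univ, true_and, Finset.mem_union, mem_gaps,
      Finset.mem_map, Function.Embedding.coeFn_mk]
    constructor
    · intro h
      by_cases hm : ∃ b, i b = m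
      · obtain ⟨b, rfl⟩ := hm
        exact Or.inr ⟨b, hi.lt_iff_lt.1 h, rfl⟩
      · push Not at hm
        exact Or.inl ⟨h, hm⟩
    · rintro (h | ⟨b, h, rfl⟩)
      · exact h.1
      · exact hi h
  have h2 := congrArg Finset.card h1
  rw [Finset.card_union_of_disjoint, Finset.card_map] at h2
  · have e1 : (Finset.univ.filter fun m : Fin n => m < i a).card = i a := by
      rw [Finset.filter_gt_eq_Iio, Fin.card_Iio]
    have e2 : (Finset.univ.filter fun b : Fin r => b < a).card = a := by
      rw [Finset.filter_gt_eq_Iio, Fin.card_Iio]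
    omega
  · rw [Finset.disjoint_left]
    intro m hm hm'
    obtain ⟨b, -, rfl⟩ := Finset.mem_map.1 hm'
    exact (mem_gaps.1 hm).2 b rfl

lemma exists_polyFun_cells_empty [Infinite k] [FiniteDimensional k W] {s : ℕ} (hs : 0 < s)
    (hW : finrank k W = n) (i : Fin s → Fin r → Fin n) (hi : ∀ j, StrictMono (i j))
    (hneg : (r : ℤ) * (n - r) - ∑ j, codimZ n r (i j) < 0) :
    ∃ g ∈ polyFun k (Fin s → Fin n → W), (∃ x, g x ≠ 0) ∧
      ∀ e : Fin s → Fin n → W, (∀ j, LinearIndependent k (e j)) →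
        ∀ K : Submodule k W, (∀ j, cellMem (i j) (spanFlag k (e j)) K) → g e = 0 := by
  classical
  let j₀ : Fin s := ⟨0, hs⟩
  let T : Fin s → Type := fun j => {m : Fin n // ∀ a, i j a ≠ m}
  let Q : Fin s → Type := fun j => (a : Fin r) × {m : Fin n // m ∈ gaps (i j) (i j a)}
  let P := (Fin r → W) × (∀ j, T j → W) × (∀ j, Q j → k) ×
    ({j : Fin s // j ≠ j₀} → Fin r → Fin r → k)
  let fE : P → ∀ j, Fin n → W := fun x j m => if hm : ∀ a, i j a ≠ m then x.2.1 j ⟨m, hm⟩ else 0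
  let cE : P → ∀ j, Fin n → Fin r → k := fun x j m a =>
    if hm : m ∈ gaps (i j) (i j a) then x.2.2.1 j ⟨a, m, hm⟩ else 0
  let hE : P → ∀ j : Fin s, Fin r → Fin r → k := fun x j b a =>
    if hj : j ≠ j₀ then x.2.2.2 ⟨j, hj⟩ b a else if b = a then 1 else 0
  let Ψ : P → Fin s → Fin n → W := fun x j => cellParam (i j) x.1 (fE x j) (hE x j) (cE x j)
  have hΨ : PolyMap k Ψ := by
    refine polyMap_pi fun j => polyMap_cellParam (hi j).injective (fun a => ?_) (fun m => ?_)
      (fun b a => ?_) (fun m a => ?_)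
    · exact PolyMap.id.fst.eval a
    · by_cases hm : ∀ a, i j a ≠ m
      · simp only [fE, dif_pos hm]
        exact (PolyMap.id.snd.fst.eval j).eval (⟨m, hm⟩ : T j)
      · simp only [fE, dif_neg hm]
        exact PolyMap.const 0
    · by_cases hj : j ≠ j₀
      · simp only [hE, dif_pos hj]
        exact polyMap_iff_mem.1
          (((PolyMap.id.snd.snd.snd.eval (⟨j, hj⟩ : {j : Fin s // j ≠ j₀})).eval b).eval a)
      · simp only [hE, dif_neg hj]
        exact polyFun_const _
    · by_cases hm : m ∈ gaps (i j) (i j a)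
      · simp only [cE, dif_pos hm]
        exact polyMap_iff_mem.1 ((PolyMap.id.snd.snd.fst.eval j).eval (⟨a, m, hm⟩ : Q j))
      · simp only [cE, dif_neg hm]
        exact polyFun_const 0
  have hrn : ∀ j : Fin s, Fintype.card (T j) + r = n := fun j => by
    have h1 := Fintype.card_subtype_compl (fun m : Fin n => ∃ a, i j a = m)
    have h2 : Fintype.card {m : Fin n // ∃ a, i j a = m} = r := by
      have h3 : (Finset.univ.filter fun m : Fin n => ∃ a, i j a = m) =
          Finset.univ.image (i j) := by ext m; simp
      rw [Fintype.card_subtype, h3, Finset.card_image_of_injective _ (hi j).injective,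
        Finset.card_univ, Fintype.card_fin]
    have h3 : Fintype.card (T j) = Fintype.card {m : Fin n // ¬ ∃ a, i j a = m} :=
      Fintype.card_congr (Equiv.subtypeEquivRight fun m => by push Not; rfl)
    have h4 : r ≤ n := by simpa using Fintype.card_le_of_injective _ (hi j).injective
    rw [h2, Fintype.card_fin] at h1
    omega
  have hQ : ∀ j, (Fintype.card (Q j) : ℤ) = r * (n - r) - codimZ n r (i j) := fun j => by
    have h1 : Fintype.card (Q j) = ∑ a, (gaps (i j) (i j a)).card := by
      simp only [Q, Fintype.card_sigma, Fintype.card_coe]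
    rw [h1, codimZ, Nat.cast_sum, eq_sub_iff_add_eq, ← Finset.sum_add_distrib]
    have h2 : ∀ a ∈ (Finset.univ : Finset (Fin r)), ((gaps (i j) (i j a)).card : ℤ) +
        (n - r + (a : ℕ) - (i j a : ℕ)) = n - r := fun a _ => by
      have := card_gaps_add (hi j) a; omega
    rw [Finset.sum_congr rfl h2, Finset.sum_const, Finset.card_univ, Fintype.card_fin, nsmul_eq_mul]
  have hfr : finrank k P < finrank k (Fin s → Fin n → W) := by
    have e1 : finrank k P = r * n + ((∑ j, Fintype.card (T j) * n) + ((∑ j, Fintype.card (Q j)) +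
        Fintype.card {j : Fin s // j ≠ j₀} * (r * r))) := by
      simp only [P, Module.finrank_prod, Module.finrank_pi_fintype, Module.finrank_self, hW,
        Finset.sum_const, Finset.card_univ, Fintype.card_fin, smul_eq_mul, mul_one]
    have e2 : finrank k (Fin s → Fin n → W) = s * (n * n) := by
      simp only [Module.finrank_pi_fintype, hW,
        Finset.sum_const, Finset.card_univ, Fintype.card_fin, smul_eq_mul]
    have e3 : Fintype.card {j : Fin s // j ≠ j₀} + 1 = s := by
      have := Fintype.card_subtype_compl (fun j : Fin s => j = j₀)
      rw [Fintype.card_fin, Fintype.card_subtype_eq] at this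
      have h' : Fintype.card {j : Fin s // j ≠ j₀} = Fintype.card {j : Fin s // ¬ j = j₀} := rfl
      omega
    have e4 : (∑ j, Fintype.card (T j) * n : ℕ) = s * (Fintype.card (T j₀) * n) := by
      rw [Finset.sum_congr rfl fun j _ => by
        rw [show Fintype.card (T j) = Fintype.card (T j₀) by have := hrn j; have := hrn j₀; omega]]
      simp
    have e5 : ((∑ j, Fintype.card (Q j) : ℕ) : ℤ) = s * (r * (n - r)) - ∑ j, codimZ n r (i j) := by
      rw [Nat.cast_sum, Finset.sum_congr rfl fun j _ => hQ j, Finset.sum_sub_distrib]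
      simp
    rw [e1, e2, e4]
    zify
    rw [← Nat.cast_sum, e5]
    have e6 : (Fintype.card (T j₀) : ℤ) = n - r := by have := hrn j₀; omega
    have e7 : (Fintype.card {j : Fin s // j ≠ j₀} : ℤ) = s - 1 := by omega
    rw [e6, e7]
    nlinarith
  obtain ⟨g, hg, hx, hg0⟩ := exists_polyFun_comp_eq_zero hΨ hfr
  refine ⟨g, hg, hx, fun e he K hK => ?_⟩
  choose c w hech hspan using fun j => exists_isEchelon hW (he j) (hi j).injective (hK j)
  have hH : ∀ j : Fin s, ∃ h : Fin r → Fin r → k, ∀ a, w j a = ∑ b, h b a • w j₀ b := by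
    intro j
    have : ∀ a, w j a ∈ span k (Set.range (w j₀)) := fun a => by
      rw [hspan j₀, ← hspan j]; exact subset_span ⟨a, rfl⟩
    choose h hh using fun a => (mem_span_range_iff_exists_fun k).1 (this a)
    exact ⟨fun b a => h a b, fun a => (hh a).symm⟩
  choose h hh using hH
  let p : P := (w j₀, fun j m => e j m, fun j q => c j q.2 q.1, fun j => h j)
  have hp : Ψ p = e := by
    funext j
    refine IsEchelon.cellParam_eq (w := w j) (hi j).injective (fun a => ?_) (fun a => ?_)
      fun m hm => ?_
    · rw [hech j a]
      congr 1
      refine Finset.sum_congr rfl fun m hm => ?_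
      simp only [cE, dif_pos hm, p]
    · by_cases hj : j = j₀
      · subst hj
        simp [hE, ite_smul, p]
      · rw [hh]
        simp only [hE, dif_pos hj, p, ne_eq]
    · simp only [fE, dif_pos hm, p]
  rw [← hp]
  exact hg0 p

lemma exists_polyFun_hnChi_nonneg [Infinite k] [FiniteDimensional k W] {s : ℕ} (hs : 0 < s)
    (hW : finrank k W = n) :
    ∃ g ∈ polyFun k (Fin s → Fin n → W), (∃ x, g x ≠ 0) ∧
      ∀ e : Fin s → Fin n → W, (∀ j, LinearIndependent k (e j)) → g e ≠ 0 →
        ∀ S : Submodule k W, 0 ≤ hnChi n (fun j => spanFlag k (e j)) S S := by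
  classical
  have key : ∀ q : (d : Fin (n + 1)) × (Fin s → Fin d → Fin n),
      ∃ g ∈ polyFun k (Fin s → Fin n → W), (∃ x, g x ≠ 0) ∧
      ∀ e : Fin s → Fin n → W, (∀ j, LinearIndependent k (e j)) → g e ≠ 0 →
        (∀ j, StrictMono (q.2 j)) →
        ∀ K : Submodule k W, (∀ j, cellMem (q.2 j) (spanFlag k (e j)) K) →
          0 ≤ ((q.1 : ℕ) : ℤ) * (n - (q.1 : ℕ)) - ∑ j, codimZ n q.1 (q.2 j) := by
    rintro ⟨d, i⟩
    by_cases h : (∀ j, StrictMono (i j)) ∧ ((d : ℕ) : ℤ) * (n - (d : ℕ)) - ∑ j, codimZ n d (i j) < 0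
    · obtain ⟨g, hg, hx, hg0⟩ := exists_polyFun_cells_empty (k := k) hs hW i h.1 h.2
      exact ⟨g, hg, hx, fun e he hge _ K hK => absurd (hg0 e he K hK) hge⟩
    · refine ⟨_, polyFun_const 1, ⟨0, one_ne_zero⟩, fun e he _ hi K hK => ?_⟩
      by_contra! h'
      exact h ⟨hi, h'⟩
  choose g hg hx hg0 using key
  refine ⟨∏ q, g q, prod_mem fun q _ => hg q, ?_, fun e he hge S => ?_⟩
  · obtain ⟨z, hz⟩ := polyFun_prod_ne_zero Finset.univ (fun q _ => hg q) fun q _ => hx q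
    refine ⟨z, ?_⟩
    rw [Finset.prod_apply]
    exact Finset.prod_ne_zero_iff.2 hz
  · rw [Finset.prod_apply] at hge
    choose i hi hcell using fun j => exists_cellMem hW (he j) S
    have hle : finrank k S < n + 1 := by
      have := Submodule.finrank_le S; omega
    have := hg0 ⟨⟨finrank k S, hle⟩, i⟩ e he (Finset.prod_ne_zero_iff.1 hge _ (Finset.mem_univ _))
      hi S hcell
    rwa [hnChi_self_eq hW he hi hcell rfl]

end DimensionCount

section GenericFibre

universe u

variable {A R : Type u} [CommRing A] [IsDomain A] [CommRing R] [IsDomain R] [Algebra A R]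

lemma exists_generic_noether [Algebra.FiniteType A R] (hinj : Function.Injective (algebraMap A R)) :
    ∃ (d : ℕ) (y : Fin d → R) (a : A), a ≠ 0 ∧
      Function.Injective (MvPolynomial.aeval (R := A) y) ∧
      ∀ x : R, ∃ m : ℕ,
        (MvPolynomial.aeval (R := A) y).toRingHom.IsIntegralElem (algebraMap A R a ^ m * x) := by
  classical
  let N := nonZeroDivisors A
  let K := FractionRing A
  let M : Submonoid R := Algebra.algebraMapSubmonoid R N
  let L := Localization M
  have hM : M ≤ nonZeroDivisors R := by
    rintro _ ⟨a, ha, rfl⟩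
    exact mem_nonZeroDivisors_of_ne_zero fun h =>
      nonZeroDivisors.ne_zero ha (hinj (by rw [h, map_zero]))
  have hRL : Function.Injective (algebraMap R L) := IsLocalization.injective L hM
  have : IsDomain L := IsLocalization.isDomain_of_le_nonZeroDivisors L hM
  have : Algebra.FiniteType K L := by
    rw [← RingHom.finiteType_algebraMap]
    have : IsLocalization (N.map (algebraMap A R)) L := inferInstanceAs (IsLocalization M L)
    exact RingHom.finiteType_localizationPreserves (algebraMap A R) N K L
      (RingHom.finiteType_algebraMap.2 inferInstance)
  obtain ⟨d, g, hg, hgi⟩ := exists_integral_inj_algHom_of_fg K L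
  have hden : ∀ i, ∃ (x : R) (b : A), b ≠ 0 ∧
      g (MvPolynomial.X i) * algebraMap R L (algebraMap A R b) = algebraMap R L x := by
    intro i
    obtain ⟨⟨x, _, b, hb, rfl⟩, hx⟩ := IsLocalization.surj M (g (MvPolynomial.X i))
    exact ⟨x, b, nonZeroDivisors.ne_zero hb, hx⟩
  choose y b hb hy using hden
  have hAL : ∀ c : A,
      algebraMap R L (algebraMap A R c) = algebraMap K L (algebraMap A K c) := fun c => by
    rw [← IsScalarTower.algebraMap_apply A R L, ← IsScalarTower.algebraMap_apply A K L]
  have hbK : ∀ i, algebraMap A K (b i) ≠ 0 := fun i h =>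
    hb i (IsFractionRing.injective A K (by rw [h, map_zero]))
  -- rescale the variables so that they map to elements of `R`
  let σ : MvPolynomial (Fin d) K →ₐ[K] MvPolynomial (Fin d) K :=
    MvPolynomial.aeval fun i => MvPolynomial.C (algebraMap A K (b i)) * MvPolynomial.X i
  let τ : MvPolynomial (Fin d) K →ₐ[K] MvPolynomial (Fin d) K :=
    MvPolynomial.aeval fun i => MvPolynomial.C (algebraMap A K (b i))⁻¹ * MvPolynomial.X i
  have hστ : σ.comp τ = AlgHom.id K _ := by
    ext1 i
    simp only [σ, τ, AlgHom.comp_apply, MvPolynomial.aeval_X, map_mul, MvPolynomial.algHom_C,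
      AlgHom.id_apply, MvPolynomial.algebraMap_eq, ← mul_assoc]
    rw [← map_mul, inv_mul_cancel₀ (hbK i), map_one, one_mul]
  have hτσ : τ.comp σ = AlgHom.id K _ := by
    ext1 i
    simp only [σ, τ, AlgHom.comp_apply, MvPolynomial.aeval_X, map_mul, MvPolynomial.algHom_C,
      AlgHom.id_apply, MvPolynomial.algebraMap_eq, ← mul_assoc]
    rw [← map_mul, mul_inv_cancel₀ (hbK i), map_one, one_mul]
  let g' : MvPolynomial (Fin d) K →ₐ[K] L := g.comp σ
  have hg'X : ∀ i, g' (MvPolynomial.X i) = algebraMap R L (y i) := fun i => by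
    simp only [g', σ, AlgHom.comp_apply, MvPolynomial.aeval_X, map_mul, MvPolynomial.algHom_C]
    rw [← hy, hAL, mul_comm]
  have hg'i : g'.toRingHom.IsIntegral := by
    refine RingHom.IsIntegral.trans σ.toRingHom g.toRingHom (fun x => ?_) hgi
    have := RingHom.isIntegralElem_map σ.toRingHom (x := τ x)
    rwa [show σ.toRingHom (τ x) = x from DFunLike.congr_fun hστ x] at this
  have hg'inj : Function.Injective g' := by
    refine hg.comp (Function.LeftInverse.injective (g := τ) fun x => DFunLike.congr_fun hτσ x)
  let B := MvPolynomial (Fin d) A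
  let : Algebra B (MvPolynomial (Fin d) K) := MvPolynomial.algebraMvPolynomial
  let : Algebra B R := (MvPolynomial.aeval (R := A) y).toRingHom.toAlgebra
  let : Algebra (MvPolynomial (Fin d) K) L := g'.toRingHom.toAlgebra
  have hcomm : (algebraMap B L) =
      (algebraMap (MvPolynomial (Fin d) K) L).comp (algebraMap B (MvPolynomial (Fin d) K)) := by
    rw [IsScalarTower.algebraMap_eq B R L]
    refine MvPolynomial.ringHom_ext (fun c => ?_) fun i => ?_
    · show algebraMap R L (MvPolynomial.aeval (R := A) y (MvPolynomial.C c)) =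
        g' (MvPolynomial.map (algebraMap A K) (MvPolynomial.C c))
      rw [MvPolynomial.map_C, MvPolynomial.algHom_C, MvPolynomial.algHom_C, hAL]
    · show algebraMap R L (MvPolynomial.aeval (R := A) y (MvPolynomial.X i)) =
        g' (MvPolynomial.map (algebraMap A K) (MvPolynomial.X i))
      rw [MvPolynomial.map_X, hg'X, MvPolynomial.aeval_X]
  have : IsScalarTower B (MvPolynomial (Fin d) K) L := .of_algebraMap_eq fun x =>
    DFunLike.congr_fun hcomm x
  have hint : ∀ x : R, ∃ a : A, a ≠ 0 ∧ IsIntegral B (algebraMap A R a * x) := fun x => by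
    have h1 : IsIntegral (MvPolynomial (Fin d) K) (algebraMap R L x) := hg'i _
    obtain ⟨⟨_, a, ha, rfl⟩, h⟩ := h1.exists_multiple_integral_of_isLocalization
      (R := B) (N.map (MvPolynomial.C (σ := Fin d)))
    refine ⟨a, nonZeroDivisors.ne_zero ha, ?_⟩
    refine (isIntegral_algHom_iff (IsScalarTower.toAlgHom B R L) hRL).1 ?_
    rw [Submonoid.smul_def, Algebra.smul_def] at h
    have e : algebraMap R L (algebraMap A R a * x) =
        algebraMap B L (MvPolynomial.C a) * algebraMap R L x := by
      rw [map_mul, IsScalarTower.algebraMap_apply B R L]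
      congr 2
      exact (MvPolynomial.algHom_C (MvPolynomial.aeval (R := A) y) a).symm
    exact e ▸ h
  obtain ⟨G, hG⟩ := (‹Algebra.FiniteType A R› : Algebra.FiniteType A R).out
  choose α hα0 hα using hint
  refine ⟨d, y, ∏ z ∈ G, α z, Finset.prod_ne_zero_iff.2 fun z _ => hα0 z, ?_, fun x => ?_⟩
  · have h1 : Function.Injective ((algebraMap R L) ∘ (algebraMap B R)) := by
      have : ((algebraMap R L) ∘ (algebraMap B R)) = g' ∘ MvPolynomial.map (algebraMap A K) :=
        funext fun x => DFunLike.congr_fun hcomm x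
      rw [this]
      exact hg'inj.comp (MvPolynomial.map_injective _ (IsFractionRing.injective A K))
    exact h1.of_comp
  · have hA : ∀ c : A, IsIntegral B (algebraMap A R c) := fun c => by
      have : algebraMap A R c = algebraMap B R (MvPolynomial.C c) :=
        (MvPolynomial.algHom_C (MvPolynomial.aeval (R := A) y) c).symm
      rw [this]
      exact isIntegral_algebraMap
    show ∃ m : ℕ, IsIntegral B _
    have hx : x ∈ Algebra.adjoin A (G : Set R) := hG ▸ Algebra.mem_top
    induction hx using Algebra.adjoin_induction with
    | mem x hx =>
      refine ⟨1, ?_⟩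
      rw [pow_one, ← Finset.prod_erase_mul _ _ hx, map_mul, mul_assoc]
      exact (hA _).mul (hα x)
    | algebraMap c => exact ⟨0, by simpa using hA c⟩
    | add x₁ x₂ _ _ h₁ h₂ =>
      obtain ⟨m₁, h₁⟩ := h₁
      obtain ⟨m₂, h₂⟩ := h₂
      refine ⟨m₁ + m₂, ?_⟩
      have e : algebraMap A R (∏ z ∈ G, α z) ^ (m₁ + m₂) * (x₁ + x₂) =
        algebraMap A R (∏ z ∈ G, α z) ^ m₂ * (algebraMap A R (∏ z ∈ G, α z) ^ m₁ * x₁) +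
        algebraMap A R (∏ z ∈ G, α z) ^ m₁ * (algebraMap A R (∏ z ∈ G, α z) ^ m₂ * x₂) := by ring
      rw [e]
      exact (((hA _).pow _).mul h₁).add (((hA _).pow _).mul h₂)
    | mul x₁ x₂ _ _ h₁ h₂ =>
      obtain ⟨m₁, h₁⟩ := h₁
      obtain ⟨m₂, h₂⟩ := h₂
      refine ⟨m₁ + m₂, ?_⟩
      have e : algebraMap A R (∏ z ∈ G, α z) ^ (m₁ + m₂) * (x₁ * x₂) =
        (algebraMap A R (∏ z ∈ G, α z) ^ m₁ * x₁) *
        (algebraMap A R (∏ z ∈ G, α z) ^ m₂ * x₂) := by ring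
      rw [e]
      exact h₁.mul h₂

theorem exists_generic_fibre_dense [UniqueFactorizationMonoid A] [Algebra.FiniteType A R]
    (hinj : Function.Injective (algebraMap A R)) {f : R} (hf : f ≠ 0) :
    ∃ a : A, a ≠ 0 ∧ ∀ (m : Ideal A) (Q : Ideal R) [m.IsPrime] [Q.IsPrime],
      a ∉ m → Q.comap (algebraMap A R) = m → ∀ q ∉ Q, f * q ∉ (m.map (algebraMap A R)).radical := by
  classical
  obtain ⟨d, y, a, ha, hψ, hint⟩ := exists_generic_noether hinj
  let B := MvPolynomial (Fin d) A
  let : Algebra B R := (MvPolynomial.aeval (R := A) y).toRingHom.toAlgebra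
  have : IsScalarTower A B R := .of_algebraMap_eq fun c =>
    (MvPolynomial.algHom_C (MvPolynomial.aeval (R := A) y) c).symm
  let S := integralClosure B R
  have hBS : Function.Injective (algebraMap B S) := fun x y h =>
    hψ (congrArg (Subtype.val : S → R) h)
  have : FaithfulSMul B S := (faithfulSMul_iff_algebraMap_injective B S).2 hBS
  let toS : ∀ x : R, ∃ m : ℕ, algebraMap A R a ^ m * x ∈ S := hint
  choose ν hν using toS
  have haR : algebraMap A R a ≠ 0 := fun h => ha (hinj (by rw [h, map_zero]))
  let f' : S := ⟨_, hν f⟩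
  have hf' : f' ≠ 0 := fun h => mul_ne_zero (pow_ne_zero _ haR) hf (congrArg Subtype.val h)
  obtain ⟨g, hg, hfg⟩ := (Algebra.IsIntegral.isIntegral (R := B) f').isAlgebraic.exists_nonzero_dvd
    (mem_nonZeroDivisors_of_ne_zero hf')
  obtain ⟨μ, hμ⟩ := MvPolynomial.ne_zero_iff.1 hg
  refine ⟨a * g.coeff μ, mul_ne_zero ha hμ, fun m Q _ _ ham hQ q hq hrad => ?_⟩
  have ham' : a ∉ m := fun h => ham (m.mul_mem_right _ h)
  have hgm : g.coeff μ ∉ m := fun h => ham (m.mul_mem_left _ h)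
  let p : Ideal B := m.map MvPolynomial.C
  have hp : p.IsPrime := by
    have : p = RingHom.ker (MvPolynomial.map (σ := Fin d) (Ideal.Quotient.mk m)) := by
      rw [MvPolynomial.ker_map, Ideal.mk_ker]
    rw [this]
    exact RingHom.ker_isPrime _
  have hCR : ∀ c : A, algebraMap B R (MvPolynomial.C c) = algebraMap A R c :=
    fun c => (IsScalarTower.algebraMap_apply A B R c).symm
  let QS : Ideal S := Q.comap (algebraMap S R)
  have hpQ : p ≤ QS.under B := by
    refine Ideal.map_le_iff_le_comap.2 fun c hc => ?_
    show algebraMap B R (MvPolynomial.C c) ∈ Q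
    rw [hCR]
    rwa [← hQ] at hc
  obtain ⟨P, hPQ, hP, hPp⟩ := Ideal.exists_ideal_le_liesOver_of_le (p := p) (q := QS.under B) QS hpQ
  have hfP : f' ∉ P := fun h => by
    have h1 : algebraMap B S g ∈ P := P.mem_of_dvd hfg h
    have h2 : g ∈ p := by rwa [hPp.over, Ideal.mem_comap]
    exact hgm (MvPolynomial.mem_map_C_iff.1 h2 μ)
  have haQ : algebraMap A R a ∉ Q := fun h => ham' (by rwa [← hQ])
  let aS : S := algebraMap B S (MvPolynomial.C a)
  have haS : (aS : R) = algebraMap A R a := hCR a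
  have haP : aS ∉ P := fun h => haQ (by rw [← haS]; exact hPQ h)
  let q' : S := ⟨_, hν q⟩
  have hqP : q' ∉ P := fun h => (Ideal.IsPrime.mul_notMem ‹Q.IsPrime›
    (fun h' => haQ (‹Q.IsPrime›.mem_of_pow_mem _ h')) hq) (hPQ h)
  have hgen : ∀ x ∈ m.map (algebraMap A R),
      ∃ M : ℕ, ∃ z ∈ P, (z : R) = algebraMap A R a ^ M * x := by
    intro x hx
    induction hx using Submodule.span_induction with
    | mem x hx =>
      obtain ⟨c, hc, rfl⟩ := hx
      refine ⟨0, algebraMap B S (MvPolynomial.C c), ?_, ?_⟩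
      · have : MvPolynomial.C c ∈ p := Ideal.mem_map_of_mem _ hc
        rwa [hPp.over] at this
      · rw [pow_zero, one_mul]
        exact hCR c
    | zero => exact ⟨0, 0, P.zero_mem, by simp⟩
    | add x₁ x₂ _ _ h₁ h₂ =>
      obtain ⟨M₁, z₁, hz₁, e₁⟩ := h₁
      obtain ⟨M₂, z₂, hz₂, e₂⟩ := h₂
      refine ⟨M₁ + M₂, aS ^ M₂ * z₁ + aS ^ M₁ * z₂,
        P.add_mem (P.mul_mem_left _ hz₁) (P.mul_mem_left _ hz₂), ?_⟩
      push_cast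
      rw [haS, e₁, e₂]
      ring
    | smul c x _ h =>
      obtain ⟨M, z, hz, e⟩ := h
      refine ⟨ν c + M, ⟨_, hν c⟩ * z, P.mul_mem_left _ hz, ?_⟩
      push_cast
      rw [e, smul_eq_mul]
      ring
  obtain ⟨l, hl⟩ := hrad
  obtain ⟨M, z, hz, e⟩ := hgen _ hl
  have h1 : aS ^ M * (f' * q') ^ l = aS ^ (ν f * l + ν q * l) * z := by
    apply Subtype.ext
    push_cast
    rw [haS, e]
    simp only [f', q']
    ring
  have h2 : aS ^ M * (f' * q') ^ l ∉ P := hP.mul_notMem (fun h => haP (hP.mem_of_pow_mem _ h))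
    (fun h => hP.mul_notMem hfP hqP (hP.mem_of_pow_mem _ h))
  exact h2 (h1 ▸ P.mul_mem_left _ hz)

end GenericFibre

section FibreDensity

variable {k E F : Type} [Field k] [AddCommGroup E] [Module k E] [AddCommGroup F] [Module k F]

/-- Evaluation of polynomial functions at a point. -/
def polyFunEval (x : E) : polyFun k E →+* k :=
  (Pi.evalRingHom (fun _ : E => k) x).comp (polyFun k E).val.toRingHom

/-- Pullback of polynomial functions along a polynomial map. -/
def polyFunPullback {Φ : E → F} (hΦ : PolyMap k Φ) : polyFun k F →ₐ[k] polyFun k E where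
  toFun g := ⟨fun x => (g : F → k) (Φ x), polyFun_comp g.2 hΦ⟩
  map_one' := rfl
  map_mul' _ _ := rfl
  map_zero' := rfl
  map_add' _ _ := rfl
  commutes' _ := rfl

variable [IsAlgClosed k] [FiniteDimensional k E] [FiniteDimensional k F]

lemma exists_ne_zero_of_notMem_radical (J : Ideal (polyFun k E)) {f : polyFun k E}
    (hf : f ∉ J.radical) : ∃ x, (∀ g ∈ J, (g : E → k) x = 0) ∧ (f : E → k) x ≠ 0 := by
  let b := finBasis k E
  let φ := (polyFunEquiv b).toRingEquiv.toRingHom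
  have h1 : (polyFunEquiv b).symm f ∉ (J.comap φ).radical := by
    rw [← Ideal.comap_radical, Ideal.mem_comap]
    have : φ ((polyFunEquiv b).symm f) = f := (polyFunEquiv b).apply_symm_apply f
    rwa [this]
  rw [← MvPolynomial.vanishingIdeal_zeroLocus_eq_radical (K := k),
    MvPolynomial.mem_vanishingIdeal_iff] at h1
  push Not at h1
  obtain ⟨z, hz, hzf⟩ := h1
  have hrepr : (b.repr (b.equivFun.symm z) : Fin _ → k) = z := by
    rw [← Basis.equivFun_apply, LinearEquiv.apply_symm_apply]
  have hev : ∀ g : polyFun k E, (g : E → k) (b.equivFun.symm z)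
      = MvPolynomial.eval z ((polyFunEquiv b).symm g) := fun g => by
    conv_lhs => rw [← (polyFunEquiv b).apply_symm_apply g]
    rw [polyFunEquiv_apply, hrepr]
  refine ⟨b.equivFun.symm z, fun g hg => ?_, ?_⟩
  · rw [hev]
    have := (MvPolynomial.mem_zeroLocus_iff.1 hz) ((polyFunEquiv b).symm g) (by
      rw [Ideal.mem_comap]
      have : φ ((polyFunEquiv b).symm g) = g := (polyFunEquiv b).apply_symm_apply g
      rwa [this])
    simpa using this
  · rw [hev]
    simpa using hzf

lemma exists_polyFun_fibre {Φ : E → F} (hΦ : PolyMap k Φ)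
    (hdom : ∀ g ∈ polyFun k F, (∀ x, g (Φ x) = 0) → ∀ y, g y = 0)
    {f : E → k} (hf : f ∈ polyFun k E) (hf0 : ∃ x, f x ≠ 0) :
    ∃ a ∈ polyFun k F, (∃ y, a y ≠ 0) ∧ ∀ x, a (Φ x) ≠ 0 → ∀ q ∈ polyFun k E, q x ≠ 0 →
      ∃ x', Φ x' = Φ x ∧ f x' ≠ 0 ∧ q x' ≠ 0 := by
  let eE := polyFunEquiv (finBasis k E)
  let eF := polyFunEquiv (finBasis k F)
  have := eE.symm.toRingEquiv.toMulEquiv.isDomain (MvPolynomial (Fin (finrank k E)) k)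
  have := eF.symm.toRingEquiv.toMulEquiv.isDomain (MvPolynomial (Fin (finrank k F)) k)
  have : UniqueFactorizationMonoid (polyFun k F) :=
    eF.toRingEquiv.toMulEquiv.uniqueFactorizationMonoid inferInstance
  let := (polyFunPullback hΦ).toRingHom.toAlgebra
  have : IsScalarTower k (polyFun k F) (polyFun k E) := IsScalarTower.of_algebraMap_eq' rfl
  have : Algebra.FiniteType k (polyFun k E) :=
    Algebra.FiniteType.of_surjective eE.toAlgHom eE.surjective
  have : Algebra.FiniteType (polyFun k F) (polyFun k E) :=
    Algebra.FiniteType.of_restrictScalars_finiteType k _ _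
  have hinj : Function.Injective (algebraMap (polyFun k F) (polyFun k E)) := by
    rw [injective_iff_map_eq_zero]
    intro g hg
    exact Subtype.ext (funext (hdom g g.2 fun x =>
      congrFun (congrArg (Subtype.val : polyFun k E → E → k) hg) x))
  obtain ⟨a, ha, hA⟩ := exists_generic_fibre_dense hinj (f := ⟨f, hf⟩) (by
    obtain ⟨x, hx⟩ := hf0
    exact fun h => hx (congrFun (congrArg (Subtype.val : polyFun k E → E → k) h) x))
  refine ⟨a, a.2, ?_, fun x hax q hq hqx => ?_⟩
  · by_contra! h
    exact ha (Subtype.ext (funext h))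
  · have hm := RingHom.ker_isPrime (polyFunEval (k := k) (Φ x))
    have hQ := RingHom.ker_isPrime (polyFunEval (k := k) x)
    have hrad := hA (RingHom.ker (polyFunEval (Φ x))) (RingHom.ker (polyFunEval x)) hax rfl
      ⟨q, hq⟩ hqx
    obtain ⟨x', hx', hfq⟩ := exists_ne_zero_of_notMem_radical _ hrad
    refine ⟨x', ?_, left_ne_zero_of_mul hfq, right_ne_zero_of_mul hfq⟩
    refine (finBasis k F).ext_elem fun i => sub_eq_zero.1 ?_
    let l := (finBasis k F).coord i
    exact hx' _ (Ideal.mem_map_of_mem (algebraMap (polyFun k F) (polyFun k E))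
      (x := ⟨fun y => l y - l (Φ x), Subalgebra.sub_mem _ (polyFun_linear l) (polyFun_const _)⟩)
      (sub_self (l (Φ x))))

end FibreDensity

section CellMap

variable {k W : Type*} [Field k] [AddCommGroup W] [Module k W] {n r s : ℕ}

/-- The linear system whose solvability expresses the vanishing of the obstruction to
transversality, in the coordinates of `cellParam`. -/
def cellMap (I : Fin s → Fin r → Fin n) :
    ((Fin r → W) × (Fin s → Fin n → W) × (Fin s → Fin r → Fin r → k)) →ₗ[k]
      ((Fin r → W) × (Fin s → Fin n → Fin r → k) × (Fin s → Fin r → Fin r → k)) →ₗ[k]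
        (Fin s → Fin r → W) :=
  LinearMap.mk₂ k
    (fun p x j a => ∑ b, p.2.2 j b a • x.1 b +
      ∑ m ∈ gaps (I j) (I j a), x.2.1 j m a • p.2.1 j m + ∑ b, x.2.2 j b a • p.1 b)
    (fun p q x => by
      funext j a
      simp only [Prod.snd_add, Prod.fst_add, Pi.add_apply, add_smul, smul_add,
        Finset.sum_add_distrib]
      abel)
    (fun t p x => by
      funext j a
      simp only [Prod.smul_snd, Prod.smul_fst, Pi.smul_apply, smul_assoc, smul_add,
        Finset.smul_sum, smul_comm t])
    (fun p x y => by
      funext j a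
      simp only [Prod.snd_add, Prod.fst_add, Pi.add_apply, add_smul, smul_add,
        Finset.sum_add_distrib]
      abel)
    (fun t p x => by
      funext j a
      simp only [Prod.smul_snd, Prod.smul_fst, Pi.smul_apply, smul_assoc, smul_add,
        Finset.smul_sum, smul_comm t])

lemma cellMap_apply (I : Fin s → Fin r → Fin n)
    (p : (Fin r → W) × (Fin s → Fin n → W) × (Fin s → Fin r → Fin r → k))
    (x : (Fin r → W) × (Fin s → Fin n → Fin r → k) × (Fin s → Fin r → Fin r → k))
    (j : Fin s) (a : Fin r) :
    cellMap I p x j a = ∑ b, p.2.2 j b a • x.1 b +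
      ∑ m ∈ gaps (I j) (I j a), x.2.1 j m a • p.2.1 j m + ∑ b, x.2.2 j b a • p.1 b := rfl

lemma mem_map_mkQ_span_iff {v : Fin r → W} {f : Fin n → W} {V : Submodule k W}
    (hV : span k (Set.range v) = V) (T : Finset (Fin n)) (z : W) :
    V.mkQ z ∈ (span k (f '' (T : Set (Fin n)))).map V.mkQ ↔
      ∃ (y : Fin n → k) (d : Fin r → k), ∑ m ∈ T, y m • f m + ∑ b, d b • v b = z := by
  constructor
  · rintro ⟨g, hg, hgz⟩
    obtain ⟨y, hy⟩ : ∃ y : Fin n → k, ∑ m ∈ T, y m • f m = g := by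
      rw [SetLike.mem_coe, mem_span_image_finset_iff_exists_fun] at hg
      obtain ⟨c, hc⟩ := hg
      refine ⟨fun m => if hm : m ∈ T then c ⟨m, hm⟩ else 0, ?_⟩
      rw [← hc, ← Finset.sum_coe_sort T]
      simp
    have h1 : z - g ∈ V := by
      rw [← V.ker_mkQ, LinearMap.mem_ker, map_sub, hgz, sub_self]
    rw [← hV, mem_span_range_iff_exists_fun] at h1
    obtain ⟨d, hd⟩ := h1
    exact ⟨y, d, by rw [hy, hd]; abel⟩
  · rintro ⟨y, d, rfl⟩
    refine ⟨∑ m ∈ T, y m • f m, sum_mem fun m hm => smul_mem _ _ (subset_span ⟨m, hm, rfl⟩), ?_⟩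
    rw [map_add, left_eq_add, ← LinearMap.mem_ker, V.ker_mkQ, ← hV]
    exact sum_mem fun b _ => smul_mem _ _ (subset_span ⟨b, rfl⟩)

variable [FiniteDimensional k W] {v : Fin r → W}

lemma linearIndependent_of_cellParam {i : Fin r → Fin n} {f : Fin n → W} {h : Fin r → Fin r → k}
    {c : Fin n → Fin r → k} (hW : finrank k W = n) (hi : Function.Injective i)
    (he : LinearIndependent k (cellParam i v f h c)) : LinearIndependent k v := by
  rw [linearIndependent_iff_card_eq_finrank_span, Set.finrank, ← span_eq_of_cellParam hW hi he]
  have := (isEchelon_cellParam (v := v) (f := f) (h := h) (c := c) hi).linearIndependent hW he hi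
  rw [linearIndependent_iff_card_eq_finrank_span, Set.finrank] at this
  exact this

variable {I : Fin s → Fin r → Fin n} {f : Fin s → Fin n → W} {h : Fin s → Fin r → Fin r → k}
  {c : Fin s → Fin n → Fin r → k}

lemma forall_sub_mem_filtHom_iff (hW : finrank k W = n) (hI : ∀ j, Function.Injective (I j))
    (he : ∀ j, LinearIndependent k (cellParam (I j) v (f j) (h j) (c j)))
    {V : Submodule k W} (hV : span k (Set.range v) = V) {φ : Fin r → W} {Y : Fin s → Fin r → W}
    {φ' : V →ₗ[k] W ⧸ V} (hφ : ∀ b (hb : v b ∈ V), φ' ⟨v b, hb⟩ = V.mkQ (φ b))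
    {ρ : Fin s → V →ₗ[k] W ⧸ V}
    (hρ : ∀ j a (ha : ∑ b, h j b a • v b ∈ V), ρ j ⟨_, ha⟩ = V.mkQ (Y j a)) :
    (∀ j, ρ j - φ' ∈ filtHom
      (fun u => (spanFlag k (cellParam (I j) v (f j) (h j) (c j)) u).comap V.subtype)
      (fun u => (spanFlag k (cellParam (I j) v (f j) (h j) (c j)) u).map V.mkQ)) ↔
    ∃ y d, cellMap I (v, f, h) (φ, y, d) = Y := by
  have hv : ∀ b, v b ∈ V := fun b => hV ▸ subset_span ⟨b, rfl⟩
  have hw : ∀ j a, ∑ b, h j b a • v b ∈ V := fun j a => sum_mem fun b _ => smul_mem _ _ (hv b)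
  have hφw : ∀ j a, φ' ⟨_, hw j a⟩ = V.mkQ (∑ b, h j b a • φ b) := fun j a => by
    have : (⟨_, hw j a⟩ : V) = ∑ b, h j b a • ⟨v b, hv b⟩ := Subtype.ext (by simp)
    rw [this, map_sum, map_sum]
    exact Finset.sum_congr rfl fun b _ => by rw [map_smul, map_smul, hφ]
  have key : ∀ j, (ρ j - φ' ∈ filtHom
      (fun u => (spanFlag k (cellParam (I j) v (f j) (h j) (c j)) u).comap V.subtype)
      (fun u => (spanFlag k (cellParam (I j) v (f j) (h j) (c j)) u).map V.mkQ)) ↔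
      ∀ a, ∃ (y : Fin n → k) (d : Fin r → k), ∑ b, h j b a • φ b +
        ∑ m ∈ gaps (I j) (I j a), y m • f j m + ∑ b, d b • v b = Y j a := fun j => by
    rw [(isEchelon_cellParam (hI j)).mem_filtHom_iff hW (he j) (hI j)
      ((span_eq_of_cellParam hW (hI j) (he j)).trans hV)]
    refine forall_congr' fun a => ?_
    have himg : cellParam (I j) v (f j) (h j) (c j) '' (gaps (I j) (I j a) : Set (Fin n)) =
        f j '' (gaps (I j) (I j a) : Set (Fin n)) :=
      Set.image_congr fun m hm => cellParam_gap _ _ _ _ _ (mem_gaps.1 hm).2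
    rw [forall_prop_of_true (hw j a), LinearMap.sub_apply, hρ, hφw, ← map_sub, himg,
      mem_map_mkQ_span_iff hV]
    refine exists_congr fun y => exists_congr fun d => ?_
    rw [eq_sub_iff_add_eq', ← add_assoc]
  simp only [key]
  constructor
  · intro H
    choose y d H using H
    exact ⟨fun j m a => y j a m, fun j b a => d j a b, funext fun j => funext fun a => H j a⟩
  · rintro ⟨y, d, H⟩ j a
    exact ⟨fun m => y j m a, fun b => d j b a, congrFun (congrFun H j) a⟩

omit [FiniteDimensional k W] in
lemma exists_hom_of_linearIndependent (hv : LinearIndependent k v) {V : Submodule k W}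
    (hV : span k (Set.range v) = V) {Q : Type*} [AddCommGroup Q] [Module k Q] (y : Fin r → Q) :
    ∃ φ : V →ₗ[k] Q, ∀ b (hb : v b ∈ V), φ ⟨v b, hb⟩ = y b := by
  subst hV
  refine ⟨(Basis.span hv).constr k y, fun b hb => ?_⟩
  rw [← (Basis.span hv).constr_basis k y b]
  congr 1
  exact (Basis.span_apply hv b).symm

lemma extZero_iff_cellMap_surjective (hW : finrank k W = n) (hI : ∀ j, Function.Injective (I j))
    (hs : 0 < s) (he : ∀ j, LinearIndependent k (cellParam (I j) v (f j) (h j) (c j)))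
    {V : Submodule k W} (hV : span k (Set.range v) = V) :
    ExtZero
      (fun j u => (spanFlag k (cellParam (I j) v (f j) (h j) (c j)) u).comap V.subtype)
      (fun j u => (spanFlag k (cellParam (I j) v (f j) (h j) (c j)) u).map V.mkQ) ↔
    Function.Surjective (cellMap I (v, f, h)) := by
  have hvi := linearIndependent_of_cellParam hW (hI ⟨0, hs⟩) (he ⟨0, hs⟩)
  have hv : ∀ b, v b ∈ V := fun b => hV ▸ subset_span ⟨b, rfl⟩
  have hw : ∀ j a, ∑ b, h j b a • v b ∈ V := fun j a => sum_mem fun b _ => smul_mem _ _ (hv b)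
  constructor
  · intro H Y
    choose ρ hρ using fun j => exists_hom_of_linearIndependent
      ((isEchelon_cellParam (hI j)).linearIndependent hW (he j) (hI j))
      ((span_eq_of_cellParam hW (hI j) (he j)).trans hV) fun a => V.mkQ (Y j a)
    obtain ⟨φ', hφ'⟩ := H ρ
    choose φ hφ using fun b => V.mkQ_surjective (φ' ⟨v b, hv b⟩)
    obtain ⟨y, d, h1⟩ := (forall_sub_mem_filtHom_iff hW hI he hV (φ := φ)
      (fun b _ => (hφ b).symm) hρ).1 hφ'
    exact ⟨_, h1⟩
  · intro H ρ
    choose Y hY using fun j a => V.mkQ_surjective (ρ j ⟨_, hw j a⟩)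
    obtain ⟨⟨φ, y, d⟩, hx⟩ := H Y
    obtain ⟨φ', hφ'⟩ := exists_hom_of_linearIndependent hvi hV fun b => V.mkQ (φ b)
    exact ⟨φ', (forall_sub_mem_filtHom_iff hW hI he hV hφ' fun j a _ => (hY j a).symm).2
      ⟨y, d, hx⟩⟩

/-- The linear map `k^r × k^r → W` defined by two `r`-tuples of vectors. -/
def pairMap (k W : Type*) [Field k] [AddCommGroup W] [Module k W] (r : ℕ) :
    ((Fin r → W) × (Fin r → W)) →ₗ[k] ((Fin r → k) × (Fin r → k)) →ₗ[k] W :=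
  LinearMap.mk₂ k (fun q x => ∑ b, x.1 b • q.1 b + ∑ b, x.2 b • q.2 b)
    (fun p q x => by
      simp only [Prod.snd_add, Prod.fst_add, Pi.add_apply, smul_add, Finset.sum_add_distrib]
      abel)
    (fun t p x => by
      simp only [Prod.smul_snd, Prod.smul_fst, Pi.smul_apply, smul_add, Finset.smul_sum,
        smul_comm t])
    (fun p x y => by
      simp only [Prod.snd_add, Prod.fst_add, Pi.add_apply, add_smul, Finset.sum_add_distrib]
      abel)
    (fun t p x => by
      simp only [Prod.smul_snd, Prod.smul_fst, Pi.smul_apply, smul_assoc, smul_add,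
        Finset.smul_sum])

omit [FiniteDimensional k W] in
lemma pairMap_apply (q : (Fin r → W) × (Fin r → W)) (x : (Fin r → k) × (Fin r → k)) :
    pairMap k W r q x = ∑ b, x.1 b • q.1 b + ∑ b, x.2 b • q.2 b := rfl

lemma apply_mem_range_of_hasJet [Infinite k] {V : Submodule k W}
    (hV : span k (Set.range v) = V) {θ η : V →ₗ[k] W ⧸ V} {φ ψ : Fin r → W}
    (hθ : ∀ b (hb : v b ∈ V), θ ⟨v b, hb⟩ = V.mkQ (φ b))
    (hη : ∀ b (hb : v b ∈ V), η ⟨v b, hb⟩ = V.mkQ (ψ b)) {γ : k → Fin r → W}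
    (hγ : HasJet k γ φ ψ) (hmax : ∀ t, finrank k (LinearMap.range (pairMap k W r (γ t, v))) ≤
      finrank k (LinearMap.range (pairMap k W r (φ, v)))) {x : V} (hx : θ x = 0) :
    η x ∈ LinearMap.range θ := by
  have hv : ∀ b, v b ∈ V := fun b => hV ▸ subset_span ⟨b, rfl⟩
  have hext : ∀ (ξ : V →ₗ[k] W ⧸ V) (z : Fin r → W)
      (_ : ∀ b (hb : v b ∈ V), ξ ⟨v b, hb⟩ = V.mkQ (z b)) (l : Fin r → k),
      ξ (∑ b, l b • ⟨v b, hv b⟩) = V.mkQ (∑ b, l b • z b) := fun ξ z hz l => by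
    rw [map_sum, map_sum]
    exact Finset.sum_congr rfl fun b _ => by rw [map_smul, map_smul, hz]
  obtain ⟨l, hl⟩ := (mem_span_range_iff_exists_fun k).1 (hV.ge x.2)
  have hxl : x = ∑ b, l b • ⟨v b, hv b⟩ := Subtype.ext (by simp [hl])
  have h1 : ∑ b, l b • φ b ∈ V := by
    rw [← V.ker_mkQ, LinearMap.mem_ker, ← hext θ φ hθ, ← hxl, hx]
  obtain ⟨d, hd⟩ := (mem_span_range_iff_exists_fun k).1 (hV.ge h1)
  have hjet : HasJet k (fun t => pairMap k W r (γ t, v)) (pairMap k W r (φ, v))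
      (pairMap k W r (ψ, 0)) := by
    have h2 := ((hγ.linear (LinearMap.inl k (Fin r → W) (Fin r → W))).linear (pairMap k W r)).add
      (HasJet.const (pairMap k W r (0, v)))
    have h3 : ∀ z : Fin r → W, pairMap k W r (LinearMap.inl k (Fin r → W) (Fin r → W) z) +
        pairMap k W r (0, v) = pairMap k W r (z, v) := fun z => by
      rw [← map_add]; simp
    simp only [h3, add_zero] at h2
    exact h2
  obtain ⟨⟨l', d'⟩, h3⟩ := jet_ker_le_range hjet hmax (v := (l, -d)) (by
    rw [pairMap_apply]
    simp [hd])
  refine ⟨∑ b, l' b • ⟨v b, hv b⟩, ?_⟩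
  rw [hxl, hext η ψ hη, hext θ φ hθ]
  have h4 : ∑ b, l b • ψ b = ∑ b, l' b • φ b + ∑ b, d' b • v b := by
    simpa [pairMap_apply] using h3.symm
  rw [h4, map_add, left_eq_add, ← LinearMap.mem_ker, V.ker_mkQ]
  exact sum_mem fun b _ => smul_mem _ _ (hv b)

end CellMap

section MaximalSections

lemma exists_forall_le_of_bounded {ι : Type*} [Nonempty ι] (f : ι → ℕ) (B : ℕ) (h : ∀ x, f x ≤ B) :
    ∃ x, ∀ y, f y ≤ f x := by
  have hb : BddAbove (Set.range f) := ⟨B, by rintro _ ⟨x, rfl⟩; exact h x⟩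
  obtain ⟨x, hx⟩ := Nat.sSup_mem (Set.range_nonempty f) hb
  exact ⟨x, fun y => hx ▸ le_csSup hb ⟨y, rfl⟩⟩

variable {k E F G H C : Type*} [Field k] [AddCommGroup E] [Module k E]
  [AddCommGroup F] [Module k F] [AddCommGroup G] [Module k G] [AddCommGroup H] [Module k H]
  [AddCommGroup C] [Module k C]

lemma PolyMap.map {g : E → F} (hg : PolyMap k g) (f : F →ₗ[k] G) :
    PolyMap k fun x => f (g x) :=
  (PolyMap.linear f).comp hg

lemma exists_jet_of_section [Infinite k] [FiniteDimensional k F] [FiniteDimensional k G]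
    (B : E →ₗ[k] F →ₗ[k] G) {Θ : E × C → F} (hΘ : PolyMap k Θ) (hB : ∀ p, B p.1 (Θ p) = 0)
    (p q : E) (c : C) :
    ∃ ψ, HasJet k (fun t => Θ (p + t • q, c)) (Θ (p, c)) ψ ∧ B q (Θ (p, c)) + B p ψ = 0 := by
  have h1 : PolyMap k fun t : k => Θ (p + t • q, c) :=
    hΘ.comp ((polyMap_line p q).prodMk (PolyMap.const c))
  obtain ⟨ψ, hψ⟩ := h1.hasJet
  simp only [zero_smul, add_zero] at hψ
  refine ⟨ψ, hψ, ?_⟩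
  have h2 := ((HasJet.line p q).linear B).apply hψ
  simp only [fun t : k => hB (p + t • q, c)] at h2
  exact h2.unique (HasJet.const 0)

lemma exists_maximal_section [Infinite k] [FiniteDimensional k F] [FiniteDimensional k G]
    [FiniteDimensional k H] [FiniteDimensional k C] {N : E → F →ₗ[k] G} (hN : PolyMap k N)
    {B : E → F → H →ₗ[k] C}
    (hB : ∀ Θ : E → F, PolyMap k Θ → PolyMap k fun p => B p (Θ p)) :
    ∃ Θ : E → F, PolyMap k Θ ∧ (∀ p, N p (Θ p) = 0) ∧ ∃ g ∈ polyFun k E, (∃ p, g p ≠ 0) ∧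
      ∀ p₀, g p₀ ≠ 0 →
        (∀ p, finrank k (LinearMap.range (N p)) ≤ finrank k (LinearMap.range (N p₀))) ∧
        ∀ Θ' : E → F, PolyMap k Θ' → (∀ p, N p (Θ' p) = 0) →
          ∀ p, finrank k (LinearMap.range (B p (Θ' p))) ≤
            finrank k (LinearMap.range (B p₀ (Θ p₀))) := by
  obtain ⟨pN, hpN⟩ := exists_forall_le_of_bounded
    (fun p => finrank k (LinearMap.range (N p))) _ fun p => Submodule.finrank_le _
  let S := {Θ : E → F // PolyMap k Θ ∧ ∀ p, N p (Θ p) = 0}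
  have : Nonempty (S × E) := ⟨⟨⟨fun _ => 0, PolyMap.const 0, fun p => map_zero _⟩, 0⟩⟩
  obtain ⟨⟨⟨Θ, hΘ, hΘN⟩, pΘ⟩, hmax⟩ := exists_forall_le_of_bounded
    (fun x : S × E => finrank k (LinearMap.range (B x.2 (x.1.1 x.2))))
    _ fun _ => Submodule.finrank_le _
  obtain ⟨g₁, hg₁, hg₁0, hg₁N⟩ := exists_polyFun_le_rank hN pN
  obtain ⟨g₂, hg₂, hg₂0, hg₂N⟩ := exists_polyFun_le_rank (hB Θ hΘ) pΘ
  obtain ⟨p₁, h₁, h₂⟩ := polyFun_mul_ne_zero hg₁ hg₂ hg₁0 hg₂0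
  exact ⟨Θ, hΘ, hΘN, g₁ * g₂, mul_mem hg₁ hg₂, ⟨p₁, mul_ne_zero h₁ h₂⟩, fun p₀ h₀ =>
    ⟨fun p => (hpN p).trans (hg₁N _ (left_ne_zero_of_mul h₀)), fun Θ' h5 h6 p =>
      (hmax ⟨⟨Θ', h5, h6⟩, p⟩).trans (hg₂N _ (right_ne_zero_of_mul h₀))⟩⟩

end MaximalSections

section CellParams

variable {k W : Type*} [Field k] [AddCommGroup W] [Module k W] {n r s : ℕ}

lemma exists_polyFun_linearIndependent [FiniteDimensional k W] (hW : finrank k W = n) (s : ℕ) :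
    ∃ D ∈ polyFun k (Fin s → Fin n → W), (∃ e, D e ≠ 0) ∧
      ∀ e, D e ≠ 0 → ∀ j, LinearIndependent k (e j) := by
  let b := finBasisOfFinrankEq k W hW
  have hpoly : ∀ j, PolyMap k fun e : Fin s → Fin n → W => b.constr k (e j) := fun j =>
    PolyMap.map (g := fun e : Fin s → Fin n → W => e j) (PolyMap.id.eval j)
      (LinearEquiv.toLinearMap (b.constr k : (Fin n → W) ≃ₗ[k] W →ₗ[k] W))
  refine ⟨∏ j, fun e => LinearMap.det (b.constr k (e j)),
    prod_mem fun j _ => polyFun_det (hpoly j), ⟨fun _ => b, ?_⟩, fun e he j => ?_⟩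
  · have : b.constr k b = LinearMap.id := b.ext fun i => by simp
    simp [this]
  · rw [Finset.prod_apply, Finset.prod_ne_zero_iff] at he
    have h1 : IsUnit (b.constr k (e j)) :=
      (LinearMap.isUnit_iff_isUnit_det _).2 (isUnit_iff_ne_zero.2 (he j (Finset.mem_univ j)))
    have h2 := b.linearIndependent.map' _ ((LinearMap.isUnit_iff_ker_eq_bot _).1 h1)
    have h3 : (b.constr k (e j)) ∘ b = e j := funext fun i => b.constr_basis k _ i
    rwa [h3] at h2

/-- Parameters for an `s`-tuple of bases together with a tuple spanning a point of all the
corresponding Schubert cells. -/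
abbrev CellParams (k W : Type*) (n r s : ℕ) :=
  ((Fin r → W) × (Fin s → Fin n → W) × (Fin s → Fin r → Fin r → k)) × (Fin s → Fin n → Fin r → k)

/-- The `s`-tuple of bases with given parameters. -/
def cellParams (I : Fin s → Fin r → Fin n) (p : CellParams k W n r s) : Fin s → Fin n → W :=
  fun j => cellParam (I j) p.1.1 (p.1.2.1 j) (p.1.2.2 j) (p.2 j)

variable {I : Fin s → Fin r → Fin n}

lemma polyMap_cellParams [FiniteDimensional k W] (hI : ∀ j, Function.Injective (I j)) :
    PolyMap k (cellParams (k := k) (W := W) I) :=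
  polyMap_pi fun j => polyMap_cellParam (hI j)
    (fun a => PolyMap.id.fst.fst.eval a)
    (fun m => (PolyMap.id.fst.snd.fst.eval j).eval m)
    (fun b a => polyMap_iff_mem.1 (((PolyMap.id.fst.snd.snd.eval j).eval b).eval a))
    (fun m a => polyMap_iff_mem.1 (((PolyMap.id.snd.eval j).eval m).eval a))

lemma polyMap_cellMap : PolyMap k fun p : CellParams k W n r s => cellMap I p.1 :=
  PolyMap.id.fst.map (cellMap (k := k) (W := W) I)

/-- The deformation argument: surjectivity holds at any point where the relevant ranks are
maximal. -/
lemma cellMap_surjective_of_max [Infinite k] [FiniteDimensional k W] (hs : 0 < s)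
    (hW : finrank k W = n) (hI : ∀ j, Function.Injective (I j)) {v : Fin r → W}
    {f : Fin s → Fin n → W} {h : Fin s → Fin r → Fin r → k} {c : Fin s → Fin n → Fin r → k}
    (he : ∀ j, LinearIndependent k (cellParam (I j) v (f j) (h j) (c j)))
    (hnn : ∀ S : Submodule k W,
      0 ≤ hnChi n (fun j => spanFlag k (cellParam (I j) v (f j) (h j) (c j))) S S)
    (hN : ∀ p : CellParams k W n r s, finrank k (LinearMap.range (cellMap I p.1)) ≤
      finrank k (LinearMap.range (cellMap I (v, f, h))))
    {Θ : CellParams k W n r s →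
      (Fin r → W) × (Fin s → Fin n → Fin r → k) × (Fin s → Fin r → Fin r → k)}
    (hΘ : PolyMap k Θ) (hΘN : ∀ p, cellMap I p.1 (Θ p) = 0)
    (hmax : ∀ Θ' : CellParams k W n r s →
        (Fin r → W) × (Fin s → Fin n → Fin r → k) × (Fin s → Fin r → Fin r → k),
      PolyMap k Θ' → (∀ p, cellMap I p.1 (Θ' p) = 0) →
      ∀ p, finrank k (LinearMap.range (pairMap k W r ((Θ' p).1, p.1.1))) ≤
        finrank k (LinearMap.range (pairMap k W r ((Θ ((v, f, h), c)).1, v)))) :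
    Function.Surjective (cellMap I (v, f, h)) := by
  have hvi := linearIndependent_of_cellParam hW (hI ⟨0, hs⟩) (he ⟨0, hs⟩)
  obtain ⟨V, hV⟩ : ∃ V, span k (Set.range v) = V := ⟨_, rfl⟩
  have hv : ∀ b, v b ∈ V := fun b => hV ▸ subset_span ⟨b, rfl⟩
  obtain ⟨θ, hθ⟩ := exists_hom_of_linearIndependent hvi hV
    fun b => V.mkQ ((Θ ((v, f, h), c)).1 b)
  rw [← extZero_iff_cellMap_surjective hW hI hs he hV]
  refine extZero_of_deformation (θ := θ) (fun j => isFilt_spanFlag hW (he j)) hnn ?_ ?_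
  · intro η hη
    choose φ hφ using fun b => V.mkQ_surjective (η ⟨v b, hv b⟩)
    have hφ' : ∀ b (hb : v b ∈ V), (-η) ⟨v b, hb⟩ = V.mkQ ((-φ) b) := fun b hb => by
      rw [LinearMap.neg_apply, Pi.neg_apply, map_neg, hφ]
    obtain ⟨y, d, hyd⟩ := (forall_sub_mem_filtHom_iff hW hI he hV hφ'
      (ρ := 0) (Y := 0) (fun j a _ => by simp)).1 fun j => by simpa using hη j
    obtain ⟨Θ', hΘ', hΘ'0, hΘ'N⟩ := exists_polyMap_section
      (L := fun p : CellParams k W n r s => cellMap I p.1)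
      polyMap_cellMap
      (p₀ := ((v, f, h), c)) hN hyd
    intro x hx
    rw [← neg_mem_iff]
    refine apply_mem_range_of_hasJet (η := -η) hV hθ hφ'
      (HasJet.line (Θ ((v, f, h), c)).1 (-φ)) (fun t => ?_) hx
    have h1 := hmax (fun p => Θ p + t • Θ' p)
      (hΘ.add (PolyMap.smul (polyFun_const t) hΘ')) (fun p => by
        rw [map_add, map_smul, hΘN, hΘ'N, smul_zero, add_zero]) ((v, f, h), c)
    rwa [hΘ'0] at h1
  · intro δ γ
    obtain ⟨σ, hσ⟩ := V.mkQ.exists_rightInverse_of_surjective V.range_mkQ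
    have hσ' : ∀ x, V.mkQ (σ x) = x := fun x => LinearMap.congr_fun hσ x
    let D := fun j => σ ∘ₗ δ j ∘ₗ V.mkQ
    have hγ : ∀ j b, ∃ G : Fin r → k, ∑ b', G b' • v b' = γ j ⟨v b, hv b⟩ := fun j b =>
      (mem_span_range_iff_exists_fun k).1 (hV.ge (γ j ⟨v b, hv b⟩).2)
    choose G hG using hγ
    let f' : Fin s → Fin n → W := fun j m => D j (f j m)
    let h' : Fin s → Fin r → Fin r → k := fun j b a => -∑ b', G j b' b * h j b' a
    obtain ⟨⟨ψ, y', d'⟩, hjet, hz⟩ :=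
      exists_jet_of_section (cellMap I) hΘ hΘN (v, f, h) (0, f', h') c
    obtain ⟨η, hη⟩ := exists_hom_of_linearIndependent hvi hV fun b => V.mkQ (ψ b)
    refine ⟨η, (forall_sub_mem_filtHom_iff hW hI he hV hη
      (ρ := fun j => δ j ∘ₗ θ + θ ∘ₗ γ j) fun j a ha => ?_).2
      ⟨y', d', eq_neg_of_add_eq_zero_right hz⟩, fun x hx => apply_mem_range_of_hasJet hV hθ hη
        (hjet.linear (LinearMap.fst _ _ _)) (fun t => ?_) hx⟩
    · have h0 := congrFun (congrFun (hΘN ((v, f, h), c)) j) a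
      rw [cellMap_apply] at h0
      rw [Pi.neg_apply, Pi.neg_apply, cellMap_apply]
      generalize Θ ((v, f, h), c) = x at *
      have hsum : ∑ b, x.2.2 j b a • v b ∈ V := sum_mem fun b _ => smul_mem _ _ (hv b)
      have hw : (⟨_, ha⟩ : V) = ∑ b, h j b a • ⟨v b, hv b⟩ := Subtype.ext (by simp)
      have hθw : θ ⟨_, ha⟩ = -∑ m ∈ gaps (I j) (I j a), x.2.1 j m a • V.mkQ (f j m) := by
        have h1 : V.mkQ (∑ b, h j b a • x.1 b) +
            V.mkQ (∑ m ∈ gaps (I j) (I j a), x.2.1 j m a • f j m) +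
            V.mkQ (∑ b, x.2.2 j b a • v b) = 0 := by
          rw [← map_add, ← map_add]
          exact (congrArg V.mkQ h0).trans (map_zero _)
        have hsum' : V.mkQ (∑ b, x.2.2 j b a • v b) = 0 :=
          (Submodule.Quotient.mk_eq_zero V).2 hsum
        rw [hsum', add_zero] at h1
        simp only [map_sum, map_smul] at h1
        rw [hw, map_sum]
        simp only [map_smul, hθ]
        exact eq_neg_of_add_eq_zero_left h1
      have hγv : ∀ b, γ j ⟨v b, hv b⟩ = ∑ b', G j b b' • ⟨v b', hv b'⟩ := fun b =>
        Subtype.ext (by simp [hG])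
      have hγw : θ (γ j ⟨_, ha⟩) = ∑ b, h j b a • ∑ b', G j b b' • V.mkQ (x.1 b') := by
        rw [hw]
        simp only [map_sum, map_smul, hγv, hθ]
      have hσD : ∀ m, V.mkQ (f' j m) = δ j (V.mkQ (f j m)) := fun m => hσ' _
      simp only [LinearMap.add_apply, LinearMap.comp_apply, hθw, hγw, map_neg, map_add, map_sum,
        map_smul, hσD, h', Pi.zero_apply, smul_zero, Finset.sum_const_zero, add_zero,
        neg_smul, Finset.sum_neg_distrib, Finset.smul_sum, Finset.sum_smul]
      rw [Finset.sum_comm]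
      simp only [smul_smul, mul_comm]
      abel
    · have h1 : finrank k (LinearMap.range (pairMap k W r
          ((Θ ((v, f, h) + t • (0, f', h'), c)).1, v + t • (0 : Fin r → W)))) ≤ _ :=
        hmax Θ hΘ hΘN ((v, f, h) + t • (0, f', h'), c)
      rwa [smul_zero, add_zero] at h1

lemma exists_cellMap_surjective [Infinite k] [FiniteDimensional k W] (hs : 0 < s)
    (hW : finrank k W = n) (hI : ∀ j, Function.Injective (I j))
    (hdom : ∀ g ∈ polyFun k (Fin s → Fin n → W),
      (∀ p : CellParams k W n r s, g (cellParams I p) = 0) → ∀ e, g e = 0) :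
    ∃ p : CellParams k W n r s, Function.Surjective (cellMap I p.1) := by
  have hΦ := polyMap_cellParams (k := k) (W := W) hI
  have hdom' : ∀ g ∈ polyFun k (Fin s → Fin n → W), (∃ e, g e ≠ 0) →
      ∃ p : CellParams k W n r s, g (cellParams I p) ≠ 0 := fun g hg ⟨e, he⟩ => by
    by_contra! h
    exact he (hdom g hg h e)
  obtain ⟨D, hD, hD0, hDe⟩ := exists_polyFun_linearIndependent (k := k) hW s
  obtain ⟨g, hg, hg0, hge⟩ := exists_polyFun_hnChi_nonneg (k := k) hs hW
  obtain ⟨pD, hpD⟩ := hdom' D hD hD0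
  obtain ⟨pg, hpg⟩ := hdom' g hg hg0
  obtain ⟨Θ, hΘ, hΘN, g', hg', ⟨p₁, hp₁⟩, hmax⟩ := exists_maximal_section
    (polyMap_cellMap (k := k) (W := W) (I := I))
    (B := fun p x => pairMap k W r (x.1, p.1.1))
    fun Θ hΘ => (hΘ.fst.prodMk PolyMap.id.fst.fst).map (pairMap k W r)
  obtain ⟨p₂, h₂⟩ := polyFun_mul_ne_zero (polyFun_comp hD hΦ) (polyFun_comp hg hΦ) hpD hpg
  obtain ⟨⟨⟨v, f, h⟩, c⟩, h₃, h₄⟩ := polyFun_mul_ne_zero hg'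
    (mul_mem (polyFun_comp hD hΦ) (polyFun_comp hg hΦ)) hp₁ (mul_ne_zero h₂.1 h₂.2)
  have hind := hDe _ (left_ne_zero_of_mul h₄)
  exact ⟨((v, f, h), c), cellMap_surjective_of_max hs hW hI hind
    (hge _ hind (right_ne_zero_of_mul h₄)) (hmax _ h₃).1 hΘ hΘN (hmax _ h₃).2⟩

end CellParams

section Topology

variable {k E F G : Type*} [Field k] [AddCommGroup E] [Module k E] [AddCommGroup F] [Module k F]
  [AddCommGroup G] [Module k G]

lemma isOpen_setOf_polyFun_ne_zero {f : E → k} (hf : f ∈ polyFun k E) :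
    @IsOpen _ (mZariski k E) {x | f x ≠ 0} := by
  obtain ⟨p, hp⟩ := mem_polyFun_iff.1 hf
  exact TopologicalSpace.isOpen_generateFrom_of_mem ⟨p, by simp only [hp]⟩

lemma exists_polyFun_of_isOpen {U : Set E} (hU : @IsOpen _ (mZariski k E) U) {x : E} (hx : x ∈ U) :
    ∃ q ∈ polyFun k E, q x ≠ 0 ∧ ∀ y, q y ≠ 0 → y ∈ U := by
  induction hU with
  | basic V hV =>
    obtain ⟨p, rfl⟩ := hV
    exact ⟨_, mem_polyFun_iff.2 ⟨p, fun _ => rfl⟩, hx, fun _ h => h⟩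
  | univ => exact ⟨1, one_mem _, one_ne_zero, fun _ _ => trivial⟩
  | inter V V' _ _ ih ih' =>
    obtain ⟨q, hq, hqx, hqV⟩ := ih hx.1
    obtain ⟨q', hq', hqx', hqV'⟩ := ih' hx.2
    exact ⟨q * q', mul_mem hq hq', mul_ne_zero hqx hqx', fun y hy =>
      ⟨hqV y (left_ne_zero_of_mul hy), hqV' y (right_ne_zero_of_mul hy)⟩⟩
  | sUnion S _ ih =>
    obtain ⟨V, hV, hxV⟩ := hx
    obtain ⟨q, hq, hqx, hqV⟩ := ih V hV hxV
    exact ⟨q, hq, hqx, fun y hy => ⟨V, hV, hqV y hy⟩⟩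

lemma isOpen_of_exists_polyFun {U : Set E}
    (hU : ∀ x ∈ U, ∃ q ∈ polyFun k E, q x ≠ 0 ∧ ∀ y, q y ≠ 0 → y ∈ U) :
    @IsOpen _ (mZariski k E) U := by
  let _ := mZariski k E
  refine isOpen_iff_forall_mem_open.2 fun x hx => ?_
  obtain ⟨q, hq, hqx, hqU⟩ := hU x hx
  exact ⟨{y | q y ≠ 0}, fun y hy => hqU y hy, isOpen_setOf_polyFun_ne_zero hq, hqx⟩

lemma exists_polyFun_surjective [FiniteDimensional k F] [FiniteDimensional k G]
    {L : E → F →ₗ[k] G} (hL : PolyMap k L) {p₀ : E} (h₀ : Function.Surjective (L p₀)) :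
    ∃ g ∈ polyFun k E, g p₀ ≠ 0 ∧ ∀ p, g p ≠ 0 → Function.Surjective (L p) := by
  obtain ⟨g, hg, hg0, hgp⟩ := exists_polyFun_le_rank hL p₀
  refine ⟨g, hg, hg0, fun p hp => LinearMap.range_eq_top.1 ?_⟩
  refine Submodule.eq_top_of_finrank_eq (le_antisymm (Submodule.finrank_le _) ?_)
  have := hgp p hp
  rwa [LinearMap.range_eq_top.2 h₀, finrank_top] at this

lemma exists_polyFun_linearIndependent_of [FiniteDimensional k F] {r : ℕ} {b : Fin r → F}
    (hb : LinearIndependent k b) :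
    ∃ g ∈ polyFun k (Fin r → F), g b ≠ 0 ∧ ∀ b', g b' ≠ 0 → LinearIndependent k b' := by
  have hL : PolyMap k fun b : Fin r → F => Fintype.linearCombination k b :=
    polyMap_hom fun l => by
      simp only [Fintype.linearCombination_apply]
      exact PolyMap.sum _ fun a _ =>
        PolyMap.linear (l a • LinearMap.proj (R := k) (φ := fun _ : Fin r => F) a)
  obtain ⟨g, hg, hg0, hgp⟩ := exists_polyFun_le_rank hL b
  refine ⟨g, hg, hg0, fun b' hb' => ?_⟩
  have := hgp b' hb'
  rw [Fintype.range_linearCombination, Fintype.range_linearCombination,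
    finrank_span_eq_card hb] at this
  exact linearIndependent_iff_card_le_finrank_span.2 this

end Topology

section ExtZeroOpen

variable {k W : Type*} [Field k] [AddCommGroup W] [Module k W] [FiniteDimensional k W]
  {n r s : ℕ} {E : Fin s → ℕ → Submodule k W}

/-- The linear system whose solvability expresses the vanishing of the obstruction space of the
multifiltered spaces induced on the span of a tuple of vectors and on the quotient by it. -/
def endMap (E : Fin s → ℕ → Submodule k W) (b : Fin r → W) :
    ((Fin r → W) × (∀ j, filtHom (E j) (E j)) × (Fin s → Fin r → Fin r → k)) →ₗ[k]
      (Fin s → Fin r → W) where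
  toFun x j a := x.1 a + (x.2.1 j : W →ₗ[k] W) (b a) + ∑ b', x.2.2 j b' a • b b'
  map_add' x y := by
    funext j a
    simp only [Prod.snd_add, Prod.fst_add, Pi.add_apply, add_smul, Submodule.coe_add,
      LinearMap.add_apply, Finset.sum_add_distrib]
    abel
  map_smul' t x := by
    funext j a
    simp only [Prod.smul_snd, Prod.smul_fst, Pi.smul_apply, smul_assoc, smul_add,
      Submodule.coe_smul, LinearMap.smul_apply, Finset.smul_sum, RingHom.id_apply]

omit [FiniteDimensional k W] in
lemma endMap_apply (b : Fin r → W)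
    (x : (Fin r → W) × (∀ j, filtHom (E j) (E j)) × (Fin s → Fin r → Fin r → k)) (j : Fin s)
    (a : Fin r) : endMap E b x j a =
      x.1 a + (x.2.1 j : W →ₗ[k] W) (b a) + ∑ b', x.2.2 j b' a • b b' := rfl

lemma polyMap_endMap : PolyMap k (endMap E : (Fin r → W) → _) :=
  polyMap_hom fun x => polyMap_pi fun j => polyMap_pi fun a =>
    ((PolyMap.const (x.1 a)).add ((PolyMap.id.eval a).map (x.2.1 j : W →ₗ[k] W))).add
      (PolyMap.sum _ fun b' _ => PolyMap.smul (polyFun_const _) (PolyMap.id.eval b'))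

omit [FiniteDimensional k W] in
lemma extZero_iff_endMap_surjective (hE : ∀ j, IsFilt n (E j)) {b : Fin r → W}
    (hb : LinearIndependent k b) {V : Submodule k W} (hV : span k (Set.range b) = V) :
    ExtZero (fun j u => (E j u).comap V.subtype) (fun j u => (E j u).map V.mkQ) ↔
      Function.Surjective (endMap E b) := by
  have hbV : ∀ a, b a ∈ V := fun a => hV ▸ subset_span ⟨a, rfl⟩
  constructor
  · intro h y
    choose ρ hρ using fun j => exists_hom_of_linearIndependent hb hV fun a => V.mkQ (y j a)
    obtain ⟨Φ, hΦ⟩ := h ρ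
    choose φ hφ using fun a => V.mkQ_surjective (Φ ⟨b a, hbV a⟩)
    choose α hα hαV using fun j => exists_filtered_lift (hE j) (hE j).mono V V (hΦ j)
    have hd : ∀ j a, ∃ d : Fin r → k, ∑ b', d b' • b b' = y j a - φ a - α j (b a) := fun j a => by
      rw [← mem_span_range_iff_exists_fun, hV, ← Submodule.Quotient.mk_eq_zero,
        ← Submodule.mkQ_apply, map_sub, map_sub, hφ]
      have := hαV j ⟨b a, hbV a⟩
      rw [LinearMap.sub_apply, hρ] at this
      rw [this, sub_self]
    choose d hd using hd
    refine ⟨(φ, fun j => ⟨α j, hα j⟩, fun j b' a => d j a b'), ?_⟩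
    funext j a
    rw [endMap_apply, hd]
    abel
  · intro h ρ
    choose y hy using fun j a => V.mkQ_surjective (ρ j ⟨b a, hbV a⟩)
    obtain ⟨⟨φ, X, d⟩, hx⟩ := h y
    obtain ⟨Φ, hΦ⟩ := exists_hom_of_linearIndependent hb hV fun a => V.mkQ (φ a)
    refine ⟨Φ, fun j => ?_⟩
    have key : ρ j - Φ = V.mkQ ∘ₗ (X j : W →ₗ[k] W) ∘ₗ V.subtype := by
      subst hV
      refine (Basis.span hb).ext fun a => ?_
      have h1 : Basis.span hb a = ⟨b a, hbV a⟩ := Basis.span_apply hb a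
      have h2 := congrFun (congrFun hx j) a
      rw [endMap_apply] at h2
      have h3 : ∑ b', d j b' a • b b' ∈ span k (Set.range b) :=
        sum_mem fun b' _ => smul_mem _ _ (hbV b')
      rw [h1, LinearMap.sub_apply, hΦ, ← hy, ← h2, map_add, map_add, Submodule.mkQ_apply _ (∑ _, _),
        (Submodule.Quotient.mk_eq_zero _).2 h3]
      simp
    rw [key]
    exact fun u x hx => ⟨_, (X j).2 u x hx, rfl⟩

lemma isOpen_setOf_extZero (hE : ∀ j, IsFilt n (E j)) :
    @IsOpen _ (grTop k r) {V : Submodule k W | finrank k V = r ∧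
      ExtZero (fun j u => (E j u).comap V.subtype) (fun j u => (E j u).map V.mkQ)} := by
  refine isOpen_coinduced.2 (isOpen_of_exists_polyFun fun b hb => ?_)
  have hbi : LinearIndependent k b := linearIndependent_iff_card_le_finrank_span.2 (by
    rw [Fintype.card_fin]; exact hb.1.ge)
  obtain ⟨g, hg, hgb, hgi⟩ := exists_polyFun_linearIndependent_of hbi
  obtain ⟨g', hg', hgb', hgs⟩ := exists_polyFun_surjective (polyMap_endMap (E := E))
    ((extZero_iff_endMap_surjective hE hbi rfl).1 hb.2)
  refine ⟨g * g', mul_mem hg hg', mul_ne_zero hgb hgb', fun b' hb' => ?_⟩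
  have hbi' := hgi b' (left_ne_zero_of_mul hb')
  exact ⟨by rw [finrank_span_eq_card hbi', Fintype.card_fin],
    (extZero_iff_endMap_surjective hE hbi' rfl).2 (hgs b' (right_ne_zero_of_mul hb'))⟩

end ExtZeroOpen

section Transversality

variable {k W : Type} [Field k] [AddCommGroup W] [Module k W] [FiniteDimensional k W]
  {n r s : ℕ} {I : Fin s → Fin r → Fin n}

lemma exists_cellParams_eq (hs : 0 < s) (hW : finrank k W = n) (hI : ∀ j, Function.Injective (I j))
    {e : Fin s → Fin n → W} (he : ∀ j, LinearIndependent k (e j)) {V : Submodule k W}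
    (hV : ∀ j, cellMem (I j) (spanFlag k (e j)) V) :
    ∃ p : CellParams k W n r s, cellParams I p = e ∧ span k (Set.range p.1.1) = V := by
  choose c w hw hwV using fun j => exists_isEchelon hW (he j) (hI j) (hV j)
  let j₀ : Fin s := ⟨0, hs⟩
  have hh : ∀ j a, ∃ l : Fin r → k, ∑ b, l b • w j₀ b = w j a := fun j a => by
    rw [← mem_span_range_iff_exists_fun, hwV j₀, ← hwV j]
    exact subset_span ⟨a, rfl⟩
  choose h hh using hh
  exact ⟨((w j₀, e, fun j b a => h j a b), c), funext fun j =>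
    (hw j).cellParam_eq (hI j) (fun a => (hh j a).symm) fun _ _ => rfl, hwV j₀⟩

lemma cellMem_cellParams (hW : finrank k W = n) (hI : ∀ j, Function.Injective (I j))
    {p : CellParams k W n r s} (he : ∀ j, LinearIndependent k (cellParams I p j)) (j : Fin s) :
    cellMem (I j) (spanFlag k (cellParams I p j)) (span k (Set.range p.1.1)) := by
  rw [← span_eq_of_cellParam hW (hI j) (he j)]
  exact (isEchelon_cellParam (hI j)).cellMem hW (he j) (hI j)

lemma finrank_iInf_grTangent [Infinite k] (hs : 0 < s) (hW : finrank k W = n)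
    (hI : ∀ j, StrictMono (I j)) {e : Fin s → Fin n → W} (he : ∀ j, LinearIndependent k (e j))
    {V C : Submodule k W} (hV : ∀ j, cellMem (I j) (spanFlag k (e j)) V)
    (hext : ExtZero (fun j u => (spanFlag k (e j) u).comap V.subtype)
      (fun j u => (spanFlag k (e j) u).map V.mkQ)) (hC : IsCompl V C) :
    (finrank k ↥(⨅ j, grTangent {V' : Submodule k W | cellMem (I j) (spanFlag k (e j)) V'} V C) : ℤ)
      = r * (n - r) - ∑ j, codimZ n r (I j) := by
  have hE := fun j => isFilt_spanFlag hW (he j)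
  obtain ⟨m, hm, hm0⟩ := filtChi_add_finrank
    (fun j => (hE j).comap V.subtype V.injective_subtype)
    (fun j => (hE j).map V.mkQ V.mkQ_surjective)
  rw [iInf_congr fun j => grTangent_cell (hE j) (hV j) hC, hm, hm0.1 hext,
    ← hnChi_eq_filtChi (fun j => spanFlag k (e j)), hnChi_self_eq hW he hI hV (hV ⟨0, hs⟩).1]
  simp

lemma exists_extZero_of_mem_isOpen (hs : 0 < s) (hW : finrank k W = n)
    (hI : ∀ j, Function.Injective (I j)) {e : Fin s → Fin n → W}
    (he : ∀ j, LinearIndependent k (e j)) {τ : CellParams k W n r s → k}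
    (hτ : ∀ p, τ p ≠ 0 → Function.Surjective (cellMap I p.1))
    (hdense : ∀ p, cellParams I p = e → ∀ q ∈ polyFun k (CellParams k W n r s), q p ≠ 0 →
      ∃ p', cellParams I p' = e ∧ τ p' ≠ 0 ∧ q p' ≠ 0)
    {V : Submodule k W} (hV : ∀ j, cellMem (I j) (spanFlag k (e j)) V)
    {U : Set (Submodule k W)} (hU : @IsOpen _ (grTop k r) U) (hVU : V ∈ U) :
    ∃ V' ∈ U, (∀ j, cellMem (I j) (spanFlag k (e j)) V') ∧
      ExtZero (fun j u => (spanFlag k (e j) u).comap V'.subtype)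
        (fun j u => (spanFlag k (e j) u).map V'.mkQ) := by
  obtain ⟨p, rfl, rfl⟩ := exists_cellParams_eq hs hW hI he hV
  obtain ⟨q, hq, hqp, hqU⟩ := exists_polyFun_of_isOpen (isOpen_coinduced.1 hU) hVU
  obtain ⟨p', hp', hτp', hqp'⟩ := hdense p rfl _ (polyFun_comp hq PolyMap.id.fst.fst) hqp
  rw [← hp'] at he ⊢
  exact ⟨_, hqU _ hqp', cellMem_cellParams hW hI he,
    (extZero_iff_cellMap_surjective hW hI hs he rfl).2 (hτ p' hτp')⟩

lemma genericFlags_of_polyFun [Infinite k] (hW : finrank k W = n)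
    {P : (Fin s → ℕ → Submodule k W) → Prop} {g : (Fin s → Fin n → W) → k}
    (hg : g ∈ polyFun k (Fin s → Fin n → W)) {e₀ : Fin s → Fin n → W} (h₀ : g e₀ ≠ 0)
    (h : ∀ e, g e ≠ 0 → (∀ j, LinearIndependent k (e j)) → P fun j => spanFlag k (e j)) :
    GenericFlags k s n P := by
  obtain ⟨D, hD, ⟨e₁, h₁⟩, hDe⟩ := exists_polyFun_linearIndependent (k := k) hW s
  obtain ⟨e, he, he'⟩ := polyFun_mul_ne_zero hg hD h₀ h₁
  exact ⟨{e | g e ≠ 0}, isOpen_setOf_polyFun_ne_zero hg, ⟨e, he, hDe e he'⟩, h⟩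

end Transversality

/-- Theorem `transversality`.  For a generic `𝓔 ∈ Fl(W)^s`, the
intersection `∩_j Ω°_{I^j}(E^j_•)` has a (relatively) open dense subset of points at
which the Schubert cells meet transversally: the intersection of their tangent spaces
(computed in any chart) has dimension `dim Gr(r,n) - ∑_j codim ω_{I^j}`. -/
theorem stmt17 (k : Type) [Field k] [IsAlgClosed k]
    {W : Type} [AddCommGroup W] [Module k W] [FiniteDimensional k W]
    (n r s : ℕ) (hs : 0 < s) (hW : Module.finrank k W = n)
    (I : Fin s → Fin r → Fin n) (hI : ∀ j, StrictMono (I j)) :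
    GenericFlags k s n (fun E =>
      ∃ O : Set (Submodule k W),
        O ⊆ {V : Submodule k W | ∀ j, cellMem (I j) (E j) V} ∧
        (∃ U : Set (Submodule k W), @IsOpen _ (grTop k r) U ∧
          O = U ∩ {V : Submodule k W | ∀ j, cellMem (I j) (E j) V}) ∧
        (∀ V ∈ {V : Submodule k W | ∀ j, cellMem (I j) (E j) V},
          ∀ U : Set (Submodule k W), @IsOpen _ (grTop k r) U → V ∈ U →
            (U ∩ O).Nonempty) ∧
        ∀ V ∈ O, ∀ C : Submodule k W, IsCompl V C →
          (Module.finrank k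
              ↥(⨅ j : Fin s, grTangent {V' : Submodule k W |
                  cellMem (I j) (E j) V'} V C) : ℤ)
            = (r : ℤ) * ((n : ℤ) - (r : ℤ)) - ∑ j : Fin s, codimZ n r (I j)) := by
  have hinf : Infinite k := IsAlgClosed.instInfinite
  have hinj : ∀ j, Function.Injective (I j) := fun j => (hI j).injective
  by_cases hdom : ∀ g ∈ polyFun k (Fin s → Fin n → W),
      (∀ p : CellParams k W n r s, g (cellParams I p) = 0) → ∀ e, g e = 0
  · obtain ⟨p₀, hp₀⟩ := exists_cellMap_surjective hs hW hinj hdom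
    obtain ⟨τ, hτ, hτ0, hτs⟩ := exists_polyFun_surjective
      (polyMap_cellMap (k := k) (W := W) (I := I)) hp₀
    obtain ⟨a, ha, ⟨e₀, ha0⟩, hae⟩ := exists_polyFun_fibre
      (polyMap_cellParams (k := k) (W := W) hinj) hdom hτ ⟨p₀, hτ0⟩
    refine genericFlags_of_polyFun hW ha ha0 fun e hea he => ?_
    refine ⟨_, Set.inter_subset_right, ⟨_, isOpen_setOf_extZero (r := r)
      fun j => isFilt_spanFlag hW (he j), rfl⟩, fun V hV U hU hVU => ?_, fun V hV C hC =>
      finrank_iInf_grTangent hs hW hI he hV.2 hV.1.2 hC⟩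
    obtain ⟨V', hV'U, hV', hext⟩ := exists_extZero_of_mem_isOpen hs hW hinj he hτs
      (fun p hp q hq hqp => hp ▸ hae p (hp ▸ hea) q hq hqp) hV hU hVU
    exact ⟨V', hV'U, ⟨(hV' ⟨0, hs⟩).1, hext⟩, hV'⟩
  · push Not at hdom
    obtain ⟨g, hg, hgp, e₀, he₀⟩ := hdom
    refine genericFlags_of_polyFun hW hg he₀ fun e hge he => ?_
    refine ⟨∅, Set.empty_subset _, ⟨∅, @isOpen_empty _ (grTop k r), by simp⟩,
      fun V hV => ?_, fun V hV => hV.elim⟩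
    obtain ⟨p, hp, -⟩ := exists_cellParams_eq hs hW hinj he hV
    exact (hge (hp ▸ hgp p)).elim

end
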